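/- Let n ≥ 2 be an integer, let Γ ∈ 𝒰, let K be a homogeneous Calderón–Zygmund kernel on ℝ^n, and let p ∈ (1,∞). Then there exist constants ε > 0 and C such that for every integer l ≥ 1 and every Schwartz function f on ℝ^n one has ‖ ( ∑_{k∈ℤ} |H_{k_*+l}^{(2^k)}f(x)|^2 )^{1/2} ‖_{L^p(ℝ^n, dx)} ≤ C · 2^{−lε} ‖f‖_{L^p(ℝ^n)}, where k_* := sup{ m ∈ ℤ : 2^k Γ(2^m) ≤ 1 }, and ε, C are independent of l. -/

import Mathlib

open MeasureTheory Filter Set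
open scoped ENNReal NNReal FourierTransform Topology

noncomputable section

/-- `ℝⁿ` as a Euclidean space. -/
abbrev Rn (n : ℕ) := EuclideanSpace ℝ (Fin n)

/-- The class `𝒰` of phase functions: `Γ` is continuous on `[0,∞)`, smooth on `(0,∞)`,
`Γ(0) = 0`, `Γ′ > 0` on `(0,∞)`, with the bounds `c_{1,j} ≤ |s^j Γ^{(j)}(s)/Γ(s)|` for
`j = 1, 2` and `|s^j Γ^{(j)}(s)/Γ(s)| ≤ c_{2,j}` for all `j ≥ 1`. -/
structure IsGammaU (Γ : ℝ → ℝ) : Prop where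
  continuousOn : ContinuousOn Γ (Set.Ici 0)
  smooth : ContDiffOn ℝ (⊤ : ℕ∞) Γ (Set.Ioi 0)
  map_zero : Γ 0 = 0
  deriv_pos : ∀ s > (0 : ℝ), 0 < deriv Γ s
  lower : ∀ j ∈ ({1, 2} : Set ℕ), ∃ c > (0 : ℝ), ∀ s > (0 : ℝ),
    c ≤ |s ^ j * iteratedDeriv j Γ s / Γ s|
  upper : ∀ j : ℕ, 1 ≤ j → ∃ c > (0 : ℝ), ∀ s > (0 : ℝ),
    |s ^ j * iteratedDeriv j Γ s / Γ s| ≤ c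

/-- `K` is a homogeneous Calderón–Zygmund kernel on `ℝⁿ`: `K(t) = Ω(t)/‖t‖ⁿ` with `Ω` smooth
away from the origin, homogeneous of degree `0`, and of mean value zero on the unit sphere. -/
def IsHomCZKernel (n : ℕ) (K : Rn n → ℝ) : Prop :=
  ∃ Ω : Rn n → ℝ,
    ContDiffOn ℝ (⊤ : ℕ∞) Ω {x : Rn n | x ≠ 0} ∧
    (∀ c : ℝ, 0 < c → ∀ t : Rn n, Ω (c • t) = Ω t) ∧
    (∫ θ : Metric.sphere (0 : Rn n) 1, Ω θ ∂((volume : Measure (Rn n)).toSphere) = 0) ∧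
    (∀ t : Rn n, t ≠ 0 → K t = Ω t / ‖t‖ ^ n)

/-- The `r`-variation of a family `(a_u)_{u ∈ 𝒦}`. -/
def variation {ι : Type*} [LinearOrder ι] (r : ℝ) (𝒦 : Set ι) (a : ι → ℂ) : ℝ≥0∞ :=
  ⨆ (J : ℕ) (u : Fin (J + 1) → ι) (_ : StrictMono u) (_ : ∀ i, u i ∈ 𝒦),
    (∑ i : Fin J, (‖a (u i.succ) - a (u i.castSucc)‖₊ : ℝ≥0∞) ^ r) ^ (1 / r)

/-- The `λ`-jump counting function of a family `(a_u)_{u ∈ 𝒦}`. -/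
def jumpCount {ι : Type*} [LinearOrder ι] (lam : ℝ) (𝒦 : Set ι) (a : ι → ℂ) : ℝ≥0∞ :=
  ⨆ (J : ℕ) (s : Fin J → ι) (t : Fin J → ι) (_ : ∀ i, s i ∈ 𝒦) (_ : ∀ i, t i ∈ 𝒦)
    (_ : ∀ i, s i < t i) (_ : ∀ i j : Fin J, i < j → t i < s j)
    (_ : ∀ i, lam < ‖a (t i) - a (s i)‖), (J : ℝ≥0∞)

/-- The `L^p` norm of an `ℝ≥0∞`-valued function. -/
def lpNormENN {α : Type*} [MeasurableSpace α] (p : ℝ) (g : α → ℝ≥0∞) (μ : Measure α) : ℝ≥0∞ :=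
  (∫⁻ x, g x ^ p ∂μ) ^ (1 / p)

/-- The fixed Littlewood–Paley cutoff `ψ : ℝ → [0,1]`, supported in `{1/2 ≤ |s| ≤ 2}`,
with `∑_{l ∈ ℤ} ψ(2^{-l} s) = 1` for `s ≠ 0`. -/
def IsLPCutoff (ψ : ℝ → ℝ) : Prop :=
  ContDiff ℝ (⊤ : ℕ∞) ψ ∧ (∀ s, ψ s ∈ Set.Icc (0 : ℝ) 1) ∧
    (∀ s, ψ s ≠ 0 → |s| ∈ Set.Icc (1/2 : ℝ) 2) ∧
    (∀ s : ℝ, s ≠ 0 → HasSum (fun l : ℤ => ψ ((2 : ℝ) ^ (-l) * s)) 1)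

/-- `k_* = sup{ m ∈ ℤ : 2^k Γ(2^m) ≤ 1 }`. -/
def kstar (Γ : ℝ → ℝ) (k : ℤ) : ℤ :=
  sSup {m : ℤ | (2 : ℝ) ^ k * Γ ((2 : ℝ) ^ m) ≤ 1}

/-- The localized modulated integral `H_l^{(u)} f(x) = ∫ f(x−t) e^{iuΓ(|t|)} ψ_l(t) K(t) dt`. -/
def Hloc {n : ℕ} (Γ : ℝ → ℝ) (K : Rn n → ℝ) (ψ : ℝ → ℝ) (u : ℝ) (l : ℤ)
    (f : Rn n → ℂ) (x : Rn n) : ℂ :=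
  ∫ t : Rn n, f (x - t) * Complex.exp (Complex.I * Complex.ofReal (u * Γ ‖t‖)) *
    Complex.ofReal (ψ ((2 : ℝ) ^ (-l) * ‖t‖) * K t)

section Plancherel

variable {V F : Type*} [NormedAddCommGroup V] [InnerProductSpace ℝ V] [FiniteDimensional ℝ V]
  [MeasurableSpace V] [BorelSpace V] [NormedAddCommGroup F] [InnerProductSpace ℂ F]

theorem continuous_fourier_of_integrable {f : V → F} (hf : Integrable f) : Continuous (𝓕 f) :=
  VectorFourier.fourierIntegral_continuous Real.continuous_fourierChar
    (L := innerₗ V) continuous_inner hf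

variable [CompleteSpace F]

theorem toLp_fourier_ae_eq {f : V → F} (hf : Integrable f) (hf2 : MemLp f 2) :
    (𝓕 (hf2.toLp f) : Lp F 2 (volume : Measure V)) =ᵐ[volume] 𝓕 f := by
  refine ae_eq_of_integral_contDiff_smul_eq
    ((Lp.memLp _).locallyIntegrable (by norm_num))
    (continuous_fourier_of_integrable hf).locallyIntegrable fun g hg hgc => ?_
  have hg1 : HasCompactSupport (Complex.ofRealCLM ∘ g) := hgc.comp_left rfl
  have hg2 : ContDiff ℝ (⊤ : ℕ∞) (Complex.ofRealCLM ∘ g) := by fun_prop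
  set φ := hg1.toSchwartzMap hg2 with hφ
  have key := congrArg (fun T => T φ) (Lp.fourier_toTemperedDistribution_eq (hf2.toLp f))
  simp only [TemperedDistribution.fourier_apply, Lp.toTemperedDistribution_apply] at key
  have e1 : ∀ h : V → F, ∫ x, g x • h x = ∫ x, φ x • h x := fun h => by
    congr 1
  rw [e1, e1, ← key]
  have e2 : ∫ x, (𝓕 φ) x • (hf2.toLp f) x = ∫ x, (𝓕 φ) x • f x := by
    apply integral_congr_ae
    filter_upwards [hf2.coeFn_toLp] with x hx
    rw [hx]
  rw [e2, SchwartzMap.fourier_coe]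
  exact VectorFourier.integral_fourierIntegral_smul_eq_flip (L := innerₗ V)
    Real.continuous_fourierChar continuous_inner φ.integrable hf |>.trans (by
      congr 1; ext x; rw [flip_innerₗ]; rfl)

/-- Plancherel's identity for functions in `L¹ ∩ L²`. -/
theorem lintegral_enorm_fourier_sq {f : V → F} (hf : Integrable f) (hf2 : MemLp f 2) :
    ∫⁻ ξ, ‖𝓕 f ξ‖ₑ ^ 2 = ∫⁻ x, ‖f x‖ₑ ^ 2 := by
  have h1 : eLpNorm (𝓕 f) 2 volume = eLpNorm f 2 volume := by
    rw [← eLpNorm_congr_ae (toLp_fourier_ae_eq hf hf2), ← eLpNorm_congr_ae hf2.coeFn_toLp,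
      ← Lp.enorm_def, ← Lp.enorm_def, enorm_eq_iff_norm_eq]
    exact Lp.norm_fourier_eq _
  have h2 := congrArg (· ^ (2 : ℝ)) h1
  simp only [eLpNorm_eq_lintegral_rpow_enorm_toReal two_ne_zero ENNReal.ofNat_ne_top,
    ← ENNReal.rpow_mul] at h2
  simpa using h2

/-- A pointwise bound on the symbol of a convolution operator bounds it on `L²`. -/
theorem lintegral_enorm_convolution_sq_le {F₁ F₂ F₃ : Type*} [NormedAddCommGroup F₁]
    [InnerProductSpace ℂ F₁] [CompleteSpace F₁] [NormedAddCommGroup F₂] [InnerProductSpace ℂ F₂]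
    [CompleteSpace F₂] [NormedAddCommGroup F₃] [InnerProductSpace ℂ F₃] [CompleteSpace F₃]
    (B : F₁ →L[ℂ] F₂ →L[ℂ] F₃) (hB : ∀ w v, ‖B w v‖ ≤ ‖w‖ * ‖v‖) {K : V → F₁} {f : V → F₂}
    (hK : Integrable K) (hf : Integrable f) (hf2 : MemLp f 2)
    (hKf : MemLp (convolution K f B volume) 2) {A : ℝ≥0∞} (hA : ∀ ξ, ‖𝓕 K ξ‖ₑ ^ 2 ≤ A) :
    ∫⁻ x, ‖convolution K f B volume x‖ₑ ^ 2 ≤ A * ∫⁻ x, ‖f x‖ₑ ^ 2 := by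
  rw [← lintegral_enorm_fourier_sq (hK.integrable_convolution B hf) hKf,
    ← lintegral_enorm_fourier_sq hf hf2, ← lintegral_const_mul]
  · refine lintegral_mono fun ξ => ?_
    dsimp only
    rw [Real.fourier_bilin_convolution_eq B hK hf]
    calc ‖B (𝓕 K ξ) (𝓕 f ξ)‖ₑ ^ 2 ≤ (‖𝓕 K ξ‖ₑ * ‖𝓕 f ξ‖ₑ) ^ 2 := by
          gcongr
          rw [← ofReal_norm, ← ofReal_norm, ← ofReal_norm, ← ENNReal.ofReal_mul (norm_nonneg _)]
          exact ENNReal.ofReal_le_ofReal (hB _ _)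
      _ ≤ _ := by rw [mul_pow]; gcongr; exact hA ξ
  · exact (continuous_fourier_of_integrable hf).enorm.measurable.pow_const 2

end Plancherel

section Dyadic

variable {n : ℕ}

/-- The index of the dyadic cube of side `2 ^ m` that contains `x`. -/
def dyadicIndex (m : ℤ) (x : Rn n) : Fin n → ℤ := fun i => ⌊(2 : ℝ) ^ (-m) * x i⌋

/-- The dyadic cube of side `2 ^ m` that contains `x`. -/
def dyadicCube (m : ℤ) (x : Rn n) : Set (Rn n) := {y | dyadicIndex m y = dyadicIndex m x}

/-- The lower corner of the dyadic cube of side `2 ^ m` with index `z`. -/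
def dyadicCorner (m : ℤ) (z : Fin n → ℤ) : Rn n := WithLp.toLp 2 fun i => (2 : ℝ) ^ m * z i

theorem measurable_dyadicIndex (m : ℤ) : Measurable (dyadicIndex m : Rn n → Fin n → ℤ) := by
  unfold dyadicIndex
  fun_prop

theorem measurableSet_dyadicCube (m : ℤ) (x : Rn n) : MeasurableSet (dyadicCube m x) :=
  measurable_dyadicIndex m (measurableSet_singleton _)

theorem dyadicIndex_succ (m : ℤ) (x : Rn n) :
    dyadicIndex (m + 1) x = fun i => dyadicIndex m x i / 2 := by
  ext i
  simp only [dyadicIndex]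
  have h : (2 : ℝ) ^ (-(m + 1)) * x i = (2 : ℝ) ^ (-m) * x i / ((2 : ℕ) : ℝ) := by
    rw [neg_add, zpow_add₀ two_ne_zero]; simp; ring
  rw [h, Int.floor_div_natCast]; rfl

theorem dyadicIndex_eq_of_le {m m' : ℤ} (h : m ≤ m') {x y : Rn n}
    (hxy : dyadicIndex m y = dyadicIndex m x) : dyadicIndex m' y = dyadicIndex m' x := by
  induction m', h using Int.leInduction with
  | base => exact hxy
  | succ k _ ih => rw [dyadicIndex_succ, dyadicIndex_succ, ih]

theorem volume_dyadicCube (m : ℤ) (x : Rn n) :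
    volume (dyadicCube m x) = ENNReal.ofReal (((2 : ℝ) ^ m) ^ n) := by
  have h2 : (0 : ℝ) < 2 ^ m := by positivity
  have h : dyadicCube m x = (MeasurableEquiv.toLp 2 (Fin n → ℝ)).symm ⁻¹'
      (Set.pi univ fun i => Ico ((2 : ℝ) ^ m * dyadicIndex m x i)
        ((2 : ℝ) ^ m * (dyadicIndex m x i + 1))) := by
    ext y
    simp only [dyadicCube, mem_ofPred_eq, mem_preimage, Set.mem_pi, mem_univ, true_imp_iff, mem_Ico]
    rw [funext_iff]
    refine forall_congr' fun i => ?_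
    change ⌊(2 : ℝ) ^ (-m) * y i⌋ = _ ↔ _ ≤ y i ∧ y i < _
    rw [Int.floor_eq_iff, zpow_neg, inv_mul_eq_div, le_div_iff₀ h2, div_lt_iff₀ h2, mul_comm,
      mul_comm _ ((2 : ℝ) ^ m)]
  rw [h, (EuclideanSpace.volume_preserving_symm_measurableEquiv_toLp
    (Fin n)).measure_preimage_equiv, volume_pi_pi]
  simp only [Real.volume_Ico]
  have : ∀ i : Fin n, (2 : ℝ) ^ m * (dyadicIndex m x i + 1) - 2 ^ m * dyadicIndex m x i = 2 ^ m :=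
    fun i => by ring
  simp [this, ENNReal.ofReal_pow h2.le]

theorem norm_sub_dyadicCorner_le (m : ℤ) (x : Rn n) :
    ‖x - dyadicCorner m (dyadicIndex m x)‖ ≤ √n * 2 ^ m := by
  have h2 : (0 : ℝ) < 2 ^ m := by positivity
  rw [EuclideanSpace.norm_eq, ← Real.sqrt_sq h2.le, ← Real.sqrt_mul (Nat.cast_nonneg _)]
  apply Real.sqrt_le_sqrt
  calc ∑ i, ‖(x - dyadicCorner m (dyadicIndex m x)) i‖ ^ 2 ≤ ∑ i : Fin n, ((2 : ℝ) ^ m) ^ 2 := by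
        gcongr with i
        have e : (x - dyadicCorner m (dyadicIndex m x)) i
            = 2 ^ m * Int.fract ((2 : ℝ) ^ (-m) * x i) := by
          change x i - 2 ^ m * (⌊(2 : ℝ) ^ (-m) * x i⌋ : ℝ) = _
          rw [Int.fract, mul_sub, ← mul_assoc, ← zpow_add₀ two_ne_zero]; simp
        rw [e, norm_mul, Real.norm_of_nonneg h2.le, Real.norm_of_nonneg (Int.fract_nonneg _)]
        exact mul_le_of_le_one_right h2.le (Int.fract_lt_one _).le
    _ = _ := by simp

theorem norm_sub_le_of_mem_dyadicCube {m : ℤ} {x y : Rn n} (h : y ∈ dyadicCube m x) :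
    ‖y - x‖ ≤ 2 * √n * 2 ^ m := by
  have h1 := norm_sub_dyadicCorner_le m x
  have h2 := norm_sub_dyadicCorner_le m y
  rw [show dyadicIndex m y = dyadicIndex m x from h] at h2
  have := norm_sub_le_norm_sub_add_norm_sub y (dyadicCorner m (dyadicIndex m x)) x
  rw [norm_sub_rev (dyadicCorner _ _) x] at this
  linarith

end Dyadic

section Stopping

variable {n : ℕ} {u : Rn n → ℝ≥0∞} {s : ℝ≥0∞}

/-- The average of `u` over the dyadic cube of side `2 ^ m` that contains `x` exceeds `s`. -/
def IsHeavy (u : Rn n → ℝ≥0∞) (s : ℝ≥0∞) (m : ℤ) (x : Rn n) : Prop :=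
  s * volume (dyadicCube m x) < ∫⁻ y in dyadicCube m x, u y

/-- The union of the heavy dyadic cubes. -/
def heavySet (u : Rn n → ℝ≥0∞) (s : ℝ≥0∞) : Set (Rn n) := {x | ∃ m, IsHeavy u s m x}

/-- The scale of the maximal heavy dyadic cube that contains `x`. -/
def heavyScale (u : Rn n → ℝ≥0∞) (s : ℝ≥0∞) (x : Rn n) : ℤ := sSup {m | IsHeavy u s m x}

/-- The scale and the index of the maximal heavy dyadic cube that contains `x`. -/
def heavyIndex (u : Rn n → ℝ≥0∞) (s : ℝ≥0∞) (x : Rn n) : ℤ × (Fin n → ℤ) :=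
  (heavyScale u s x, dyadicIndex (heavyScale u s x) x)

/-- The maximal heavy dyadic cube with given scale and index, or the empty set. -/
def heavyPiece (u : Rn n → ℝ≥0∞) (s : ℝ≥0∞) (i : ℤ × (Fin n → ℤ)) : Set (Rn n) :=
  {x | x ∈ heavySet u s ∧ heavyIndex u s x = i}

theorem dyadicCube_eq_of_le {m m' : ℤ} (h : m ≤ m') {x y : Rn n} (hy : y ∈ dyadicCube m x) :
    dyadicCube m' y = dyadicCube m' x := by
  unfold dyadicCube
  rw [dyadicIndex_eq_of_le h hy]

theorem isHeavy_iff_of_le {m m' : ℤ} (h : m ≤ m') {x y : Rn n} (hy : y ∈ dyadicCube m x) :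
    IsHeavy u s m' y ↔ IsHeavy u s m' x := by
  unfold IsHeavy
  rw [dyadicCube_eq_of_le h hy]

theorem bddAbove_isHeavy (hn : n ≠ 0) (hs : s ≠ 0) (hs' : s ≠ ⊤) (hu : ∫⁻ x, u x ≠ ⊤)
    (x : Rn n) : BddAbove {m | IsHeavy u s m x} := by
  have hI : (∫⁻ x, u x) / s ≠ ⊤ := ENNReal.div_ne_top hu hs
  obtain ⟨M, hM⟩ := pow_unbounded_of_one_lt ((∫⁻ x, u x) / s).toReal (one_lt_two)
  refine ⟨M, fun m hm => ?_⟩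
  by_contra! hlt
  have hm' : s * volume (dyadicCube m x) < ∫⁻ x, u x :=
    lt_of_lt_of_le hm (setLIntegral_le_lintegral _ _)
  rw [volume_dyadicCube, mul_comm, ← ENNReal.lt_div_iff_mul_lt (Or.inl hs) (Or.inl hs'),
    ENNReal.ofReal_lt_iff_lt_toReal (by positivity) hI] at hm'
  have h1 : (2 : ℝ) ^ M ≤ 2 ^ m := by
    rw [← zpow_natCast]
    exact zpow_le_zpow_right₀ one_le_two hlt.le
  have h2 : (2 : ℝ) ^ m ≤ (2 ^ m) ^ n :=
    le_self_pow₀ ((one_le_pow₀ one_le_two).trans h1) hn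
  linarith

theorem isHeavy_heavyScale (hn : n ≠ 0) (hs : s ≠ 0) (hs' : s ≠ ⊤) (hu : ∫⁻ x, u x ≠ ⊤)
    {x : Rn n} (hx : x ∈ heavySet u s) : IsHeavy u s (heavyScale u s x) x :=
  Int.csSup_mem hx (bddAbove_isHeavy hn hs hs' hu x)

theorem heavyPiece_heavyIndex (hn : n ≠ 0) (hs : s ≠ 0) (hs' : s ≠ ⊤) (hu : ∫⁻ x, u x ≠ ⊤)
    {x : Rn n} (hx : x ∈ heavySet u s) :
    heavyPiece u s (heavyIndex u s x) = dyadicCube (heavyScale u s x) x := by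
  ext y
  constructor
  · rintro ⟨hy, h⟩
    have h1 : heavyScale u s y = heavyScale u s x := congrArg Prod.fst h
    have h2 := congrArg Prod.snd h
    simp only [heavyIndex, h1] at h2
    exact h2
  · intro hy
    have hb := isHeavy_heavyScale hn hs hs' hu hx
    have hby := (isHeavy_iff_of_le le_rfl hy).2 hb
    have hyΩ : y ∈ heavySet u s := ⟨_, hby⟩
    have h1 : heavyScale u s x ≤ heavyScale u s y := le_csSup (bddAbove_isHeavy hn hs hs' hu y) hby
    have h2 : heavyScale u s y ≤ heavyScale u s x :=
      le_csSup (bddAbove_isHeavy hn hs hs' hu x)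
        ((isHeavy_iff_of_le h1 hy).1 (isHeavy_heavyScale hn hs hs' hu hyΩ))
    have h3 := le_antisymm h2 h1
    refine ⟨hyΩ, Prod.ext h3 ?_⟩
    simp only [heavyIndex, h3]
    exact hy

theorem heavyPiece_eq_empty_or (hn : n ≠ 0) (hs : s ≠ 0) (hs' : s ≠ ⊤) (hu : ∫⁻ x, u x ≠ ⊤)
    (i : ℤ × (Fin n → ℤ)) : heavyPiece u s i = ∅ ∨ ∃ x ∈ heavySet u s, i = heavyIndex u s x ∧
      heavyPiece u s i = dyadicCube (heavyScale u s x) x := by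
  rcases (heavyPiece u s i).eq_empty_or_nonempty with h | ⟨x, hx, rfl⟩
  · exact Or.inl h
  · exact Or.inr ⟨x, hx, rfl, heavyPiece_heavyIndex hn hs hs' hu hx⟩

theorem measurableSet_heavyPiece (hn : n ≠ 0) (hs : s ≠ 0) (hs' : s ≠ ⊤) (hu : ∫⁻ x, u x ≠ ⊤)
    (i : ℤ × (Fin n → ℤ)) : MeasurableSet (heavyPiece u s i) := by
  rcases heavyPiece_eq_empty_or hn hs hs' hu i with h | ⟨x, -, -, h⟩
  · simp [h]
  · rw [h]; exact measurableSet_dyadicCube _ _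

theorem iUnion_heavyPiece : ⋃ i, heavyPiece u s i = heavySet u s := by
  ext x
  simp [heavyPiece]

theorem pairwise_disjoint_heavyPiece : Pairwise (Function.onFun Disjoint (heavyPiece u s)) := by
  intro i j hij
  rw [Function.onFun, Set.disjoint_left]
  rintro x ⟨_, rfl⟩ ⟨_, h⟩
  exact hij h

theorem measurableSet_heavySet (hn : n ≠ 0) (hs : s ≠ 0) (hs' : s ≠ ⊤) (hu : ∫⁻ x, u x ≠ ⊤) :
    MeasurableSet (heavySet u s) := by
  rw [← iUnion_heavyPiece]
  exact MeasurableSet.iUnion (measurableSet_heavyPiece hn hs hs' hu)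

theorem mul_volume_heavyPiece_le (hn : n ≠ 0) (hs : s ≠ 0) (hs' : s ≠ ⊤) (hu : ∫⁻ x, u x ≠ ⊤)
    (i : ℤ × (Fin n → ℤ)) :
    s * volume (heavyPiece u s i) ≤ ∫⁻ y in heavyPiece u s i, u y := by
  rcases heavyPiece_eq_empty_or hn hs hs' hu i with h | ⟨x, hx, -, h⟩
  · simp [h]
  · rw [h]; exact (isHeavy_heavyScale hn hs hs' hu hx).le

theorem volume_dyadicCube_succ (m : ℤ) (x : Rn n) :
    volume (dyadicCube (m + 1) x) = 2 ^ n * volume (dyadicCube m x) := by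
  rw [volume_dyadicCube, volume_dyadicCube, zpow_add₀ two_ne_zero, mul_pow,
    ENNReal.ofReal_mul (by positivity), mul_comm]
  congr 1
  simp [ENNReal.ofReal_pow]

theorem lintegral_heavyPiece_le (hn : n ≠ 0) (hs : s ≠ 0) (hs' : s ≠ ⊤) (hu : ∫⁻ x, u x ≠ ⊤)
    (i : ℤ × (Fin n → ℤ)) :
    ∫⁻ y in heavyPiece u s i, u y ≤ 2 ^ n * s * volume (heavyPiece u s i) := by
  rcases heavyPiece_eq_empty_or hn hs hs' hu i with h | ⟨x, hx, -, h⟩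
  · simp [h]
  · rw [h]
    have h1 : ¬ IsHeavy u s (heavyScale u s x + 1) x := fun h2 => by
      have := le_csSup (bddAbove_isHeavy hn hs hs' hu x) h2
      change heavyScale u s x + 1 ≤ heavyScale u s x at this
      omega
    rw [IsHeavy, not_lt, volume_dyadicCube_succ] at h1
    calc _ ≤ ∫⁻ y in dyadicCube (heavyScale u s x + 1) x, u y :=
          lintegral_mono_set fun y hy => dyadicIndex_eq_of_le (by omega) hy
      _ ≤ _ := h1.trans_eq (by ring)

theorem lintegral_heavySet_le (hn : n ≠ 0) (hs : s ≠ 0) (hs' : s ≠ ⊤) (hu : ∫⁻ x, u x ≠ ⊤) :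
    ∫⁻ y in heavySet u s, u y ≤ 2 ^ n * s * volume (heavySet u s) := by
  rw [← iUnion_heavyPiece, lintegral_iUnion (measurableSet_heavyPiece hn hs hs' hu)
    pairwise_disjoint_heavyPiece, measure_iUnion pairwise_disjoint_heavyPiece
    (measurableSet_heavyPiece hn hs hs' hu), ← ENNReal.tsum_mul_left]
  exact ENNReal.tsum_le_tsum (lintegral_heavyPiece_le hn hs hs' hu)

theorem volume_heavyPiece_ne_top (hn : n ≠ 0) (hs : s ≠ 0) (hs' : s ≠ ⊤) (hu : ∫⁻ x, u x ≠ ⊤)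
    (i : ℤ × (Fin n → ℤ)) : volume (heavyPiece u s i) ≠ ⊤ := by
  rcases heavyPiece_eq_empty_or hn hs hs' hu i with h | ⟨x, -, -, h⟩
  · simp [h]
  · rw [h, volume_dyadicCube]; exact ENNReal.ofReal_ne_top

/-- The weak type bound for the union of the heavy cubes. -/
theorem mul_volume_heavySet_le (hn : n ≠ 0) (hs : s ≠ 0) (hs' : s ≠ ⊤) (hu : ∫⁻ x, u x ≠ ⊤)
    (hum : Measurable u) :
    s / 2 * volume (heavySet u s) ≤ ∫⁻ y in {y | s / 2 < u y}, u y := by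
  have hP := measurableSet_heavyPiece hn hs hs' hu
  have hm : MeasurableSet {y | s / 2 < u y} := measurableSet_lt measurable_const hum
  have key : ∀ i, s / 2 * volume (heavyPiece u s i)
      ≤ ∫⁻ y in heavyPiece u s i, {y | s / 2 < u y}.indicator u y := fun i => by
    have h1 : s / 2 * volume (heavyPiece u s i) + s / 2 * volume (heavyPiece u s i)
        ≤ (∫⁻ y in heavyPiece u s i, {y | s / 2 < u y}.indicator u y)
          + s / 2 * volume (heavyPiece u s i) := by
      rw [← add_mul, ENNReal.add_halves]
      refine (mul_volume_heavyPiece_le hn hs hs' hu i).trans ?_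
      rw [← setLIntegral_const, ← lintegral_add_right _ measurable_const]
      refine lintegral_mono fun y => ?_
      by_cases hy : s / 2 < u y
      · simp [indicator, hy]
      · rw [indicator_of_notMem (by exact hy), zero_add]
        exact not_lt.1 hy
    refine (ENNReal.add_le_add_iff_right ?_).1 h1
    exact ENNReal.mul_ne_top (ENNReal.div_ne_top hs' two_ne_zero)
      (volume_heavyPiece_ne_top hn hs hs' hu i)
  calc s / 2 * volume (heavySet u s) = ∑' i, s / 2 * volume (heavyPiece u s i) := by
        rw [← iUnion_heavyPiece, measure_iUnion pairwise_disjoint_heavyPiece hP,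
          ENNReal.tsum_mul_left]
    _ ≤ ∑' i, ∫⁻ y in heavyPiece u s i, {y | s / 2 < u y}.indicator u y :=
        ENNReal.tsum_le_tsum key
    _ = ∫⁻ y in heavySet u s, {y | s / 2 < u y}.indicator u y := by
        rw [← lintegral_iUnion hP pairwise_disjoint_heavyPiece, iUnion_heavyPiece]
    _ ≤ _ := (setLIntegral_le_lintegral _ _).trans_eq (lintegral_indicator hm _)

theorem volume_heavySet_ne_top (hn : n ≠ 0) (hs : s ≠ 0) (hs' : s ≠ ⊤) (hu : ∫⁻ x, u x ≠ ⊤)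
    (hum : Measurable u) : volume (heavySet u s) ≠ ⊤ := fun h => by
  have := (mul_volume_heavySet_le hn hs hs' hu hum).trans (setLIntegral_le_lintegral _ _)
  rw [h, ENNReal.mul_top (ENNReal.div_ne_zero.2 ⟨hs, ENNReal.ofNat_ne_top⟩), top_le_iff] at this
  exact hu this

theorem exists_dyadicCube_subset {x : Rn n} {U : Set (Rn n)} (hU : U ∈ 𝓝 x) :
    ∃ m : ℤ, dyadicCube m x ⊆ U := by
  obtain ⟨r, hr, hrU⟩ := Metric.mem_nhds_iff.1 hU
  obtain ⟨k, hk⟩ := exists_pow_lt_of_lt_one (show 0 < r / (2 * √n + 1) by positivity)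
    (show (1 / 2 : ℝ) < 1 by norm_num)
  refine ⟨-k, fun y hy => hrU ?_⟩
  rw [Metric.mem_ball, dist_eq_norm]
  refine (norm_sub_le_of_mem_dyadicCube hy).trans_lt ?_
  rw [zpow_neg, zpow_natCast, ← inv_pow, ← one_div]
  rw [lt_div_iff₀ (by positivity)] at hk
  nlinarith [show (0 : ℝ) < (1 / 2) ^ k by positivity]

theorem le_of_notMem_heavySet (hu : Continuous u) {x : Rn n} (hx : x ∉ heavySet u s) :
    u x ≤ s := by
  by_contra! h
  obtain ⟨t, hst, htu⟩ := exists_between h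
  obtain ⟨m, hm⟩ := exists_dyadicCube_subset (hu.tendsto x (Ioi_mem_nhds htu))
  refine hx ⟨m, ?_⟩
  have h0 : volume (dyadicCube m x) ≠ 0 := by
    rw [volume_dyadicCube]; simp; positivity
  have h1 : volume (dyadicCube m x) ≠ ⊤ := by
    rw [volume_dyadicCube]; simp
  calc s * volume (dyadicCube m x) < t * volume (dyadicCube m x) := by
        exact ENNReal.mul_lt_mul_left h0 h1 hst
    _ = ∫⁻ y in dyadicCube m x, t := by simp
    _ ≤ _ := setLIntegral_mono hu.measurable fun y hy => (hm hy).le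

end Stopping

theorem lintegral_enorm_ne_top {n : ℕ} {F : Type*} [NormedAddCommGroup F] {f : Rn n → F}
    (hf : Integrable f) : ∫⁻ x, ‖f x‖ₑ ≠ ⊤ := hf.2.ne

section KernelOperator

variable {n : ℕ} {F₁ F₂ F₃ : Type*} [NormedAddCommGroup F₁] [NormedSpace ℂ F₁]
  [NormedAddCommGroup F₂] [NormedSpace ℂ F₂] [NormedAddCommGroup F₃] [NormedSpace ℂ F₃]
  {B : F₁ →L[ℂ] F₂ →L[ℂ] F₃} {K : Rn n → F₁} {f g b : Rn n → F₂}

/-- The convolution operator with kernel `K`, with respect to the bilinear map `B`. -/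
def kernelOp (B : F₁ →L[ℂ] F₂ →L[ℂ] F₃) (K : Rn n → F₁) (g : Rn n → F₂) (x : Rn n) : F₃ :=
  ∫ y, B (K (x - y)) (g y)

/-- A bilinear map of norm at most one. -/
def IsContractive (B : F₁ →L[ℂ] F₂ →L[ℂ] F₃) : Prop := ∀ w v, ‖B w v‖ ≤ ‖w‖ * ‖v‖

theorem IsContractive.enorm_le (hB : IsContractive B) (w : F₁) (v : F₂) :
    ‖B w v‖ₑ ≤ ‖w‖ₑ * ‖v‖ₑ := by
  rw [← ofReal_norm, ← ofReal_norm, ← ofReal_norm, ← ENNReal.ofReal_mul (norm_nonneg _)]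
  exact ENNReal.ofReal_le_ofReal (hB w v)

theorem aestronglyMeasurable_bilin {μ : Measure (Rn n)} {k : Rn n → F₁}
    (hk : AEStronglyMeasurable k μ) (hg : AEStronglyMeasurable g μ) :
    AEStronglyMeasurable (fun y => B (k y) (g y)) μ :=
  B.aestronglyMeasurable_comp₂ hk hg

theorem integrable_bilin (hB : IsContractive B) {μ : Measure (Rn n)} {k : Rn n → F₁}
    (hk : AEStronglyMeasurable k μ) {M : ℝ} (hM : ∀ x, ‖k x‖ ≤ M) (hg : Integrable g μ) :
    Integrable (fun y => B (k y) (g y)) μ := by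
  refine (hg.norm.const_mul M).mono' (aestronglyMeasurable_bilin hk hg.1) (.of_forall fun y => ?_)
  exact (hB _ _).trans (by gcongr; exact hM y)

theorem integrable_kernelOp (hB : IsContractive B) (hK : Continuous K) {M : ℝ}
    (hM : ∀ x, ‖K x‖ ≤ M) (hg : Integrable g) (x : Rn n) :
    Integrable (fun y => B (K (x - y)) (g y)) :=
  integrable_bilin hB (hK.comp (by fun_prop)).aestronglyMeasurable (fun y => hM (x - y)) hg

theorem continuous_kernelOp (hB : IsContractive B) (hK : Continuous K) {M : ℝ}
    (hM : ∀ x, ‖K x‖ ≤ M) (hg : Integrable g) : Continuous (kernelOp B K g) := by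
  refine continuous_of_dominated (bound := fun y => M * ‖g y‖)
    (fun x => (integrable_kernelOp hB hK hM hg x).1) (fun x => .of_forall fun y => ?_)
    (hg.norm.const_mul M) (.of_forall fun y => by fun_prop)
  exact (hB _ _).trans (by gcongr; exact hM _)

theorem kernelOp_add (hB : IsContractive B) (hK : Continuous K) {M : ℝ}
    (hM : ∀ x, ‖K x‖ ≤ M) (hg : Integrable g) (hb : Integrable b) (x : Rn n) :
    kernelOp B K (g + b) x = kernelOp B K g x + kernelOp B K b x := by
  unfold kernelOp
  rw [← integral_add (integrable_kernelOp hB hK hM hg x) (integrable_kernelOp hB hK hM hb x)]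
  simp

/-- Cancellation of a mean zero function against the kernel. -/
theorem enorm_setIntegral_kernel_le [CompleteSpace F₂] [CompleteSpace F₃] (hB : IsContractive B)
    (hK : Continuous K) {M : ℝ} (hM : ∀ x, ‖K x‖ ≤ M) (hb : Integrable b) {Q : Set (Rn n)}
    (h0 : ∫ y in Q, b y = 0) (c x : Rn n) :
    ‖∫ y in Q, B (K (x - y)) (b y)‖ₑ ≤ ∫⁻ y in Q, ‖K (x - y) - K (x - c)‖ₑ * ‖b y‖ₑ := by
  have h1 : ∫ y in Q, B (K (x - c)) (b y) = 0 := by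
    rw [ContinuousLinearMap.integral_comp_comm _ hb.integrableOn, h0, map_zero]
  have h2 : ∫ y in Q, B (K (x - y)) (b y) = ∫ y in Q, B (K (x - y) - K (x - c)) (b y) := by
    simp_rw [map_sub, sub_apply]
    rw [integral_sub (integrable_kernelOp hB hK hM hb x).integrableOn
      ((B (K (x - c))).integrable_comp hb.integrableOn), h1, sub_zero]
  rw [h2]
  exact (enorm_integral_le_lintegral_enorm _).trans (lintegral_mono fun y => hB.enorm_le _ _)

omit [NormedSpace ℂ F₁] [NormedSpace ℂ F₂] in
/-- The integral form of Hörmander's condition, away from the support of `b`. -/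
theorem lintegral_kernel_difference_le (hK : Continuous K) {H : ℝ≥0∞}
    (hH : ∀ w : Rn n, ∫⁻ z in {z | 2 * ‖w‖ ≤ ‖z‖}, ‖K (z - w) - K z‖ₑ ≤ H)
    (hb : Integrable b) {Q E : Set (Rn n)} (hQm : MeasurableSet Q) {c : Rn n} {ρ : ℝ}
    (hQ : ∀ y ∈ Q, ‖y - c‖ ≤ ρ)
    (hE : ∀ x ∈ E, 2 * ρ ≤ ‖x - c‖) :
    ∫⁻ x in E, ∫⁻ y in Q, ‖K (x - y) - K (x - c)‖ₑ * ‖b y‖ₑ ≤ H * ∫⁻ y in Q, ‖b y‖ₑ := by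
  have hm : AEMeasurable (Function.uncurry fun (x y : Rn n) =>
      ‖K (x - y) - K (x - c)‖ₑ * ‖b y‖ₑ) ((volume.restrict E).prod (volume.restrict Q)) := by
    have h1 : Continuous fun p : Rn n × Rn n => ‖K (p.1 - p.2) - K (p.1 - c)‖ₑ :=
      Continuous.enorm (by fun_prop)
    exact h1.measurable.aemeasurable.mul (hb.1.restrict.comp_snd).enorm
  rw [lintegral_lintegral_swap hm]
  calc ∫⁻ y in Q, ∫⁻ x in E, ‖K (x - y) - K (x - c)‖ₑ * ‖b y‖ₑ
      ≤ ∫⁻ y in Q, H * ‖b y‖ₑ := by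
        refine setLIntegral_mono' hQm fun y hy => ?_
        have hk : Measurable fun x => ‖K (x - y) - K (x - c)‖ₑ :=
          (Continuous.enorm (by fun_prop)).measurable
        rw [lintegral_mul_const _ hk]
        gcongr
        calc ∫⁻ x in E, ‖K (x - y) - K (x - c)‖ₑ
            ≤ ∫⁻ x, {x | 2 * ‖y - c‖ ≤ ‖x - c‖}.indicator
                (fun x => ‖K (x - y) - K (x - c)‖ₑ) x := by
              rw [lintegral_indicator
                (measurableSet_le (by fun_prop) (by fun_prop))]
              refine lintegral_mono_set fun x hx => ?_
              have := hQ y hy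
              have := hE x hx
              simp only [mem_ofPred_eq]; linarith
          _ = ∫⁻ x, {z | 2 * ‖y - c‖ ≤ ‖z‖}.indicator
                (fun z => ‖K (z - (y - c)) - K z‖ₑ) (x - c) := by
              congr 1 with x
              simp only [indicator, mem_ofPred_eq]
              rw [show x - c - (y - c) = x - y by abel]
          _ = ∫⁻ z, {z | 2 * ‖y - c‖ ≤ ‖z‖}.indicator (fun z => ‖K (z - (y - c)) - K z‖ₑ) z :=
              lintegral_sub_right_eq_self _ c
          _ ≤ H := by
              rw [lintegral_indicator (measurableSet_le (by fun_prop) (by fun_prop))]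
              exact hH _
    _ = H * ∫⁻ y in Q, ‖b y‖ₑ := lintegral_const_mul'' _ hb.1.restrict.enorm

/-- The good part of the Calderón–Zygmund decomposition. -/
def goodPart (f : Rn n → F₂) (s : ℝ≥0∞) (y : Rn n) : F₂ :=
  open Classical in
  if y ∈ heavySet (fun z => ‖f z‖ₑ) s then
    ⨍ z in heavyPiece (fun z => ‖f z‖ₑ) s (heavyIndex (fun z => ‖f z‖ₑ) s y), f z
  else f y

variable {s : ℝ≥0∞}

theorem goodPart_of_notMem {y : Rn n} (hy : y ∉ heavySet (fun z => ‖f z‖ₑ) s) :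
    goodPart f s y = f y := by simp [goodPart, hy]

theorem goodPart_of_mem_heavyPiece {y : Rn n} {i : ℤ × (Fin n → ℤ)}
    (hy : y ∈ heavyPiece (fun z => ‖f z‖ₑ) s i) :
    goodPart f s y = ⨍ z in heavyPiece (fun z => ‖f z‖ₑ) s i, f z := by
  simp [goodPart, hy.1, hy.2]

theorem aestronglyMeasurable_goodPart (hn : n ≠ 0) (hs : s ≠ 0) (hs' : s ≠ ⊤)
    (hf : Integrable f) : AEStronglyMeasurable (goodPart f s) := by
  have hu := lintegral_enorm_ne_top hf
  have hΩ := measurableSet_heavySet hn hs hs' hu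
  rw [← Measure.restrict_univ (μ := volume), ← union_compl_self (heavySet (fun z => ‖f z‖ₑ) s),
    aestronglyMeasurable_union_iff]
  constructor
  · rw [← iUnion_heavyPiece, aestronglyMeasurable_iUnion_iff]
    intro i
    refine AEStronglyMeasurable.congr (f := fun _ => ⨍ z in heavyPiece (fun z => ‖f z‖ₑ) s i, f z)
      aestronglyMeasurable_const ?_
    filter_upwards [ae_restrict_mem (measurableSet_heavyPiece hn hs hs' hu i)] with y hy
    exact (goodPart_of_mem_heavyPiece hy).symm
  · refine hf.1.restrict.congr ?_
    filter_upwards [ae_restrict_mem hΩ.compl] with y hy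
    exact (goodPart_of_notMem hy).symm

theorem enorm_goodPart_le_of_notMem (hfc : Continuous f) {y : Rn n}
    (hy : y ∉ heavySet (fun z => ‖f z‖ₑ) s) : ‖goodPart f s y‖ₑ ≤ s := by
  rw [goodPart_of_notMem hy]
  exact le_of_notMem_heavySet hfc.enorm hy

theorem enorm_goodPart_le_of_mem (hn : n ≠ 0) (hs : s ≠ 0) (hs' : s ≠ ⊤) (hf : Integrable f)
    {y : Rn n} (hy : y ∈ heavySet (fun z => ‖f z‖ₑ) s) : ‖goodPart f s y‖ₑ ≤ 2 ^ n * s := by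
  have hu := lintegral_enorm_ne_top hf
  rw [goodPart_of_mem_heavyPiece ⟨hy, rfl⟩]
  set Q := heavyPiece (fun z => ‖f z‖ₑ) s (heavyIndex (fun z => ‖f z‖ₑ) s y)
  have hle := lintegral_heavyPiece_le hn hs hs' hu (heavyIndex (fun z => ‖f z‖ₑ) s y)
  have hfin := volume_heavyPiece_ne_top hn hs hs' hu (heavyIndex (fun z => ‖f z‖ₑ) s y)
  change ∫⁻ y in Q, ‖f y‖ₑ ≤ 2 ^ n * s * volume Q at hle
  change volume Q ≠ ⊤ at hfin
  rw [setAverage_eq, enorm_smul]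
  by_cases h0 : volume Q = 0
  · simp [measureReal_def, h0]
  · have : ‖((volume.real Q)⁻¹ : ℝ)‖ₑ = (volume Q)⁻¹ := by
      rw [Real.enorm_eq_ofReal (by positivity), measureReal_def, ENNReal.ofReal_inv_of_pos
        (ENNReal.toReal_pos h0 hfin), ENNReal.ofReal_toReal hfin]
    rw [this]
    calc (volume Q)⁻¹ * ‖∫ z in Q, f z‖ₑ ≤ (volume Q)⁻¹ * (2 ^ n * s * volume Q) := by
          gcongr
          exact (enorm_integral_le_lintegral_enorm _).trans hle
      _ = 2 ^ n * s := by
          rw [mul_comm, mul_assoc, ENNReal.mul_inv_cancel h0 hfin, mul_one]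

theorem enorm_goodPart_le (hn : n ≠ 0) (hs : s ≠ 0) (hs' : s ≠ ⊤) (hf : Integrable f)
    (hfc : Continuous f) (y : Rn n) : ‖goodPart f s y‖ₑ ≤ 2 ^ n * s := by
  by_cases hy : y ∈ heavySet (fun z => ‖f z‖ₑ) s
  · exact enorm_goodPart_le_of_mem hn hs hs' hf hy
  · refine (enorm_goodPart_le_of_notMem hfc hy).trans ?_
    calc s = 1 * s := (one_mul s).symm
      _ ≤ 2 ^ n * s := by gcongr; exact one_le_pow₀ one_le_two

theorem lintegral_enorm_goodPart_heavySet_le (hn : n ≠ 0) (hs : s ≠ 0) (hs' : s ≠ ⊤)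
    (hf : Integrable f) :
    ∫⁻ y in heavySet (fun z => ‖f z‖ₑ) s, ‖goodPart f s y‖ₑ
      ≤ 2 ^ n * s * volume (heavySet (fun z => ‖f z‖ₑ) s) := by
  rw [← setLIntegral_const]
  exact setLIntegral_mono' (measurableSet_heavySet hn hs hs' (lintegral_enorm_ne_top hf))
    fun y hy => enorm_goodPart_le_of_mem hn hs hs' hf hy

theorem integrable_goodPart (hn : n ≠ 0) (hs : s ≠ 0) (hs' : s ≠ ⊤) (hf : Integrable f)
    (hfc : Continuous f) : Integrable (goodPart f s) := by
  have hu := lintegral_enorm_ne_top hf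
  have hΩ := measurableSet_heavySet hn hs hs' hu
  refine ⟨aestronglyMeasurable_goodPart hn hs hs' hf, ?_⟩
  rw [hasFiniteIntegral_iff_enorm, ← lintegral_add_compl _ hΩ, ENNReal.add_lt_top]
  constructor
  · refine (lintegral_enorm_goodPart_heavySet_le hn hs hs' hf).trans_lt ?_
    exact ENNReal.mul_lt_top (ENNReal.mul_lt_top (by simp) hs'.lt_top)
      (volume_heavySet_ne_top hn hs hs' hu hfc.enorm.measurable).lt_top
  · refine lt_of_le_of_lt ?_ hu.lt_top
    refine (setLIntegral_mono' hΩ.compl fun y hy => ?_).trans (setLIntegral_le_lintegral _ _)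
    rw [goodPart_of_notMem hy]

/-- The square integral of the good part. -/
theorem lintegral_enorm_goodPart_sq_le (hn : n ≠ 0) (hs : s ≠ 0) (hs' : s ≠ ⊤) (hf : Integrable f)
    (hfc : Continuous f) :
    ∫⁻ y, ‖goodPart f s y‖ₑ ^ 2 ≤ (∫⁻ y in {y | ‖f y‖ₑ ≤ s}, ‖f y‖ₑ ^ 2) +
      (2 ^ n * s) ^ 2 * volume (heavySet (fun z => ‖f z‖ₑ) s) := by
  have hΩ := measurableSet_heavySet hn hs hs' (lintegral_enorm_ne_top hf)
  rw [← lintegral_add_compl _ hΩ, add_comm]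
  gcongr ?_ + ?_
  · calc ∫⁻ y in (heavySet (fun z => ‖f z‖ₑ) s)ᶜ, ‖goodPart f s y‖ₑ ^ 2
        = ∫⁻ y in (heavySet (fun z => ‖f z‖ₑ) s)ᶜ, ‖f y‖ₑ ^ 2 :=
          setLIntegral_congr_fun hΩ.compl fun y hy => by simp only [goodPart_of_notMem hy]
      _ ≤ _ := lintegral_mono_set fun y hy => le_of_notMem_heavySet hfc.enorm hy
  · rw [← setLIntegral_const]
    refine setLIntegral_mono' hΩ fun y hy => ?_
    gcongr
    exact enorm_goodPart_le_of_mem hn hs hs' hf hy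

theorem setIntegral_heavyPiece_sub_goodPart [CompleteSpace F₂] (hn : n ≠ 0) (hs : s ≠ 0) (hs' : s ≠ ⊤)
    (hf : Integrable f) (hfc : Continuous f) (i : ℤ × (Fin n → ℤ)) :
    ∫ y in heavyPiece (fun z => ‖f z‖ₑ) s i, (f y - goodPart f s y) = 0 := by
  have hu := lintegral_enorm_ne_top hf
  rw [integral_sub hf.integrableOn (integrable_goodPart hn hs hs' hf hfc).integrableOn,
    setIntegral_congr_fun (measurableSet_heavyPiece hn hs hs' hu i)
      (fun y hy => goodPart_of_mem_heavyPiece hy), setIntegral_const,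
    measure_smul_setAverage _ (volume_heavyPiece_ne_top hn hs hs' hu i), sub_self]

end KernelOperator

/-- A neighbourhood of a heavy piece, outside of which the bad part is controlled. -/
def heavyBall {n : ℕ} (u : Rn n → ℝ≥0∞) (s : ℝ≥0∞) (i : ℤ × (Fin n → ℤ)) : Set (Rn n) :=
  {x | (heavyPiece u s i).Nonempty ∧
    x ∈ Metric.closedBall (dyadicCorner i.1 i.2) (2 * √n * 2 ^ i.1)}

/-- The ratio of the volume of a heavy ball to that of its cube. -/
def heavyBallConst (n : ℕ) : ℝ≥0∞ :=
  ENNReal.ofReal ((2 * √n) ^ n) * volume (Metric.ball (0 : Rn n) 1)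

section

variable {n : ℕ} {u : Rn n → ℝ≥0∞} {s : ℝ≥0∞}

theorem heavyBallConst_ne_top : heavyBallConst n ≠ ⊤ :=
  ENNReal.mul_ne_top ENNReal.ofReal_ne_top measure_ball_lt_top.ne

theorem measurableSet_heavyBall (i : ℤ × (Fin n → ℤ)) : MeasurableSet (heavyBall u s i) :=
  (MeasurableSet.const _).inter measurableSet_closedBall

theorem volume_heavyBall_le (hn : n ≠ 0) (hs : s ≠ 0) (hs' : s ≠ ⊤) (hu : ∫⁻ x, u x ≠ ⊤)
    (i : ℤ × (Fin n → ℤ)) :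
    volume (heavyBall u s i) ≤ heavyBallConst n * volume (heavyPiece u s i) := by
  rcases heavyPiece_eq_empty_or hn hs hs' hu i with h | ⟨x, -, hi, h⟩
  · simp [heavyBall, h]
  · have : Nonempty (Fin n) := ⟨⟨0, Nat.pos_of_ne_zero hn⟩⟩
    have h1 : heavyScale u s x = i.1 := by rw [hi]; rfl
    rw [h, volume_dyadicCube, h1, heavyBallConst, mul_assoc, mul_comm (volume _), ← mul_assoc,
      ← ENNReal.ofReal_mul (by positivity), ← mul_pow]
    refine (measure_mono fun x hx => hx.2).trans ?_
    rw [Measure.addHaar_closedBall _ _ (by positivity), finrank_euclideanSpace_fin]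

theorem norm_sub_le_of_mem_heavyPiece {i : ℤ × (Fin n → ℤ)} {y : Rn n}
    (hy : y ∈ heavyPiece u s i) : ‖y - dyadicCorner i.1 i.2‖ ≤ √n * 2 ^ i.1 := by
  obtain ⟨-, rfl⟩ := hy
  exact norm_sub_dyadicCorner_le _ _

end

section KernelOperator

variable {n : ℕ} {F₁ F₂ F₃ : Type*} [NormedAddCommGroup F₁] [NormedSpace ℂ F₁]
  [NormedAddCommGroup F₂] [NormedSpace ℂ F₂] [CompleteSpace F₂]
  [NormedAddCommGroup F₃] [NormedSpace ℂ F₃] [CompleteSpace F₃]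
  {B : F₁ →L[ℂ] F₂ →L[ℂ] F₃} {K : Rn n → F₁} {f g b : Rn n → F₂} {s t A H : ℝ≥0∞}

omit [CompleteSpace F₂] in
theorem lintegral_enorm_sub_goodPart_le (hn : n ≠ 0) (hs : s ≠ 0) (hs' : s ≠ ⊤)
    (hf : Integrable f) :
    ∫⁻ y in heavySet (fun z => ‖f z‖ₑ) s, ‖f y - goodPart f s y‖ₑ
      ≤ 2 ^ (n + 1) * s * volume (heavySet (fun z => ‖f z‖ₑ) s) := by
  have hu := lintegral_enorm_ne_top hf
  calc ∫⁻ y in heavySet (fun z => ‖f z‖ₑ) s, ‖f y - goodPart f s y‖ₑ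
      ≤ ∫⁻ y in heavySet (fun z => ‖f z‖ₑ) s, (‖f y‖ₑ + ‖goodPart f s y‖ₑ) :=
        lintegral_mono fun y => enorm_sub_le
    _ = (∫⁻ y in heavySet (fun z => ‖f z‖ₑ) s, ‖f y‖ₑ) +
        ∫⁻ y in heavySet (fun z => ‖f z‖ₑ) s, ‖goodPart f s y‖ₑ :=
        lintegral_add_left' hf.1.restrict.enorm _
    _ ≤ 2 ^ n * s * volume (heavySet (fun z => ‖f z‖ₑ) s) +
        2 ^ n * s * volume (heavySet (fun z => ‖f z‖ₑ) s) :=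
        add_le_add (lintegral_heavySet_le hn hs hs' hu)
          (lintegral_enorm_goodPart_heavySet_le hn hs hs' hf)
    _ = _ := by rw [pow_succ]; ring

/-- The contribution of the bad part away from the heavy balls. -/
theorem lintegral_kernelOp_badPart_le (hn : n ≠ 0) (hs : s ≠ 0) (hs' : s ≠ ⊤)
    (hB : IsContractive B) (hK : Continuous K) {M : ℝ} (hM : ∀ x, ‖K x‖ ≤ M)
    (hH : ∀ w : Rn n, ∫⁻ z in {z | 2 * ‖w‖ ≤ ‖z‖}, ‖K (z - w) - K z‖ₑ ≤ H)
    (hf : Integrable f) (hfc : Continuous f) :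
    ∫⁻ x in (⋃ i, heavyBall (fun z => ‖f z‖ₑ) s i)ᶜ, ‖kernelOp B K (f - goodPart f s) x‖ₑ
      ≤ H * (2 ^ (n + 1) * s * volume (heavySet (fun z => ‖f z‖ₑ) s)) := by
  have hu := lintegral_enorm_ne_top hf
  set Q := heavyPiece (fun z => ‖f z‖ₑ) s with hQ
  have hQm : ∀ i, MeasurableSet (Q i) := measurableSet_heavyPiece hn hs hs' hu
  set E := (⋃ i, heavyBall (fun z => ‖f z‖ₑ) s i)ᶜ with hE
  set b := f - goodPart f s with hbdef
  have hb : Integrable b := hf.sub (integrable_goodPart hn hs hs' hf hfc)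
  have hsum : ∀ x, ‖kernelOp B K b x‖ₑ ≤ ∑' i, ∫⁻ y in Q i,
      ‖K (x - y) - K (x - dyadicCorner i.1 i.2)‖ₑ * ‖b y‖ₑ := fun x => by
    have h1 : kernelOp B K b x = ∑' i, ∫ y in Q i, B (K (x - y)) (b y) := by
      rw [← integral_iUnion hQm pairwise_disjoint_heavyPiece
        (integrable_kernelOp hB hK hM hb x).integrableOn, hQ, iUnion_heavyPiece]
      refine (setIntegral_eq_integral_of_forall_compl_eq_zero fun y hy => ?_).symm
      simp [hbdef, goodPart_of_notMem hy]
    rw [h1]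
    refine enorm_tsum_le_tsum_enorm.trans (ENNReal.tsum_le_tsum fun i => ?_)
    exact enorm_setIntegral_kernel_le hB hK hM hb
      (setIntegral_heavyPiece_sub_goodPart hn hs hs' hf hfc i) _ _
  have hmeas : ∀ i : ℤ × (Fin n → ℤ), AEMeasurable (fun x => ∫⁻ y in Q i,
      ‖K (x - y) - K (x - dyadicCorner i.1 i.2)‖ₑ * ‖b y‖ₑ) (volume.restrict E) := fun i => by
    have h1 : Continuous fun p : Rn n × Rn n =>
        ‖K (p.1 - p.2) - K (p.1 - dyadicCorner i.1 i.2)‖ₑ :=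
      Continuous.enorm (by fun_prop)
    exact (h1.measurable.aemeasurable.mul
      (hb.1.restrict.comp_snd (μ := volume.restrict E)).enorm).lintegral_prod_right'
  calc ∫⁻ x in E, ‖kernelOp B K b x‖ₑ
      ≤ ∫⁻ x in E, ∑' i, ∫⁻ y in Q i,
          ‖K (x - y) - K (x - dyadicCorner i.1 i.2)‖ₑ * ‖b y‖ₑ := lintegral_mono hsum
    _ = ∑' i, ∫⁻ x in E, ∫⁻ y in Q i,
          ‖K (x - y) - K (x - dyadicCorner i.1 i.2)‖ₑ * ‖b y‖ₑ := lintegral_tsum hmeas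
    _ ≤ ∑' i, H * ∫⁻ y in Q i, ‖b y‖ₑ := by
        refine ENNReal.tsum_le_tsum fun i => ?_
        rcases (Q i).eq_empty_or_nonempty with h | h
        · simp [h]
        refine lintegral_kernel_difference_le hK hH hb (hQm i)
          (fun y hy => norm_sub_le_of_mem_heavyPiece hy) fun x hx => ?_
        by_contra! hlt
        refine hx (mem_iUnion.2 ⟨i, h, ?_⟩)
        rw [Metric.mem_closedBall, dist_eq_norm]
        linarith
    _ = H * ∫⁻ y in heavySet (fun z => ‖f z‖ₑ) s, ‖b y‖ₑ := by
        rw [ENNReal.tsum_mul_left, ← lintegral_iUnion hQm pairwise_disjoint_heavyPiece, hQ,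
          iUnion_heavyPiece]
    _ ≤ _ := by gcongr; exact lintegral_enorm_sub_goodPart_le hn hs hs' hf

/-- The weak type estimate of Calderón–Zygmund, with a free height `s` for the decomposition. -/
theorem volume_kernelOp_lt_le (hn : n ≠ 0) (hs : s ≠ 0) (hs' : s ≠ ⊤) (ht : t ≠ 0) (ht' : t ≠ ⊤)
    (hB : IsContractive B) (hK : Continuous K) {M : ℝ} (hM : ∀ x, ‖K x‖ ≤ M)
    (hA : ∀ g : Rn n → F₂, Integrable g → (∃ M : ℝ≥0, ∀ x, ‖g x‖ₑ ≤ M) →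
      ∫⁻ x, ‖kernelOp B K g x‖ₑ ^ 2 ≤ A * ∫⁻ x, ‖g x‖ₑ ^ 2)
    (hH : ∀ w : Rn n, ∫⁻ z in {z | 2 * ‖w‖ ≤ ‖z‖}, ‖K (z - w) - K z‖ₑ ≤ H)
    (hf : Integrable f) (hfc : Continuous f) :
    volume {x | 2 * t < ‖kernelOp B K f x‖ₑ} ≤
      A / t ^ 2 * (∫⁻ y in {y | ‖f y‖ₑ ≤ s}, ‖f y‖ₑ ^ 2) +
      (A / t ^ 2 * (2 ^ n * s) ^ 2 + heavyBallConst n + H / t * (2 ^ (n + 1) * s)) *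
        volume (heavySet (fun z => ‖f z‖ₑ) s) := by
  have hu := lintegral_enorm_ne_top hf
  set Ω := heavySet (fun z => ‖f z‖ₑ) s with hΩ
  set O := ⋃ i, heavyBall (fun z => ‖f z‖ₑ) s i with hO
  have hOm : MeasurableSet O := MeasurableSet.iUnion measurableSet_heavyBall
  have hg := integrable_goodPart hn hs hs' hf hfc
  set b := f - goodPart f s with hbdef
  have hb : Integrable b := hf.sub hg
  have hgm : Measurable fun x => ‖kernelOp B K (goodPart f s) x‖ₑ :=
    (continuous_kernelOp hB hK hM hg).enorm.measurable
  have hbm : Measurable fun x => ‖kernelOp B K b x‖ₑ :=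
    (continuous_kernelOp hB hK hM hb).enorm.measurable
  have hsplit : {x | 2 * t < ‖kernelOp B K f x‖ₑ} ⊆
      {x | t ^ 2 ≤ ‖kernelOp B K (goodPart f s) x‖ₑ ^ 2} ∪
      (O ∪ {x | t ≤ Oᶜ.indicator (fun x => ‖kernelOp B K b x‖ₑ) x}) := by
    intro x hx
    by_contra hcon
    simp only [mem_union, mem_ofPred_eq, not_or, not_le] at hcon hx
    obtain ⟨h1, h2, h3⟩ := hcon
    rw [indicator_of_mem (show x ∈ Oᶜ from h2)] at h3
    have h1' : ‖kernelOp B K (goodPart f s) x‖ₑ < t := lt_of_pow_lt_pow_left' 2 h1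
    have h4 : kernelOp B K f x = kernelOp B K (goodPart f s) x + kernelOp B K b x := by
      rw [← kernelOp_add hB hK hM hg hb, hbdef, add_sub_cancel]
    rw [h4] at hx
    have := hx.trans_le (enorm_add_le _ _)
    exact absurd (this.trans (ENNReal.add_lt_add h1' h3)) (by rw [two_mul]; exact lt_irrefl _)
  have e1 : volume {x | t ^ 2 ≤ ‖kernelOp B K (goodPart f s) x‖ₑ ^ 2} ≤
      A / t ^ 2 * ((∫⁻ y in {y | ‖f y‖ₑ ≤ s}, ‖f y‖ₑ ^ 2) + (2 ^ n * s) ^ 2 * volume Ω) := by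
    refine (meas_ge_le_lintegral_div (hgm.pow_const 2).aemeasurable (by simpa using ht)
      (by simpa using ht')).trans ?_
    refine (ENNReal.div_le_div_right ((hA _ hg ⟨(2 ^ n * s).toNNReal, fun x => ?_⟩).trans
      (mul_le_mul_right (lintegral_enorm_goodPart_sq_le hn hs hs' hf hfc) A)) _).trans_eq ?_
    · rw [ENNReal.coe_toNNReal (ENNReal.mul_ne_top (by simp) hs')]
      exact enorm_goodPart_le hn hs hs' hf hfc x
    · simp only [div_eq_mul_inv]; ring
  have e2 : volume O ≤ heavyBallConst n * volume Ω := by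
    rw [hΩ, ← iUnion_heavyPiece, measure_iUnion pairwise_disjoint_heavyPiece
      (measurableSet_heavyPiece hn hs hs' hu), ← ENNReal.tsum_mul_left]
    exact (measure_iUnion_le _).trans
      (ENNReal.tsum_le_tsum fun i => volume_heavyBall_le hn hs hs' hu i)
  have e3 : volume {x | t ≤ Oᶜ.indicator (fun x => ‖kernelOp B K b x‖ₑ) x} ≤
      H / t * (2 ^ (n + 1) * s) * volume Ω := by
    refine (meas_ge_le_lintegral_div (hbm.indicator hOm.compl).aemeasurable ht ht').trans ?_
    rw [lintegral_indicator hOm.compl]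
    refine (ENNReal.div_le_div_right
      (lintegral_kernelOp_badPart_le hn hs hs' hB hK hM hH hf hfc) t).trans_eq ?_
    simp only [div_eq_mul_inv]; ring
  calc volume {x | 2 * t < ‖kernelOp B K f x‖ₑ}
      ≤ _ := measure_mono hsplit
    _ ≤ _ := (measure_union_le _ _).trans (add_le_add e1
        ((measure_union_le _ _).trans (add_le_add e2 e3)))
    _ = _ := by ring

end KernelOperator

theorem ofReal_norm_rpow {F : Type*} [NormedAddCommGroup F] (z : F) {p : ℝ} (hp : 0 ≤ p) :
    ENNReal.ofReal (‖z‖ ^ p) = ‖z‖ₑ ^ p := by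
  rw [← ofReal_norm, ENNReal.ofReal_rpow_of_nonneg (norm_nonneg _) hp]

theorem lintegral_indicator_large_rpow_le {p α v : ℝ} (hp2 : p < 2) (hα : 0 < α) (hv : 0 ≤ v) :
    ∫⁻ t in Ioi (0 : ℝ), {t | v ≤ α * t}.indicator
      (fun t => ENNReal.ofReal (v ^ 2) * ENNReal.ofReal (t ^ (p - 3))) t
      ≤ ENNReal.ofReal (α ^ (2 - p) / (2 - p)) * ENNReal.ofReal (v ^ p) := by
  rcases hv.eq_or_lt with rfl | hv
  · simp [indicator]
  have hc : 0 < v / α := by positivity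
  have hset : {t : ℝ | v ≤ α * t} = Ici (v / α) := by
    ext t; simp [div_le_iff₀' hα]
  have hint := integrableOn_Ioi_rpow_of_lt (show p - 3 < -1 by linarith) hc
  calc _ ≤ ∫⁻ t in Ici (v / α), ENNReal.ofReal (v ^ 2) * ENNReal.ofReal (t ^ (p - 3)) := by
        rw [hset, ← lintegral_indicator measurableSet_Ici]
        exact setLIntegral_le_lintegral _ _
    _ = ENNReal.ofReal (v ^ 2) * ENNReal.ofReal (∫ t in Ioi (v / α), t ^ (p - 3)) := by
        rw [lintegral_const_mul' _ _ ENNReal.ofReal_ne_top, setLIntegral_congr Ioi_ae_eq_Ici.symm,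
          ofReal_integral_eq_lintegral_ofReal hint]
        filter_upwards [ae_restrict_mem measurableSet_Ioi] with t ht
        exact Real.rpow_nonneg (hc.trans ht).le _
    _ = _ := by
        rw [integral_Ioi_rpow_of_lt (by linarith) hc, ← ENNReal.ofReal_mul (by positivity),
          ← ENNReal.ofReal_mul (by have := sub_pos.2 hp2; positivity)]
        congr 1
        rw [show p - 3 + 1 = p - 2 by ring, Real.div_rpow hv.le hα.le, Real.rpow_sub hv,
          show p - 2 = -(2 - p) by ring, Real.rpow_neg hα.le]
        have h2 : v ^ (2 : ℝ) = v ^ 2 := Real.rpow_two v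
        have h3 : 2 - p ≠ 0 := by linarith
        have h4 : α ^ (2 - p) ≠ 0 := (Real.rpow_pos_of_pos hα _).ne'
        rw [h2]
        field_simp

theorem lintegral_indicator_small_rpow_le {p α v : ℝ} (hp : 1 < p) (hα : 0 < α) (hv : 0 ≤ v) :
    ∫⁻ t in Ioi (0 : ℝ), {t | α * t < 2 * v}.indicator
      (fun t => ENNReal.ofReal v * ENNReal.ofReal (t ^ (p - 2))) t
      ≤ ENNReal.ofReal (2 ^ (p - 1) * α ^ (1 - p) / (p - 1)) * ENNReal.ofReal (v ^ p) := by
  rcases hv.eq_or_lt with rfl | hv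
  · simp [indicator]
  have hc : 0 < 2 * v / α := by positivity
  have hint : IntegrableOn (fun t : ℝ => t ^ (p - 2)) (Ioc 0 (2 * v / α)) := by
    rw [← intervalIntegrable_iff_integrableOn_Ioc_of_le hc.le]
    exact intervalIntegral.intervalIntegrable_rpow' (by linarith)
  have hm : MeasurableSet {t : ℝ | α * t < 2 * v} := measurableSet_lt (by fun_prop) (by fun_prop)
  calc _ ≤ ∫⁻ t in Ioc 0 (2 * v / α), ENNReal.ofReal v * ENNReal.ofReal (t ^ (p - 2)) := by
        rw [lintegral_indicator hm, Measure.restrict_restrict hm]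
        refine lintegral_mono_set fun t ht => ⟨ht.2, ?_⟩
        rw [le_div_iff₀' hα]
        exact (show α * t < 2 * v from ht.1).le
    _ = ENNReal.ofReal v * ENNReal.ofReal (∫ t in (0)..(2 * v / α), t ^ (p - 2)) := by
        rw [lintegral_const_mul' _ _ ENNReal.ofReal_ne_top, intervalIntegral.integral_of_le hc.le,
          ofReal_integral_eq_lintegral_ofReal hint]
        filter_upwards [ae_restrict_mem measurableSet_Ioc] with t ht
        exact Real.rpow_nonneg ht.1.le _
    _ = _ := by
        have h3 : 0 < p - 1 := by linarith
        rw [integral_rpow (Or.inl (by linarith)), ← ENNReal.ofReal_mul (by positivity),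
          ← ENNReal.ofReal_mul (by positivity)]
        congr 1
        rw [show p - 2 + 1 = p - 1 by ring, Real.zero_rpow h3.ne', sub_zero,
          Real.div_rpow (by positivity) hα.le, Real.mul_rpow zero_le_two hv.le,
          show 1 - p = -(p - 1) by ring, Real.rpow_neg hα.le]
        have h4 : α ^ (p - 1) ≠ 0 := (Real.rpow_pos_of_pos hα _).ne'
        have h5 : v ^ p = v * v ^ (p - 1) := by
          rw [Real.rpow_sub hv, Real.rpow_one]; field_simp
        rw [h5]
        field_simp

/-- The constant in the `L^p` bound of Calderón–Zygmund. -/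
def czConst (n : ℕ) (p : ℝ) : ℝ≥0∞ :=
  ENNReal.ofReal (2 ^ p * p) * (ENNReal.ofReal (1 / (2 - p)) +
    (4 ^ n + heavyBallConst n + 2 ^ (n + 1)) * ENNReal.ofReal (2 ^ p / (p - 1)))

theorem czConst_ne_top {n : ℕ} {p : ℝ} : czConst n p ≠ ⊤ := by
  have : (4 : ℝ≥0∞) ^ n + heavyBallConst n + 2 ^ (n + 1) ≠ ⊤ := by
    simp [heavyBallConst_ne_top]
  exact ENNReal.mul_ne_top ENNReal.ofReal_ne_top
    (ENNReal.add_ne_top.2 ⟨ENNReal.ofReal_ne_top, ENNReal.mul_ne_top this ENNReal.ofReal_ne_top⟩)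

section KernelOperator

variable {n : ℕ} {F₁ F₂ F₃ : Type*} [NormedAddCommGroup F₁] [NormedSpace ℂ F₁]
  [NormedAddCommGroup F₂] [NormedSpace ℂ F₂] [CompleteSpace F₂]
  [NormedAddCommGroup F₃] [NormedSpace ℂ F₃] [CompleteSpace F₃]
  {B : F₁ →L[ℂ] F₂ →L[ℂ] F₃} {K : Rn n → F₁} {f : Rn n → F₂} {A H : ℝ≥0∞}

theorem volume_kernelOp_lt_mul_le (hn : n ≠ 0)
    (hB : IsContractive B) (hK : Continuous K) {M : ℝ} (hM : ∀ x, ‖K x‖ ≤ M)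
    (hA : ∀ g : Rn n → F₂, Integrable g → (∃ M : ℝ≥0, ∀ x, ‖g x‖ₑ ≤ M) →
      ∫⁻ x, ‖kernelOp B K g x‖ₑ ^ 2 ≤ A * ∫⁻ x, ‖g x‖ₑ ^ 2)
    (hH : ∀ w : Rn n, ∫⁻ z in {z | 2 * ‖w‖ ≤ ‖z‖}, ‖K (z - w) - K z‖ₑ ≤ H)
    (hf : Integrable f) (hfc : Continuous f) {p α t : ℝ} (hα : 0 < α) (ht : 0 < t) :
    volume {x | t < ‖kernelOp B K f x‖ / 2} * ENNReal.ofReal (t ^ (p - 1)) ≤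
      A * (∫⁻ y, {t | ‖f y‖ ≤ α * t}.indicator
        (fun t => ENNReal.ofReal (‖f y‖ ^ 2) * ENNReal.ofReal (t ^ (p - 3))) t) +
      (A * 4 ^ n * ENNReal.ofReal (α ^ 2) + heavyBallConst n +
        H * 2 ^ (n + 1) * ENNReal.ofReal α) * ENNReal.ofReal (2 / α) *
      ∫⁻ y, {t | α * t < 2 * ‖f y‖}.indicator
        (fun t => ENNReal.ofReal ‖f y‖ * ENNReal.ofReal (t ^ (p - 2))) t := by
  have hu := lintegral_enorm_ne_top hf
  have hs : ENNReal.ofReal (α * t) ≠ 0 := by simp; positivity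
  have ht' : ENNReal.ofReal t ≠ 0 := by simpa using ht
  have hset : {x | t < ‖kernelOp B K f x‖ / 2}
      = {x | 2 * ENNReal.ofReal t < ‖kernelOp B K f x‖ₑ} := by
    ext x
    rw [mem_ofPred_eq, mem_ofPred_eq, ← ofReal_norm, ← ENNReal.ofReal_ofNat 2,
      ← ENNReal.ofReal_mul zero_le_two, ENNReal.ofReal_lt_ofReal_iff_of_nonneg (by positivity),
      lt_div_iff₀' two_pos]
  have hweak := volume_kernelOp_lt_le hn hs ENNReal.ofReal_ne_top ht' ENNReal.ofReal_ne_top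
    hB hK hM hA hH hf hfc
  have hvol := mul_volume_heavySet_le hn hs ENNReal.ofReal_ne_top hu hfc.enorm.measurable
  set Ω := heavySet (fun z => ‖f z‖ₑ) (ENNReal.ofReal (α * t))
  have ht2 : ENNReal.ofReal (t ^ (-2 : ℝ)) = (ENNReal.ofReal t ^ 2)⁻¹ := by
    rw [Real.rpow_neg ht.le, ENNReal.ofReal_inv_of_pos (by positivity), Real.rpow_two,
      ENNReal.ofReal_pow ht.le]
  have hp3 : (ENNReal.ofReal t ^ 2)⁻¹ * ENNReal.ofReal (t ^ (p - 1))
      = ENNReal.ofReal (t ^ (p - 3)) := by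
    rw [← ht2, ← ENNReal.ofReal_mul (by positivity), ← Real.rpow_add ht]; ring_nf
  have hc1 : A / ENNReal.ofReal t ^ 2 * (2 ^ n * ENNReal.ofReal (α * t)) ^ 2
      = A * 4 ^ n * ENNReal.ofReal (α ^ 2) := by
    rw [ENNReal.ofReal_mul hα.le, ENNReal.ofReal_pow hα.le, show (4 : ℝ≥0∞) = 2 ^ 2 by norm_num,
      ← pow_mul, mul_comm 2 n, pow_mul, div_eq_mul_inv]
    calc _ = A * (2 ^ n) ^ 2 * ENNReal.ofReal α ^ 2 *
          ((ENNReal.ofReal t ^ 2)⁻¹ * ENNReal.ofReal t ^ 2) := by ring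
      _ = _ := by rw [ENNReal.inv_mul_cancel (by simpa using ht') (by simp), mul_one]
  have hc2 : H / ENNReal.ofReal t * (2 ^ (n + 1) * ENNReal.ofReal (α * t))
      = H * 2 ^ (n + 1) * ENNReal.ofReal α := by
    rw [ENNReal.ofReal_mul hα.le, div_eq_mul_inv]
    calc _ = H * 2 ^ (n + 1) * ENNReal.ofReal α *
          ((ENNReal.ofReal t)⁻¹ * ENNReal.ofReal t) := by ring
      _ = _ := by rw [ENNReal.inv_mul_cancel ht' (by simp), mul_one]
  have hi1 : (∫⁻ y in {y | ‖f y‖ₑ ≤ ENNReal.ofReal (α * t)}, ‖f y‖ₑ ^ 2) *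
      ENNReal.ofReal (t ^ (p - 3)) = ∫⁻ y, {t | ‖f y‖ ≤ α * t}.indicator
        (fun t => ENNReal.ofReal (‖f y‖ ^ 2) * ENNReal.ofReal (t ^ (p - 3))) t := by
    rw [← lintegral_mul_const' _ _ ENNReal.ofReal_ne_top,
      ← lintegral_indicator (measurableSet_le hfc.enorm.measurable measurable_const)]
    congr 1 with y
    simp only [indicator, mem_ofPred_eq, ENNReal.ofReal_pow (norm_nonneg (f y)), ← ofReal_norm (f y),
      ENNReal.ofReal_le_ofReal_iff (show 0 ≤ α * t by positivity)]
  have hi2 : ENNReal.ofReal (t ^ (p - 1)) * volume Ω ≤ ENNReal.ofReal (2 / α) *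
      ∫⁻ y, {t | α * t < 2 * ‖f y‖}.indicator
        (fun t => ENNReal.ofReal ‖f y‖ * ENNReal.ofReal (t ^ (p - 2))) t := by
    have hj : ∫⁻ y in {y | ENNReal.ofReal (α * t) / 2 < ‖f y‖ₑ}, ‖f y‖ₑ
        * ENNReal.ofReal (t ^ (p - 2)) = ∫⁻ y, {t | α * t < 2 * ‖f y‖}.indicator
        (fun t => ENNReal.ofReal ‖f y‖ * ENNReal.ofReal (t ^ (p - 2))) t := by
      rw [← lintegral_indicator (measurableSet_lt measurable_const hfc.enorm.measurable)]
      congr 1 with y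
      have : ENNReal.ofReal (α * t) / 2 < ENNReal.ofReal ‖f y‖ ↔ α * t < 2 * ‖f y‖ := by
        rw [← ENNReal.ofReal_ofNat 2, ← ENNReal.ofReal_div_of_pos two_pos,
          ENNReal.ofReal_lt_ofReal_iff_of_nonneg (by positivity), div_lt_iff₀' two_pos]
      simp only [indicator, mem_ofPred_eq, ← ofReal_norm (f y), this]
    rw [← hj, lintegral_mul_const' _ _ ENNReal.ofReal_ne_top]
    have h1 : ENNReal.ofReal (t ^ (p - 1)) = ENNReal.ofReal (2 / α) *
        ENNReal.ofReal (t ^ (p - 2)) * (ENNReal.ofReal (α * t) / 2) := by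
      rw [← ENNReal.ofReal_ofNat 2, ← ENNReal.ofReal_div_of_pos two_pos,
        ← ENNReal.ofReal_mul (by positivity), ← ENNReal.ofReal_mul (by positivity)]
      congr 1
      rw [show p - 1 = p - 2 + 1 by ring, Real.rpow_add ht, Real.rpow_one]
      field_simp
    rw [h1, mul_assoc, mul_assoc, mul_comm (∫⁻ y in _, _)]
    gcongr
  rw [hset]
  calc _ ≤ _ := mul_le_mul_left hweak _
    _ = A * ((∫⁻ y in {y | ‖f y‖ₑ ≤ ENNReal.ofReal (α * t)}, ‖f y‖ₑ ^ 2) *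
          ((ENNReal.ofReal t ^ 2)⁻¹ * ENNReal.ofReal (t ^ (p - 1)))) +
        (A / ENNReal.ofReal t ^ 2 * (2 ^ n * ENNReal.ofReal (α * t)) ^ 2 + heavyBallConst n +
          H / ENNReal.ofReal t * (2 ^ (n + 1) * ENNReal.ofReal (α * t))) *
          (ENNReal.ofReal (t ^ (p - 1)) * volume Ω) := by
        rw [div_eq_mul_inv A]; ring
    _ ≤ _ := by
        rw [hp3, hi1, hc1, hc2, mul_assoc _ (ENNReal.ofReal (2 / α))]
        gcongr

/-- The `L^p` bound of Calderón–Zygmund for `1 < p < 2`, with a free parameter `α`. -/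
theorem lintegral_kernelOp_rpow_le (hn : n ≠ 0)
    (hB : IsContractive B) (hK : Continuous K) {M : ℝ} (hM : ∀ x, ‖K x‖ ≤ M)
    (hA : ∀ g : Rn n → F₂, Integrable g → (∃ M : ℝ≥0, ∀ x, ‖g x‖ₑ ≤ M) →
      ∫⁻ x, ‖kernelOp B K g x‖ₑ ^ 2 ≤ A * ∫⁻ x, ‖g x‖ₑ ^ 2)
    (hH : ∀ w : Rn n, ∫⁻ z in {z | 2 * ‖w‖ ≤ ‖z‖}, ‖K (z - w) - K z‖ₑ ≤ H)
    (hf : Integrable f) (hfc : Continuous f) {p α : ℝ} (hp : 1 < p) (hp2 : p < 2) (hα : 0 < α) :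
    ∫⁻ x, ‖kernelOp B K f x‖ₑ ^ p ≤
      czConst n p * (ENNReal.ofReal (α ^ (-p)) + H * ENNReal.ofReal (α ^ (1 - p)) +
        A * ENNReal.ofReal (α ^ (2 - p))) * ∫⁻ x, ‖f x‖ₑ ^ p := by
  have hTc := continuous_kernelOp hB hK hM hf
  have hp0 : 0 < p := by linarith
  have hcake := lintegral_rpow_eq_lintegral_meas_lt_mul (volume : Measure (Rn n))
    (f := fun x => ‖kernelOp B K f x‖ / 2) (.of_forall fun x => by positivity)
    (hTc.norm.div_const 2).aemeasurable hp0
  set C₂ := (A * 4 ^ n * ENNReal.ofReal (α ^ 2) + heavyBallConst n +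
        H * 2 ^ (n + 1) * ENNReal.ofReal α) * ENNReal.ofReal (2 / α) with hC₂
  set G₁ : Rn n → ℝ → ℝ≥0∞ := fun y => {t | ‖f y‖ ≤ α * t}.indicator
        (fun t => ENNReal.ofReal (‖f y‖ ^ 2) * ENNReal.ofReal (t ^ (p - 3))) with hG₁
  set G₂ : Rn n → ℝ → ℝ≥0∞ := fun y => {t | α * t < 2 * ‖f y‖}.indicator
        (fun t => ENNReal.ofReal ‖f y‖ * ENNReal.ofReal (t ^ (p - 2))) with hG₂
  have hfm : Measurable fun q : ℝ × Rn n => ‖f q.2‖ := (hfc.norm.comp continuous_snd).measurable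
  have m1 : Measurable (Function.uncurry fun (t : ℝ) (y : Rn n) => G₁ y t) := by
    have : (Function.uncurry fun (t : ℝ) (y : Rn n) => G₁ y t)
        = {q : ℝ × Rn n | ‖f q.2‖ ≤ α * q.1}.indicator
          (fun q => ENNReal.ofReal (‖f q.2‖ ^ 2) * ENNReal.ofReal (q.1 ^ (p - 3))) := by
      ext q; simp [hG₁, indicator, Function.uncurry]
    rw [this]
    exact Measurable.indicator (by fun_prop) (measurableSet_le hfm (by fun_prop))
  have m2 : Measurable (Function.uncurry fun (t : ℝ) (y : Rn n) => G₂ y t) := by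
    have : (Function.uncurry fun (t : ℝ) (y : Rn n) => G₂ y t)
        = {q : ℝ × Rn n | α * q.1 < 2 * ‖f q.2‖}.indicator
          (fun q => ENNReal.ofReal ‖f q.2‖ * ENNReal.ofReal (q.1 ^ (p - 2))) := by
      ext q; simp [hG₂, indicator, Function.uncurry]
    rw [this]
    exact Measurable.indicator (by fun_prop) (measurableSet_lt (by fun_prop) (by fun_prop))
  have hint : ∫⁻ t in Ioi (0 : ℝ), volume {x | t < ‖kernelOp B K f x‖ / 2} *
      ENNReal.ofReal (t ^ (p - 1)) ≤
      (A * ENNReal.ofReal (α ^ (2 - p) / (2 - p)) +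
        C₂ * ENNReal.ofReal (2 ^ (p - 1) * α ^ (1 - p) / (p - 1))) * ∫⁻ x, ‖f x‖ₑ ^ p := by
    calc _ ≤ ∫⁻ t in Ioi (0 : ℝ), (A * (∫⁻ y, G₁ y t) + C₂ * ∫⁻ y, G₂ y t) :=
          setLIntegral_mono' measurableSet_Ioi fun t ht =>
            volume_kernelOp_lt_mul_le hn hB hK hM hA hH hf hfc hα ht
      _ = A * (∫⁻ y, ∫⁻ t in Ioi (0 : ℝ), G₁ y t) + C₂ * ∫⁻ y, ∫⁻ t in Ioi (0 : ℝ), G₂ y t := by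
          have m1' : Measurable fun t => ∫⁻ y, G₁ y t := m1.lintegral_prod_right'
          have m2' : Measurable fun t => ∫⁻ y, G₂ y t := m2.lintegral_prod_right'
          rw [lintegral_add_left (m1'.const_mul A), lintegral_const_mul _ m1',
            lintegral_const_mul _ m2',
            lintegral_lintegral_swap m1.aemeasurable, lintegral_lintegral_swap m2.aemeasurable]
      _ ≤ A * (∫⁻ y, ENNReal.ofReal (α ^ (2 - p) / (2 - p)) * ‖f y‖ₑ ^ p) +
          C₂ * ∫⁻ y, ENNReal.ofReal (2 ^ (p - 1) * α ^ (1 - p) / (p - 1)) * ‖f y‖ₑ ^ p := by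
          gcongr with y y
          · rw [← ofReal_norm_rpow _ hp0.le]; exact lintegral_indicator_large_rpow_le hp2 hα (norm_nonneg _)
          · rw [← ofReal_norm_rpow _ hp0.le]; exact lintegral_indicator_small_rpow_le hp hα (norm_nonneg _)
      _ = _ := by
          rw [lintegral_const_mul' _ _ ENNReal.ofReal_ne_top,
            lintegral_const_mul' _ _ ENNReal.ofReal_ne_top]; ring
  have hleft : ∫⁻ x, ‖kernelOp B K f x‖ₑ ^ p =
      ENNReal.ofReal (2 ^ p) * ∫⁻ x, ENNReal.ofReal ((‖kernelOp B K f x‖ / 2) ^ p) := by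
    rw [← lintegral_const_mul' _ _ ENNReal.ofReal_ne_top]
    congr 1 with x
    rw [← ENNReal.ofReal_mul (by positivity), ← Real.mul_rpow zero_le_two (by positivity),
      mul_div_cancel₀ _ (two_ne_zero' ℝ), ofReal_norm_rpow _ hp0.le]
  have h2p : 0 < 2 - p := by linarith
  have hp1 : 0 < p - 1 := by linarith
  rw [hleft, hcake]
  calc _ ≤ ENNReal.ofReal (2 ^ p) * (ENNReal.ofReal p *
        ((A * ENNReal.ofReal (α ^ (2 - p) / (2 - p)) +
        C₂ * ENNReal.ofReal (2 ^ (p - 1) * α ^ (1 - p) / (p - 1))) * ∫⁻ x, ‖f x‖ₑ ^ p)) := by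
        gcongr
    _ ≤ _ := ?_
  rw [← mul_assoc, ← mul_assoc, ← ENNReal.ofReal_mul (by positivity)]
  refine mul_le_mul_left ?_ _
  rw [czConst, mul_assoc (ENNReal.ofReal (2 ^ p * p)) (_ + _)]
  refine mul_le_mul_right ?_ _
  set P := ENNReal.ofReal (2 ^ p / (p - 1))
  set R := ENNReal.ofReal (1 / (2 - p))
  set a₀ := ENNReal.ofReal (α ^ (-p))
  set a₁ := ENNReal.ofReal (α ^ (1 - p))
  set a₂ := ENNReal.ofReal (α ^ (2 - p))
  have k1 : ENNReal.ofReal (α ^ (2 - p) / (2 - p)) = a₂ * R := by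
    rw [← ENNReal.ofReal_mul (by positivity)]; congr 1; field_simp
  have k2 : ENNReal.ofReal (2 / α) * ENNReal.ofReal (2 ^ (p - 1) * α ^ (1 - p) / (p - 1))
      = a₀ * P := by
    rw [← ENNReal.ofReal_mul (by positivity), ← ENNReal.ofReal_mul (by positivity)]
    congr 1
    rw [Real.rpow_sub two_pos, Real.rpow_sub hα, Real.rpow_neg hα.le, Real.rpow_one, Real.rpow_one]
    field_simp
  have k3 : ENNReal.ofReal α * a₀ = a₁ := by
    rw [← ENNReal.ofReal_mul hα.le]
    congr 1
    rw [sub_eq_add_neg, Real.rpow_add hα, Real.rpow_one]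
  have k4 : ENNReal.ofReal (α ^ 2) * a₀ = a₂ := by
    rw [← ENNReal.ofReal_mul (by positivity)]
    congr 1
    rw [sub_eq_add_neg, Real.rpow_add hα, Real.rpow_two]
  calc _ = A * (a₂ * R) + (A * 4 ^ n * (ENNReal.ofReal (α ^ 2) * a₀) + heavyBallConst n * a₀ +
        H * 2 ^ (n + 1) * (ENNReal.ofReal α * a₀)) * P := by
        rw [k1, hC₂, mul_assoc _ (ENNReal.ofReal (2 / α)), k2]; ring
    _ = A * a₂ * R + (4 ^ n * (A * a₂) + heavyBallConst n * a₀ + 2 ^ (n + 1) * (H * a₁)) * P := by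
        rw [k3, k4]; ring
    _ ≤ (a₀ + H * a₁ + A * a₂) * R + (4 ^ n * (a₀ + H * a₁ + A * a₂) +
        heavyBallConst n * (a₀ + H * a₁ + A * a₂) + 2 ^ (n + 1) * (a₀ + H * a₁ + A * a₂)) * P := by
        have i0 : a₀ ≤ a₀ + H * a₁ + A * a₂ := by rw [add_assoc]; exact le_self_add
        have i1 : H * a₁ ≤ a₀ + H * a₁ + A * a₂ := le_add_right le_add_self
        have i2 : A * a₂ ≤ a₀ + H * a₁ + A * a₂ := le_add_self
        gcongr
    _ = _ := by ring

end KernelOperator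

/-- The quantitative information on a phase function in the class `𝒰`. -/
structure PhaseBounds (Γ : ℝ → ℝ) (c C σ : ℝ) : Prop where
  c_pos : 0 < c
  sign : σ = 1 ∨ σ = -1
  pos : ∀ s > 0, 0 < Γ s
  hasDerivAt : ∀ s > 0, HasDerivAt Γ (deriv Γ s) s
  hasDerivAt_deriv : ∀ s > 0, HasDerivAt (deriv Γ) (deriv (deriv Γ) s) s
  continuousOn_deriv2 : ContinuousOn (deriv (deriv Γ)) (Ioi 0)
  lower : ∀ s > 0, c * Γ s ≤ s * deriv Γ s
  upper : ∀ s > 0, s * deriv Γ s ≤ C * Γ s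
  lower2 : ∀ s > 0, c * Γ s ≤ σ * (s ^ 2 * deriv (deriv Γ) s)

theorem IsGammaU.pos {Γ : ℝ → ℝ} (hΓ : IsGammaU Γ) {s : ℝ} (hs : 0 < s) : 0 < Γ s := by
  have : StrictMonoOn Γ (Ici 0) := strictMonoOn_of_deriv_pos (convex_Ici 0) hΓ.continuousOn
    fun x hx => hΓ.deriv_pos x (by simpa using hx)
  simpa [hΓ.map_zero] using this self_mem_Ici hs.le hs

theorem IsGammaU.exists_phaseBounds {Γ : ℝ → ℝ} (hΓ : IsGammaU Γ) :
    ∃ c C σ : ℝ, PhaseBounds Γ c C σ := by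
  have hpos : ∀ s > 0, 0 < Γ s := fun s hs => hΓ.pos hs
  obtain ⟨c₁, hc₁, h₁⟩ := hΓ.lower 1 (by simp)
  obtain ⟨c₂, hc₂, h₂⟩ := hΓ.lower 2 (by simp)
  obtain ⟨C, -, hC⟩ := hΓ.upper 1 le_rfl
  have hd1 : ContDiffOn ℝ 1 (deriv Γ) (Ioi 0) :=
    ((contDiffOn_infty_iff_deriv_of_isOpen isOpen_Ioi).1 hΓ.smooth).2.of_le (by simp)
  have hd2 : ContinuousOn (deriv (deriv Γ)) (Ioi 0) :=
    hd1.continuousOn_deriv_of_isOpen isOpen_Ioi le_rfl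
  have hnz : ∀ s > 0, c₂ * Γ s ≤ |s ^ 2 * deriv (deriv Γ) s| := fun s hs => by
    have := h₂ s hs
    rw [iteratedDeriv_succ, iteratedDeriv_one, abs_div, abs_of_pos (hpos s hs),
      le_div_iff₀ (hpos s hs)] at this
    exact this
  have hsign : (∀ s ∈ Ioi (0 : ℝ), 0 < s ^ 2 * deriv (deriv Γ) s) ∨
      (∀ s ∈ Ioi (0 : ℝ), s ^ 2 * deriv (deriv Γ) s < 0) := by
    have hcont : ContinuousOn (fun s => s ^ 2 * deriv (deriv Γ) s) (Ioi 0) := by fun_prop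
    have hne : ∀ s ∈ Ioi (0 : ℝ), s ^ 2 * deriv (deriv Γ) s ≠ 0 := fun s hs h => by
      have := hnz s hs
      rw [h, abs_zero] at this
      exact absurd this (not_le.2 (mul_pos hc₂ (hpos s hs)))
    by_contra! hcon
    obtain ⟨⟨a, ha, ha'⟩, b, hb, hb'⟩ := hcon
    obtain ⟨z, hz, hz'⟩ := isPreconnected_Ioi.intermediate_value ha hb hcont ⟨ha', hb'⟩
    exact hne z hz hz'
  have hone : ∀ s > 0, |s ^ 1 * iteratedDeriv 1 Γ s / Γ s| = s * deriv Γ s / Γ s := fun s hs => by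
    rw [iteratedDeriv_one, pow_one, abs_of_pos (div_pos (mul_pos hs (hΓ.deriv_pos s hs))
      (hpos s hs))]
  obtain ⟨σ, hσ, hσ'⟩ : ∃ σ : ℝ, (σ = 1 ∨ σ = -1) ∧ ∀ s > 0,
      |s ^ 2 * deriv (deriv Γ) s| = σ * (s ^ 2 * deriv (deriv Γ) s) := by
    rcases hsign with h | h
    · exact ⟨1, Or.inl rfl, fun s hs => by rw [abs_of_pos (h s hs), one_mul]⟩
    · exact ⟨-1, Or.inr rfl, fun s hs => by rw [abs_of_neg (h s hs)]; ring⟩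
  refine ⟨min c₁ c₂, C, σ, lt_min hc₁ hc₂, hσ, hpos, fun s hs => ?_, fun s hs => ?_, hd2,
    fun s hs => ?_, fun s hs => ?_, fun s hs => ?_⟩
  · exact ((hΓ.smooth.differentiableOn (by simp)).differentiableAt
      (Ioi_mem_nhds hs)).hasDerivAt
  · exact ((hd1.differentiableOn (by simp)).differentiableAt (Ioi_mem_nhds hs)).hasDerivAt
  · have := h₁ s hs
    rw [hone s hs, le_div_iff₀ (hpos s hs)] at this
    exact (mul_le_mul_of_nonneg_right (min_le_left _ _) (hpos s hs).le).trans this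
  · have := hC s hs
    rwa [hone s hs, div_le_iff₀ (hpos s hs)] at this
  · rw [← hσ' s hs]
    exact (mul_le_mul_of_nonneg_right (min_le_right _ _) (hpos s hs).le).trans (hnz s hs)

namespace PhaseBounds

variable {Γ : ℝ → ℝ} {c C σ : ℝ} (h : PhaseBounds Γ c C σ)
include h

theorem C_pos : 0 < C := by
  have h1 := h.pos 1 one_pos
  have := (h.lower 1 one_pos).trans (h.upper 1 one_pos)
  exact h.c_pos.trans_le (le_of_mul_le_mul_right this h1)

theorem deriv_pos {s : ℝ} (hs : 0 < s) : 0 < deriv Γ s := by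
  have := (mul_pos h.c_pos (h.pos s hs)).trans_le (h.lower s hs)
  exact pos_of_mul_pos_right this hs.le

theorem hasDerivAt_mul_rpow (a : ℝ) {s : ℝ} (hs : 0 < s) :
    HasDerivAt (fun s => Γ s * s ^ (-a)) (s ^ (-a - 1) * (s * deriv Γ s - a * Γ s)) s := by
  have := (h.hasDerivAt s hs).mul (Real.hasDerivAt_rpow_const (p := -a) (Or.inl hs.ne'))
  refine this.congr_deriv ?_
  rw [Real.rpow_sub hs, Real.rpow_one]
  field_simp
  ring

theorem monotoneOn_mul_rpow : MonotoneOn (fun s => Γ s * s ^ (-c)) (Ioi 0) := by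
  refine monotoneOn_of_deriv_nonneg (convex_Ioi 0)
    (fun s hs => (h.hasDerivAt_mul_rpow c hs).continuousAt.continuousWithinAt) ?_ ?_
  · rw [interior_Ioi]
    exact fun s hs => (h.hasDerivAt_mul_rpow c hs).differentiableAt.differentiableWithinAt
  · rw [interior_Ioi]
    intro s hs
    rw [(h.hasDerivAt_mul_rpow c hs).deriv]
    exact mul_nonneg (Real.rpow_nonneg (le_of_lt hs) _) (sub_nonneg.2 (h.lower s hs))

theorem antitoneOn_mul_rpow : AntitoneOn (fun s => Γ s * s ^ (-C)) (Ioi 0) := by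
  refine antitoneOn_of_deriv_nonpos (convex_Ioi 0)
    (fun s hs => (h.hasDerivAt_mul_rpow C hs).continuousAt.continuousWithinAt) ?_ ?_
  · rw [interior_Ioi]
    exact fun s hs => (h.hasDerivAt_mul_rpow C hs).differentiableAt.differentiableWithinAt
  · rw [interior_Ioi]
    intro s hs
    rw [(h.hasDerivAt_mul_rpow C hs).deriv]
    exact mul_nonpos_of_nonneg_of_nonpos (Real.rpow_nonneg (le_of_lt hs) _)
      (sub_nonpos.2 (h.upper s hs))

theorem rpow_mul_le {s t : ℝ} (hs : 0 < s) (hst : s ≤ t) : (t / s) ^ c * Γ s ≤ Γ t := by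
  have ht := hs.trans_le hst
  have := h.monotoneOn_mul_rpow hs ht hst
  simp only [Real.rpow_neg hs.le, Real.rpow_neg ht.le, ← div_eq_mul_inv] at this
  rw [div_le_div_iff₀ (by positivity) (by positivity)] at this
  rw [Real.div_rpow ht.le hs.le, div_mul_eq_mul_div, div_le_iff₀ (by positivity)]
  linarith

theorem le_rpow_mul {s t : ℝ} (hs : 0 < s) (hst : s ≤ t) : Γ t ≤ (t / s) ^ C * Γ s := by
  have ht := hs.trans_le hst
  have := h.antitoneOn_mul_rpow hs ht hst
  simp only [Real.rpow_neg hs.le, Real.rpow_neg ht.le, ← div_eq_mul_inv] at this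
  rw [div_le_div_iff₀ (by positivity) (by positivity)] at this
  rw [Real.div_rpow ht.le hs.le, div_mul_eq_mul_div, le_div_iff₀ (by positivity)]
  linarith

theorem mono {s t : ℝ} (hs : 0 < s) (hst : s ≤ t) : Γ s ≤ Γ t := by
  refine le_trans ?_ (h.rpow_mul_le hs hst)
  exact le_mul_of_one_le_left (h.pos s hs).le
    (Real.one_le_rpow ((one_le_div hs).2 hst) h.c_pos.le)

theorem zpow_le {m m' : ℤ} (hm : m ≤ m') :
    (2 : ℝ) ^ (c * (m' - m : ℝ)) * Γ (2 ^ m) ≤ Γ (2 ^ m') := by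
  have := h.rpow_mul_le (s := 2 ^ m) (t := 2 ^ m') (by positivity) (zpow_le_zpow_right₀ one_le_two hm)
  rwa [← zpow_sub₀ two_ne_zero, ← Real.rpow_intCast _ (m' - m), ← Real.rpow_mul two_pos.le,
    Int.cast_sub, mul_comm _ c] at this

theorem le_zpow {m m' : ℤ} (hm : m ≤ m') :
    Γ (2 ^ m') ≤ (2 : ℝ) ^ (C * (m' - m : ℝ)) * Γ (2 ^ m) := by
  have := h.le_rpow_mul (s := 2 ^ m) (t := 2 ^ m') (by positivity) (zpow_le_zpow_right₀ one_le_two hm)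
  rwa [← zpow_sub₀ two_ne_zero, ← Real.rpow_intCast _ (m' - m), ← Real.rpow_mul two_pos.le,
    Int.cast_sub, mul_comm _ C] at this

theorem bddAbove_kstar (k : ℤ) : BddAbove {m : ℤ | (2 : ℝ) ^ k * Γ ((2 : ℝ) ^ m) ≤ 1} := by
  have h1 := h.pos 1 one_pos
  have hk : (0 : ℝ) < 2 ^ k := by positivity
  obtain ⟨N, hN⟩ : ∃ N : ℕ, 1 < (2 : ℝ) ^ (c * N) * (2 ^ k * Γ 1) := by
    obtain ⟨N, hN⟩ := pow_unbounded_of_one_lt (2 ^ k * Γ 1)⁻¹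
      (Real.one_lt_rpow one_lt_two h.c_pos)
    refine ⟨N, ?_⟩
    rw [Real.rpow_mul two_pos.le, Real.rpow_natCast]
    rwa [inv_lt_iff_one_lt_mul₀ (by positivity)] at hN
  refine ⟨N, fun m hm => ?_⟩
  by_contra! hlt
  have h2 := h.zpow_le (m := 0) (m' := N) (by positivity)
  have h3 := h.mono (s := 2 ^ (N : ℤ)) (t := 2 ^ m) (by positivity)
    (zpow_le_zpow_right₀ one_le_two hlt.le)
  simp only [zpow_zero, Int.cast_zero, sub_zero, Int.cast_natCast] at h2
  have : (2 : ℝ) ^ k * ((2 : ℝ) ^ (c * N) * Γ 1) ≤ 2 ^ k * Γ (2 ^ m) := by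
    gcongr; exact h2.trans h3
  have h4 : (2 : ℝ) ^ k * Γ (2 ^ m) ≤ 1 := hm
  nlinarith

theorem nonempty_kstar (k : ℤ) : {m : ℤ | (2 : ℝ) ^ k * Γ ((2 : ℝ) ^ m) ≤ 1}.Nonempty := by
  have h1 := h.pos 1 one_pos
  have hk : (0 : ℝ) < 2 ^ k := by positivity
  obtain ⟨N, hN⟩ := pow_unbounded_of_one_lt (2 ^ k * Γ 1) (Real.one_lt_rpow one_lt_two h.c_pos)
  refine ⟨-N, ?_⟩
  have h2 := h.zpow_le (m := -N) (m' := 0) (by simp)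
  simp only [zpow_zero, Int.cast_zero, Int.cast_neg, Int.cast_natCast, zero_sub, neg_neg] at h2
  rw [Real.rpow_mul two_pos.le, Real.rpow_natCast] at h2
  rw [mem_ofPred_eq]
  by_contra! hlt
  have h3 : (2 : ℝ) ^ k * (((2 : ℝ) ^ c) ^ N * Γ (2 ^ (-N : ℤ))) ≤ 2 ^ k * Γ 1 := by gcongr
  have : ((2 : ℝ) ^ c) ^ N * 1 ≤ ((2 : ℝ) ^ c) ^ N * (2 ^ k * Γ (2 ^ (-N : ℤ))) := by gcongr
  nlinarith

theorem kstar_le (k : ℤ) : (2 : ℝ) ^ k * Γ ((2 : ℝ) ^ kstar Γ k) ≤ 1 :=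
  Int.csSup_mem (h.nonempty_kstar k) (h.bddAbove_kstar k)

theorem lt_kstar_add_one (k : ℤ) : 1 < (2 : ℝ) ^ k * Γ ((2 : ℝ) ^ (kstar Γ k + 1)) := by
  by_contra! hle
  have : kstar Γ k + 1 ≤ kstar Γ k := le_csSup (h.bddAbove_kstar k) hle
  omega

theorem le_frequency (k : ℤ) {l : ℤ} (hl : 1 ≤ l) :
    (2 : ℝ) ^ (c * (l - 1)) ≤ (2 : ℝ) ^ k * Γ ((2 : ℝ) ^ (kstar Γ k + l)) := by
  have h1 := h.zpow_le (m := kstar Γ k + 1) (m' := kstar Γ k + l) (by omega)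
  have h2 := (h.lt_kstar_add_one k).le
  have hk : (0 : ℝ) < 2 ^ k := by positivity
  rw [show ((kstar Γ k + l : ℤ) - (kstar Γ k + 1 : ℤ) : ℝ) = l - 1 by push_cast; ring] at h1
  calc (2 : ℝ) ^ (c * (l - 1)) = (2 : ℝ) ^ (c * (l - 1)) * 1 := (mul_one _).symm
    _ ≤ (2 : ℝ) ^ (c * (l - 1)) * (2 ^ k * Γ (2 ^ (kstar Γ k + 1))) := by gcongr
    _ = 2 ^ k * ((2 : ℝ) ^ (c * (l - 1)) * Γ (2 ^ (kstar Γ k + 1))) := by ring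
    _ ≤ _ := by gcongr

theorem frequency_le (k : ℤ) {l : ℤ} (hl : 1 ≤ l) :
    (2 : ℝ) ^ k * Γ ((2 : ℝ) ^ (kstar Γ k + l)) ≤ (2 : ℝ) ^ (C * l) := by
  have h1 := h.le_zpow (m := kstar Γ k) (m' := kstar Γ k + l) (by omega)
  rw [show ((kstar Γ k + l : ℤ) - (kstar Γ k : ℤ) : ℝ) = l by push_cast; ring] at h1
  calc (2 : ℝ) ^ k * Γ (2 ^ (kstar Γ k + l))
      ≤ 2 ^ k * ((2 : ℝ) ^ (C * l) * Γ (2 ^ kstar Γ k)) := by gcongr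
    _ = (2 : ℝ) ^ (C * l) * (2 ^ k * Γ (2 ^ kstar Γ k)) := by ring
    _ ≤ (2 : ℝ) ^ (C * l) * 1 := by gcongr; exact h.kstar_le k
    _ = _ := mul_one _

theorem sub_lt_of_kstar_eq {k k' : ℤ} (he : kstar Γ k = kstar Γ k') : (k' - k : ℝ) < C := by
  have h1 := h.kstar_le k'
  have h2 := h.lt_kstar_add_one k
  have h3 := h.le_zpow (m := kstar Γ k) (m' := kstar Γ k + 1) (by omega)
  rw [show ((kstar Γ k + 1 : ℤ) - (kstar Γ k : ℤ) : ℝ) = 1 by push_cast; ring, mul_one] at h3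
  rw [← he] at h1
  have hG := h.pos (2 ^ kstar Γ k) (by positivity)
  have h4 : (1 : ℝ) < 2 ^ k * (2 ^ C * Γ (2 ^ kstar Γ k)) := h2.trans_le (by gcongr)
  have h5 : (2 : ℝ) ^ k' * Γ (2 ^ kstar Γ k) < 2 ^ k * (2 ^ C * Γ (2 ^ kstar Γ k)) := h1.trans_lt h4
  rw [← mul_assoc, mul_lt_mul_iff_left₀ hG, ← Real.rpow_intCast, ← Real.rpow_intCast,
    ← Real.rpow_add two_pos, Real.rpow_lt_rpow_left_iff one_lt_two] at h5
  linarith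

end PhaseBounds

/-- The second derivative test of van der Corput. -/
theorem norm_integral_exp_mul_le {φ φ' φ'' A A' : ℝ → ℝ} {a b μ σ M M' : ℝ} (hab : a ≤ b)
    (hφ : ∀ r ∈ Icc a b, HasDerivAt φ (φ' r) r) (hφ' : ∀ r ∈ Icc a b, HasDerivAt φ' (φ'' r) r)
    (hc : ContinuousOn φ'' (Icc a b)) (hA : ∀ r ∈ Icc a b, HasDerivAt A (A' r) r)
    (hcA : ContinuousOn A' (Icc a b)) (hσ : σ = 1 ∨ σ = -1) (hμ : 0 < μ)
    (hlow : ∀ r ∈ Icc a b, μ ≤ σ * φ'' r) (hM : ∀ r ∈ Icc a b, |A r| ≤ M)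
    (hM' : ∀ r ∈ Icc a b, |A' r| ≤ M') :
    ‖∫ r in a..b, Complex.exp (φ r * Complex.I) * A r‖ ≤ (8 * M + M' * (b - a)) / √μ := by
  have hm : 0 < √μ := Real.sqrt_pos.2 hμ
  have hmm : √μ ^ 2 = μ := Real.sq_sqrt hμ.le
  have hD : ∀ r, 0 < φ' r ^ 2 + μ := fun r => by positivity
  have hM0 : 0 ≤ M := (abs_nonneg _).trans (hM a (left_mem_Icc.2 hab))
  have hM0' : 0 ≤ M' := (abs_nonneg _).trans (hM' a (left_mem_Icc.2 hab))
  set q : ℝ → ℝ := fun r => φ' r / (φ' r ^ 2 + μ) with hq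
  set q' : ℝ → ℝ := fun r => φ'' r * (μ - φ' r ^ 2) / (φ' r ^ 2 + μ) ^ 2 with hq'
  have hqd : ∀ r ∈ Icc a b, HasDerivAt q (q' r) r := fun r hr => by
    refine ((hφ' r hr).div (((hφ' r hr).pow 2).add_const μ) (hD r).ne').congr_deriv ?_
    simp only [hq', Pi.pow_apply]
    congr 1
    simp
    ring
  have hqb : ∀ r, |q r| ≤ 1 / (2 * √μ) := fun r => by
    simp only [hq]
    rw [abs_div, abs_of_pos (hD r), div_le_div_iff₀ (hD r) (by positivity)]
    nlinarith [sq_nonneg (|φ' r| - √μ), sq_abs (φ' r)]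
  have hqb' : ∀ r ∈ Icc a b, |q' r| ≤ σ * φ'' r / (φ' r ^ 2 + μ) := fun r hr => by
    have h1 : |φ'' r| = σ * φ'' r := by
      have := hμ.trans_le (hlow r hr)
      rcases hσ with rfl | rfl
      · rw [abs_of_pos (by linarith), one_mul]
      · rw [abs_of_neg (by linarith)]; ring
    have h2 : |μ - φ' r ^ 2| ≤ φ' r ^ 2 + μ := by
      rw [abs_le]; constructor <;> nlinarith [sq_nonneg (φ' r)]
    simp only [hq']
    rw [abs_div, abs_mul, h1, abs_of_pos (pow_pos (hD r) 2), div_le_div_iff₀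
      (pow_pos (hD r) 2) (hD r)]
    have h3 : 0 ≤ σ * φ'' r := hμ.le.trans (hlow r hr)
    calc σ * φ'' r * |μ - φ' r ^ 2| * (φ' r ^ 2 + μ)
        ≤ σ * φ'' r * (φ' r ^ 2 + μ) * (φ' r ^ 2 + μ) := by have := (hD r).le; gcongr
      _ = _ := by ring
  set e : ℝ → ℂ := fun r => Complex.exp (φ r * Complex.I) with he
  have hed : ∀ r ∈ Icc a b, HasDerivAt e (e r * (φ' r * Complex.I)) r := fun r hr =>
    (((hφ r hr).ofReal_comp).mul_const Complex.I).cexp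
  have hen : ∀ r, ‖e r‖ = 1 := fun r => Complex.norm_exp_ofReal_mul_I _
  set F : ℝ → ℂ := fun r => -Complex.I * (e r * (q r * A r : ℝ)) with hF
  set F' : ℝ → ℂ := fun r => -Complex.I * (e r * (φ' r * Complex.I) * (q r * A r : ℝ) +
    e r * (q' r * A r + q r * A' r : ℝ)) with hF'
  have hFd : ∀ r ∈ Icc a b, HasDerivAt F (F' r) r := fun r hr =>
    ((hed r hr).mul ((hqd r hr).mul (hA r hr)).ofReal_comp).const_mul (-Complex.I)
  have cφ : ContinuousOn φ (Icc a b) := fun r hr => (hφ r hr).continuousAt.continuousWithinAt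
  have cφ' : ContinuousOn φ' (Icc a b) := fun r hr => (hφ' r hr).continuousAt.continuousWithinAt
  have cA : ContinuousOn A (Icc a b) := fun r hr => (hA r hr).continuousAt.continuousWithinAt
  have cq : ContinuousOn q (Icc a b) := fun r hr => (hqd r hr).continuousAt.continuousWithinAt
  have cq' : ContinuousOn q' (Icc a b) :=
    (hc.mul (continuousOn_const.sub (cφ'.pow 2))).div₀ ((cφ'.pow 2).add continuousOn_const |>.pow 2)
      fun r _ => (pow_pos (hD r) 2).ne'
  have ce : ContinuousOn e (Icc a b) := fun r hr => (hed r hr).continuousAt.continuousWithinAt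
  have ceA : ContinuousOn (fun r => e r * A r) (Icc a b) :=
    ce.mul (Complex.continuous_ofReal.comp_continuousOn cA)
  have cF' : ContinuousOn F' (Icc a b) := by
    refine continuousOn_const.mul (((ce.mul ((Complex.continuous_ofReal.comp_continuousOn cφ').mul
      continuousOn_const)).mul ?_).add (ce.mul ?_))
    · exact Complex.continuous_ofReal.comp_continuousOn (cq.mul cA)
    · exact Complex.continuous_ofReal.comp_continuousOn ((cq'.mul cA).add (cq.mul hcA))
  rw [← uIcc_of_le hab] at ceA cF'
  set P : ℝ → ℝ := fun r => 2 * M * σ / √μ * Real.arctan (φ' r / √μ) + M' / (2 * √μ) * r with hP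
  set P' : ℝ → ℝ := fun r => 2 * M * (σ * φ'' r / (φ' r ^ 2 + μ)) + M' / (2 * √μ) with hP'
  have hPd : ∀ r ∈ Icc a b, HasDerivAt P (P' r) r := fun r hr => by
    refine ((((hφ' r hr).div_const (√μ)).arctan.const_mul (2 * M * σ / √μ)).add
      ((hasDerivAt_id r).const_mul (M' / (2 * √μ)))).congr_deriv ?_
    have h1 := (hD r).ne'
    have h2 : 1 + (φ' r / √μ) ^ 2 = (φ' r ^ 2 + μ) / μ := by
      rw [div_pow, hmm]; field_simp; ring
    simp only [hP', h2, mul_one]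
    congr 1
    field_simp
    rw [hmm]
  have cP' : ContinuousOn P' (uIcc a b) := by
    rw [uIcc_of_le hab]
    exact (continuousOn_const.mul ((continuousOn_const.mul hc).div₀ ((cφ'.pow 2).add
      continuousOn_const) fun r _ => (hD r).ne')).add continuousOn_const
  have hbound : ∀ r ∈ Icc a b, ‖e r * A r - F' r‖ ≤ P' r := fun r hr => by
    have h1 : e r * A r - F' r = e r * ((A r * (μ / (φ' r ^ 2 + μ)) : ℝ) +
        Complex.I * (q' r * A r + q r * A' r : ℝ)) := by
      have hA1 : (A r : ℂ) = φ' r * q r * A r + (A r * (μ / (φ' r ^ 2 + μ)) : ℝ) := by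
        norm_cast
        simp only [hq]; have := (hD r).ne'; field_simp
      simp only [hF', Complex.ofReal_add, Complex.ofReal_mul] at hA1 ⊢
      linear_combination e r * hA1 + (e r * φ' r * q r * A r) * Complex.I_sq
    rw [h1, norm_mul, hen, one_mul]
    refine (norm_add_le _ _).trans ?_
    rw [norm_mul, Complex.norm_I, one_mul, Complex.norm_real, Complex.norm_real, Real.norm_eq_abs,
      Real.norm_eq_abs]
    have b1 : |A r * (μ / (φ' r ^ 2 + μ))| ≤ M * (σ * φ'' r / (φ' r ^ 2 + μ)) := by
      rw [abs_mul, abs_of_pos (div_pos hμ (hD r))]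
      have := hD r
      gcongr
      · exact hM r hr
      · exact hlow r hr
    have b2 : |q' r * A r| ≤ M * (σ * φ'' r / (φ' r ^ 2 + μ)) := by
      rw [abs_mul, mul_comm]
      exact mul_le_mul (hM r hr) (hqb' r hr) (abs_nonneg _) hM0
    have b3 : |q r * A' r| ≤ M' / (2 * √μ) := by
      rw [abs_mul, div_eq_inv_mul, ← one_div]
      exact mul_le_mul (hqb r) (hM' r hr) (abs_nonneg _) (by positivity)
    have b4 := abs_add_le (q' r * A r) (q r * A' r)
    simp only [hP']
    linarith
  have hFb : ∀ r ∈ Icc a b, ‖F r‖ ≤ M / (2 * √μ) := fun r hr => by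
    simp only [hF]
    rw [norm_mul, norm_neg, Complex.norm_I, one_mul, norm_mul, hen, one_mul, Complex.norm_real,
      Real.norm_eq_abs, abs_mul, div_eq_inv_mul, ← one_div]
    exact mul_le_mul (hqb r) (hM r hr) (abs_nonneg _) (by positivity)
  have hFint : ∫ r in a..b, F' r = F b - F a :=
    intervalIntegral.integral_eq_sub_of_hasDerivAt (by rwa [uIcc_of_le hab])
      cF'.intervalIntegrable
  have hPint : ∫ r in a..b, P' r = P b - P a :=
    intervalIntegral.integral_eq_sub_of_hasDerivAt (by rwa [uIcc_of_le hab])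
      cP'.intervalIntegrable
  have hsplit : ∫ r in a..b, e r * A r = (∫ r in a..b, (e r * A r - F' r)) + (F b - F a) := by
    rw [intervalIntegral.integral_sub ceA.intervalIntegrable cF'.intervalIntegrable, hFint]
    ring
  have h1 : ‖∫ r in a..b, (e r * A r - F' r)‖ ≤ P b - P a := by
    rw [← hPint]
    exact intervalIntegral.norm_integral_le_of_norm_le hab
      (.of_forall fun r hr => hbound r (Ioc_subset_Icc_self hr)) cP'.intervalIntegrable
  have h2 : P b - P a ≤ 2 * M * Real.pi / √μ + M' / (2 * √μ) * (b - a) := by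
    have h3 : σ * (Real.arctan (φ' b / √μ) - Real.arctan (φ' a / √μ)) ≤ Real.pi := by
      have := Real.arctan_lt_pi_div_two (φ' b / √μ)
      have := Real.arctan_lt_pi_div_two (φ' a / √μ)
      have := Real.neg_pi_div_two_lt_arctan (φ' b / √μ)
      have := Real.neg_pi_div_two_lt_arctan (φ' a / √μ)
      rcases hσ with rfl | rfl <;> linarith
    calc P b - P a = 2 * M / √μ * (σ * (Real.arctan (φ' b / √μ) - Real.arctan (φ' a / √μ))) +
          M' / (2 * √μ) * (b - a) := by simp only [hP]; ring
      _ ≤ 2 * M / √μ * Real.pi + M' / (2 * √μ) * (b - a) := by gcongr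
      _ = _ := by ring
  have h3 : ‖F b - F a‖ ≤ M / √μ := by
    refine (norm_sub_le _ _).trans ((add_le_add (hFb b (right_mem_Icc.2 hab))
      (hFb a (left_mem_Icc.2 hab))).trans_eq ?_)
    field_simp; ring
  rw [hsplit]
  refine (norm_add_le _ _).trans ((add_le_add (h1.trans h2) h3).trans ?_)
  have hpi := Real.pi_lt_d2
  have h4 : 0 ≤ M' * (b - a) := mul_nonneg hM0' (sub_nonneg.2 hab)
  have e1 : 2 * M * Real.pi / √μ + M' / (2 * √μ) * (b - a) + M / √μ
      = (2 * M * Real.pi + M' * (b - a) / 2 + M) / √μ := by field_simp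
  rw [e1]
  refine div_le_div_of_nonneg_right ?_ hm.le
  have h5 := mul_le_mul_of_nonneg_left hpi.le hM0
  linarith

/-- Integration in polar coordinates. -/
theorem integral_eq_integral_sphere {n : ℕ} (hn : n ≠ 0) {h : Rn n → ℂ} (hh : Integrable h) :
    ∫ x, h x = ∫ θ : Metric.sphere (0 : Rn n) 1,
      (∫ r in Ioi (0 : ℝ), r ^ (n - 1) • h (r • (θ : Rn n))) ∂(volume : Measure (Rn n)).toSphere := by
  have : Nonempty (Fin n) := ⟨⟨0, Nat.pos_of_ne_zero hn⟩⟩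
  have : Nontrivial (Rn n) := inferInstance
  set G : Metric.sphere (0 : Rn n) 1 × Ioi (0 : ℝ) → ℂ := fun z => h (z.2.1 • z.1.1) with hG
  have hGe : ∀ x : ({0}ᶜ : Set (Rn n)), G (homeomorphUnitSphereProd (Rn n) x) = h x := fun x => by
    have hx : ‖(x : Rn n)‖ ≠ 0 := norm_ne_zero_iff.2 x.2
    simp [hG, smul_smul, hx]
  have hmp := (volume : Measure (Rn n)).measurePreserving_homeomorphUnitSphereProd
  have hme : MeasurableEmbedding (homeomorphUnitSphereProd (Rn n)) :=
    (homeomorphUnitSphereProd (Rn n)).measurableEmbedding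
  have hGi : Integrable G ((volume : Measure (Rn n)).toSphere.prod (.volumeIoiPow (n - 1))) := by
    have h1 := hmp.integrable_comp_emb hme (g := G)
    rw [finrank_euclideanSpace_fin] at h1
    rw [← h1]
    have h2 : (G ∘ homeomorphUnitSphereProd (Rn n)) = h ∘ Subtype.val := funext hGe
    rw [h2, ← integrableOn_iff_comap_subtypeVal (measurableSet_singleton _).compl]
    exact hh.integrableOn
  calc ∫ x, h x = ∫ x : ({0}ᶜ : Set (Rn n)), h x ∂((volume : Measure (Rn n)).comap (↑)) := by
        rw [integral_subtype_comap (measurableSet_singleton _).compl,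
          restrict_compl_singleton]
    _ = ∫ z, G z ∂((volume : Measure (Rn n)).toSphere.prod (.volumeIoiPow (n - 1))) := by
        have h1 := hmp.integral_comp hme G
        rw [finrank_euclideanSpace_fin] at h1
        rw [← h1]
        exact integral_congr_ae (.of_forall fun x => (hGe x).symm)
    _ = ∫ θ, (∫ r : Ioi (0 : ℝ), G (θ, r) ∂.volumeIoiPow (n - 1))
          ∂(volume : Measure (Rn n)).toSphere := integral_prod _ hGi
    _ = _ := by
        refine integral_congr_ae (.of_forall fun θ => ?_)
        simp only [Measure.volumeIoiPow, ENNReal.ofReal]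
        rw [integral_withDensity_eq_integral_smul, ← integral_subtype_comap measurableSet_Ioi]
        · refine integral_congr_ae (.of_forall fun r => ?_)
          have := r.2.out.le
          simp [hG, NNReal.smul_def, Real.coe_toNNReal _ (pow_nonneg this _)]
        · exact (measurable_subtype_coe.pow_const _).real_toNNReal

theorem IsLPCutoff.eq_zero {ψ : ℝ → ℝ} (hψ : IsLPCutoff ψ) {r : ℝ} (hr : r ∉ Icc (1 / 2 : ℝ) 2)
    (h0 : 0 ≤ r) : ψ r = 0 := by
  by_contra h
  exact hr (by simpa only [abs_of_nonneg h0] using hψ.2.2.1 r h)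

/-- The part of a homogeneous kernel in the annulus `1/2 ≤ ‖x‖ ≤ 2` is Lipschitz and bounded. -/
theorem exists_lipschitzWith_annular {n : ℕ} {K : Rn n → ℝ} (hK : IsHomCZKernel n K) {ψ : ℝ → ℝ}
    (hψ : IsLPCutoff ψ) :
    ∃ L M : ℝ≥0, LipschitzWith L (fun x => ψ ‖x‖ * K x) ∧ ∀ x, |ψ ‖x‖ * K x| ≤ M := by
  obtain ⟨Ω, hΩ, -, -, hKΩ⟩ := hK
  set G : Rn n → ℝ := fun x => ψ ‖x‖ * K x with hG
  have h0 : ∀ x, ‖x‖ ∉ Icc (1 / 2 : ℝ) 2 → G x = 0 := fun x hx => by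
    simp only [hG]; rw [hψ.eq_zero hx (norm_nonneg x), zero_mul]
  have hcd : ContDiff ℝ 1 G := contDiff_iff_contDiffAt.2 fun x => by
    by_cases hx : x = 0
    · have : G =ᶠ[𝓝 x] fun _ => 0 := by
        filter_upwards [Metric.ball_mem_nhds x (half_pos one_pos)] with y hy
        refine h0 y fun h => ?_
        rw [hx, mem_ball_zero_iff] at hy
        linarith [h.1]
      exact contDiffAt_const.congr_of_eventuallyEq this
    · have hne : ∀ᶠ y in 𝓝 x, y ≠ 0 := isOpen_ne.mem_nhds hx
      have h1 : ContDiffAt ℝ 1 (fun y => Ω y / ‖y‖ ^ n) x :=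
        (((hΩ x hx).contDiffAt (isOpen_ne.mem_nhds hx)).of_le (by simp)).div
          ((contDiffAt_norm ℝ hx).pow n) (pow_ne_zero _ (norm_ne_zero_iff.2 hx))
      refine ((hψ.1.of_le (by simp)).contDiffAt.comp x (contDiffAt_norm ℝ hx)).mul
        (h1.congr_of_eventuallyEq ?_)
      filter_upwards [hne] with y hy using hKΩ y hy
  have hcs : HasCompactSupport G := HasCompactSupport.intro (isCompact_closedBall (0 : Rn n) 2)
    fun x hx => h0 x fun h => hx (mem_closedBall_zero_iff.2 h.2)
  obtain ⟨L, hL⟩ := hcd.lipschitzWith_of_hasCompactSupport hcs one_ne_zero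
  obtain ⟨M, hM⟩ := hcd.continuous.bounded_above_of_compact_support hcs
  exact ⟨L, M.toNNReal, hL, fun x => (hM x).trans (Real.le_coe_toNNReal M)⟩

/-- The kernel `e^{iΦ(‖x‖)} ψ(‖x‖) K(x)`. -/
def oscKernel {n : ℕ} (Φ ψ : ℝ → ℝ) (K : Rn n → ℝ) (x : Rn n) : ℂ :=
  Complex.exp (Φ ‖x‖ * Complex.I) * (ψ ‖x‖ * K x : ℝ)

/-- The properties of `oscKernel` at frequency `Λ` used in the estimates. -/
structure IsOscPiece {n : ℕ} (g : Rn n → ℂ) (M Λ : ℝ) : Prop where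
  support : ∀ x, 2 < ‖x‖ → g x = 0
  bound : ∀ x, ‖g x‖ ≤ M
  lipschitz : ∀ x y, ‖g x - g y‖ ≤ M * Λ * ‖x - y‖
  integral : ∫ x, g x = 0
  fourier : ∀ ξ, ‖𝓕 g ξ‖ ≤ M / √Λ

namespace PhaseBounds

variable {Γ : ℝ → ℝ} {c C σ : ℝ} (h : PhaseBounds Γ c C σ)
include h

theorem scale {u a : ℝ} (hu : 0 < u) (ha : 0 < a) :
    PhaseBounds (fun s => u * Γ (a * s)) c C σ := by
  have e1 : deriv (fun s => u * Γ (a * s)) = fun s => u * a * deriv Γ (a * s) := by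
    funext s
    rw [deriv_const_mul_field, deriv_comp_mul_left, smul_eq_mul, mul_assoc]
  have e2 : deriv (fun s => u * a * deriv Γ (a * s)) =
      fun s => u * a * (a * deriv (deriv Γ) (a * s)) := by
    funext s
    rw [deriv_const_mul_field, deriv_comp_mul_left, smul_eq_mul]
  have hm : ∀ s : ℝ, HasDerivAt (fun s => a * s) a s := fun s => by
    simpa using (hasDerivAt_id s).const_mul a
  refine ⟨h.c_pos, h.sign, fun s hs => mul_pos hu (h.pos _ (mul_pos ha hs)), fun s hs => ?_,
    fun s hs => ?_, ?_, fun s hs => ?_, fun s hs => ?_, fun s hs => ?_⟩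
  · rw [e1]
    exact (((h.hasDerivAt _ (mul_pos ha hs)).comp s (hm s)).const_mul u).congr_deriv (by ring)
  · rw [e1, e2]
    exact (((h.hasDerivAt_deriv _ (mul_pos ha hs)).comp s (hm s)).const_mul (u * a)).congr_deriv
      (by ring)
  · rw [e1, e2]
    refine continuousOn_const.mul (continuousOn_const.mul (h.continuousOn_deriv2.comp
      (by fun_prop) fun s hs => mul_pos ha hs))
  · rw [e1]
    calc c * (u * Γ (a * s)) = u * (c * Γ (a * s)) := by ring
      _ ≤ u * (a * s * deriv Γ (a * s)) := by exact mul_le_mul_of_nonneg_left (h.lower _ (mul_pos ha hs)) hu.le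
      _ = _ := by ring
  · rw [e1]
    calc s * (u * a * deriv Γ (a * s)) = u * (a * s * deriv Γ (a * s)) := by ring
      _ ≤ u * (C * Γ (a * s)) := by exact mul_le_mul_of_nonneg_left (h.upper _ (mul_pos ha hs)) hu.le
      _ = _ := by ring
  · rw [e1, e2]
    calc c * (u * Γ (a * s)) = u * (c * Γ (a * s)) := by ring
      _ ≤ u * (σ * ((a * s) ^ 2 * deriv (deriv Γ) (a * s))) := by
        exact mul_le_mul_of_nonneg_left (h.lower2 _ (mul_pos ha hs)) hu.le
      _ = _ := by ring

theorem le_of_mem_Icc {r : ℝ} (hr : r ∈ Icc (1 / 2 : ℝ) 2) : Γ r ≤ 2 ^ C * Γ 1 := by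
  have h1 := h.le_rpow_mul one_pos one_le_two
  rw [div_one] at h1
  exact (h.mono (by linarith [hr.1]) hr.2).trans h1

theorem le_mul_of_mem_Icc {r : ℝ} (hr : r ∈ Icc (1 / 2 : ℝ) 2) : Γ 1 ≤ 2 ^ C * Γ r := by
  have h1 := h.le_rpow_mul (half_pos one_pos) (by norm_num : (1 / 2 : ℝ) ≤ 1)
  rw [show (1 : ℝ) / (1 / 2) = 2 by norm_num] at h1
  exact h1.trans (mul_le_mul_of_nonneg_left (h.mono (half_pos one_pos) hr.1) (by positivity))

theorem abs_deriv_le {r : ℝ} (hr : r ∈ Icc (1 / 2 : ℝ) 2) :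
    |deriv Γ r| ≤ 2 * C * 2 ^ C * Γ 1 := by
  have hr0 : 0 < r := by linarith [hr.1]
  have h1 := h.upper r hr0
  have h2 := h.deriv_pos hr0
  rw [abs_of_pos h2]
  have h3 := mul_le_mul_of_nonneg_left (h.le_of_mem_Icc hr) h.C_pos.le
  nlinarith [hr.1]

theorem le_deriv2 {r : ℝ} (hr : r ∈ Icc (1 / 2 : ℝ) 2) :
    c / (4 * 2 ^ C) * Γ 1 ≤ σ * deriv (deriv Γ) r := by
  have hr0 : 0 < r := by linarith [hr.1]
  have h1 := h.lower2 r hr0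
  have h2 := h.le_mul_of_mem_Icc hr
  have hc := h.c_pos
  have h3 := h.pos r hr0
  have h4 : c * Γ r ≤ 4 * (σ * deriv (deriv Γ) r) := by
    have h5 : 0 < σ * deriv (deriv Γ) r := by
      have : 0 < r ^ 2 * (σ * deriv (deriv Γ) r) := by
        calc 0 < c * Γ r := by positivity
          _ ≤ _ := h1
          _ = _ := by ring
      exact pos_of_mul_pos_right this (by positivity)
    have h6 : r ^ 2 ≤ 4 := by nlinarith [hr.2]
    nlinarith
  rw [div_mul_eq_mul_div, div_le_iff₀ (by positivity)]
  calc c * Γ 1 ≤ c * (2 ^ C * Γ r) := by gcongr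
    _ = 2 ^ C * (c * Γ r) := by ring
    _ ≤ 2 ^ C * (4 * (σ * deriv (deriv Γ) r)) := by gcongr
    _ = _ := by ring

theorem norm_exp_sub_le {r s : ℝ} (hr : r ∈ Icc (1 / 2 : ℝ) 2) (hs : s ∈ Icc (1 / 2 : ℝ) 2) :
    ‖Complex.exp (Γ r * Complex.I) - Complex.exp (Γ s * Complex.I)‖ ≤
      2 * C * 2 ^ C * Γ 1 * |r - s| := by
  have h1 : |Γ r - Γ s| ≤ 2 * C * 2 ^ C * Γ 1 * |r - s| :=
    (convex_Icc (1 / 2 : ℝ) 2).norm_image_sub_le_of_norm_hasDerivWithin_le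
      (fun x hx => (h.hasDerivAt x (by linarith [hx.1])).hasDerivWithinAt)
      (fun x hx => h.abs_deriv_le hx) hs hr
  refine le_trans ?_ h1
  have h2 : Complex.exp (Γ r * Complex.I) - Complex.exp (Γ s * Complex.I) =
      Complex.exp (Γ s * Complex.I) * (Complex.exp (Complex.I * (Γ r - Γ s : ℝ)) - 1) := by
    rw [mul_sub, ← Complex.exp_add, mul_one]
    congr 2
    push_cast
    ring
  rw [h2, norm_mul, Complex.norm_exp_ofReal_mul_I, one_mul]
  exact Real.norm_exp_I_mul_ofReal_sub_one_le

end PhaseBounds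

section Oscillatory

variable {n : ℕ} {K Ω : Rn n → ℝ} {ψ Φ : ℝ → ℝ}

theorem oscKernel_eq_zero (hψ : IsLPCutoff ψ) {x : Rn n} (hx : ‖x‖ ∉ Icc (1 / 2 : ℝ) 2) :
    oscKernel Φ ψ K x = 0 := by
  simp [oscKernel, hψ.eq_zero hx (norm_nonneg x)]

theorem norm_oscKernel (x : Rn n) : ‖oscKernel Φ ψ K x‖ = |ψ ‖x‖ * K x| := by
  rw [oscKernel, norm_mul, Complex.norm_exp_ofReal_mul_I, one_mul, Complex.norm_real,
    Real.norm_eq_abs]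

theorem norm_oscKernel_sub_le {c C σ : ℝ} (h : PhaseBounds Φ c C σ) (hψ : IsLPCutoff ψ) {L M : ℝ≥0}
    (hL : LipschitzWith L fun x => ψ ‖x‖ * K x) (hM : ∀ x, |ψ ‖x‖ * K x| ≤ M) (x y : Rn n) :
    ‖oscKernel Φ ψ K x - oscKernel Φ ψ K y‖ ≤ (M * (2 * C * 2 ^ C * Φ 1) + L) * ‖x - y‖ := by
  have hC := h.C_pos
  have hΦ := h.pos 1 one_pos
  have hG : ∀ x y, |ψ ‖x‖ * K x - ψ ‖y‖ * K y| ≤ L * ‖x - y‖ := fun x y => by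
    simpa only [Real.norm_eq_abs] using hL.norm_sub_le x y
  have key : ∀ x y : Rn n, ‖y‖ ∉ Icc (1 / 2 : ℝ) 2 →
      ‖oscKernel Φ ψ K x - oscKernel Φ ψ K y‖ ≤ (M * (2 * C * 2 ^ C * Φ 1) + L) * ‖x - y‖ := by
    intro x y hy
    rw [oscKernel_eq_zero hψ hy, sub_zero, norm_oscKernel]
    have h1 := hG x y
    rw [hψ.eq_zero hy (norm_nonneg y), zero_mul, sub_zero] at h1
    refine h1.trans (mul_le_mul_of_nonneg_right ?_ (norm_nonneg _))
    have : (0 : ℝ) ≤ M * (2 * C * 2 ^ C * Φ 1) := by positivity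
    linarith
  by_cases hy : ‖y‖ ∈ Icc (1 / 2 : ℝ) 2
  · by_cases hx : ‖x‖ ∈ Icc (1 / 2 : ℝ) 2
    · have e : oscKernel Φ ψ K x - oscKernel Φ ψ K y =
          (Complex.exp (Φ ‖x‖ * Complex.I) - Complex.exp (Φ ‖y‖ * Complex.I)) *
            (ψ ‖y‖ * K y : ℝ) +
          Complex.exp (Φ ‖x‖ * Complex.I) * (ψ ‖x‖ * K x - ψ ‖y‖ * K y : ℝ) := by
        rw [oscKernel, oscKernel, Complex.ofReal_sub]; ring
      rw [e]
      refine (norm_add_le _ _).trans ?_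
      rw [norm_mul, norm_mul, Complex.norm_exp_ofReal_mul_I, one_mul, Complex.norm_real,
        Complex.norm_real, Real.norm_eq_abs, Real.norm_eq_abs, add_mul]
      refine add_le_add ?_ (hG x y)
      calc _ ≤ (2 * C * 2 ^ C * Φ 1 * |‖x‖ - ‖y‖|) * M :=
            mul_le_mul (h.norm_exp_sub_le hx hy) (hM y) (abs_nonneg _) (by positivity)
        _ ≤ (2 * C * 2 ^ C * Φ 1 * ‖x - y‖) * M := by
            gcongr; exact abs_norm_sub_norm_le x y
        _ = _ := by ring
    · rw [norm_sub_rev, norm_sub_rev x y]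
      exact key y x hx
  · exact key x y hy

theorem integrable_oscKernel {c C σ : ℝ} (h : PhaseBounds Φ c C σ) (hK : IsHomCZKernel n K)
    (hψ : IsLPCutoff ψ) : Integrable (oscKernel Φ ψ K) := by
  obtain ⟨L, M, hL, hM⟩ := exists_lipschitzWith_annular hK hψ
  have hlip : LipschitzWith (M * (2 * C * 2 ^ C * Φ 1) + L : ℝ).toNNReal (oscKernel Φ ψ K) :=
    LipschitzWith.of_dist_le_mul fun x y => by
      rw [dist_eq_norm, dist_eq_norm]
      exact (norm_oscKernel_sub_le h hψ hL hM x y).trans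
        (mul_le_mul_of_nonneg_right (Real.le_coe_toNNReal _) (norm_nonneg _))
  exact hlip.continuous.integrable_of_hasCompactSupport
    (HasCompactSupport.intro (isCompact_closedBall (0 : Rn n) 2)
      fun x hx => oscKernel_eq_zero hψ fun h => hx (mem_closedBall_zero_iff.2 h.2))

/-- The Fourier transform of `oscKernel` in polar coordinates. -/
theorem fourier_oscKernel (hn : n ≠ 0) {c C σ : ℝ} (h : PhaseBounds Φ c C σ)
    (hK : IsHomCZKernel n K) (hψ : IsLPCutoff ψ) (hΩ : ∀ c : ℝ, 0 < c → ∀ t : Rn n, Ω (c • t) = Ω t)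
    (hKΩ : ∀ t : Rn n, t ≠ 0 → K t = Ω t / ‖t‖ ^ n) (ξ : Rn n) :
    𝓕 (oscKernel Φ ψ K) ξ = ∫ θ : Metric.sphere (0 : Rn n) 1, (Ω θ : ℂ) *
      (∫ r in (1 / 2 : ℝ)..2, Complex.exp ((Φ r - 2 * Real.pi * inner ℝ (θ : Rn n) ξ * r : ℝ) *
        Complex.I) * (ψ r / r : ℝ)) ∂(volume : Measure (Rn n)).toSphere := by
  rw [Real.fourier_eq', integral_eq_integral_sphere hn]
  · refine integral_congr_ae (.of_forall fun θ => ?_)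
    have hθ : ‖(θ : Rn n)‖ = 1 := norm_eq_of_mem_sphere θ
    simp only
    rw [intervalIntegral.integral_of_le (by norm_num), ← integral_Icc_eq_integral_Ioc,
      ← integral_const_mul]
    rw [setIntegral_eq_of_subset_of_forall_sdiff_eq_zero (s := Icc (1 / 2 : ℝ) 2) measurableSet_Ioi]
    · refine setIntegral_congr_fun measurableSet_Icc fun r hr => ?_
      have hr0 : 0 < r := by linarith [hr.1]
      have hnr : ‖r • (θ : Rn n)‖ = r := by rw [norm_smul, hθ, mul_one, Real.norm_of_nonneg hr0.le]
      have hne : r • (θ : Rn n) ≠ 0 := by rw [← norm_ne_zero_iff, hnr]; exact hr0.ne'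
      have hexp : Complex.exp ((Φ r - 2 * Real.pi * inner ℝ (θ : Rn n) ξ * r : ℝ) * Complex.I) =
          Complex.exp ((-2 * Real.pi * (r * inner ℝ (θ : Rn n) ξ) : ℝ) * Complex.I) *
            Complex.exp (Φ r * Complex.I) := by
        rw [← Complex.exp_add]
        congr 1
        push_cast
        ring
      have hpow : r ^ n = r ^ (n - 1) * r := by
        rw [← pow_succ, Nat.sub_add_cancel (Nat.pos_of_ne_zero hn)]
      have hrc : (r : ℂ) ≠ 0 := by exact_mod_cast hr0.ne'
      simp only [oscKernel]
      rw [hKΩ _ hne, hnr, hΩ r hr0, hexp, real_inner_smul_left, hpow, Complex.real_smul]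
      simp only [smul_eq_mul]
      push_cast
      field_simp
    · exact fun r hr => lt_of_lt_of_le (by norm_num) hr.1
    · rintro r ⟨hr0, hr⟩
      have hnr : ‖r • (θ : Rn n)‖ = r := by
        rw [norm_smul, hθ, mul_one, Real.norm_of_nonneg (le_of_lt hr0)]
      rw [oscKernel_eq_zero hψ (by rwa [hnr]), smul_zero, smul_zero]
  · have h1 := (Real.fourierIntegral_convergent_iff (f := oscKernel Φ ψ K) (μ := volume) ξ).2
      (integrable_oscKernel h hK hψ)
    refine h1.congr (.of_forall fun x => ?_)
    simp only [Real.fourierChar_apply, Circle.smul_def]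
    congr 3
    push_cast
    ring

end Oscillatory

theorem fourier_apply_zero {n : ℕ} (g : Rn n → ℂ) : 𝓕 g 0 = ∫ x, g x := by
  simp [Real.fourier_eq']

theorem exists_isOscPiece {n : ℕ} (hn : n ≠ 0) {K : Rn n → ℝ} (hK : IsHomCZKernel n K) {ψ : ℝ → ℝ}
    (hψ : IsLPCutoff ψ) {c C σ : ℝ} (hc : 0 < c) :
    ∃ M : ℝ, 0 < M ∧ ∀ Φ : ℝ → ℝ, PhaseBounds Φ c C σ → 1 ≤ Φ 1 →
      IsOscPiece (oscKernel Φ ψ K) M (Φ 1) := by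
  obtain ⟨L, M₀, hL, hM₀⟩ := exists_lipschitzWith_annular hK hψ
  obtain ⟨Ω, hΩs, hΩ, hΩ0, hKΩ⟩ := id hK
  obtain ⟨MΩ, hMΩ⟩ : ∃ MΩ : ℝ, ∀ θ ∈ Metric.sphere (0 : Rn n) 1, ‖Ω θ‖ ≤ MΩ :=
    (isCompact_sphere _ _).exists_bound_of_continuousOn (hΩs.continuousOn.mono fun θ hθ => by
      simpa using ne_zero_of_mem_sphere one_ne_zero ⟨θ, hθ⟩)
  have hψd : ∀ r, HasDerivAt ψ (deriv ψ r) r := fun r =>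
    (hψ.1.differentiable (by simp) r).hasDerivAt
  have hψc : Continuous (deriv ψ) := hψ.1.continuous_deriv (by simp)
  set A' : ℝ → ℝ := fun r => (deriv ψ r * r - ψ r * 1) / r ^ 2 with hA'
  have hne : ∀ r ∈ Icc (1 / 2 : ℝ) 2, r ≠ 0 := fun r hr => by linarith [hr.1]
  have hA : ∀ r ∈ Icc (1 / 2 : ℝ) 2, HasDerivAt (fun r => ψ r / r) (A' r) r := fun r hr =>
    (hψd r).div (hasDerivAt_id r) (hne r hr)
  have hcA : ContinuousOn A' (Icc (1 / 2 : ℝ) 2) :=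
    (((hψc.mul continuous_id).sub (hψ.1.continuous.mul continuous_const)).continuousOn).div₀
      (continuous_pow 2).continuousOn fun r hr => pow_ne_zero 2 (hne r hr)
  obtain ⟨M', hM'⟩ := isCompact_Icc.exists_bound_of_continuousOn hcA
  have hM'0 : 0 ≤ M' := (norm_nonneg _).trans (hM' 1 (by norm_num))
  have hM2 : ∀ r ∈ Icc (1 / 2 : ℝ) 2, |ψ r / r| ≤ 2 := fun r hr => by
    have h1 := hψ.2.1 r
    rw [abs_of_nonneg (div_nonneg h1.1 (by linarith [hr.1])), div_le_iff₀ (by linarith [hr.1])]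
    linarith [h1.2, hr.1]
  set S : ℝ := ((volume : Measure (Rn n)).toSphere).real univ with hS
  set c₀ : ℝ := c / (4 * 2 ^ C) with hc₀
  have hc₀pos : 0 < c₀ := by positivity
  set M₁ : ℝ := |MΩ| * ((8 * 2 + M' * (2 - 1 / 2)) / √c₀) * S with hM₁
  set M₂ : ℝ := M₀ * (2 * |C| * 2 ^ C) + L with hM₂
  have hM₁0 : 0 ≤ M₁ := by
    have : (0 : ℝ) ≤ 8 * 2 + M' * (2 - 1 / 2) := by linarith
    positivity
  have hM₂0 : 0 ≤ M₂ := by positivity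
  refine ⟨1 + M₀ + M₁ + M₂, by positivity, fun Φ h hΦ => ⟨fun x hx => ?_, fun x => ?_, fun x y => ?_,
    ?_, fun ξ => ?_⟩⟩
  · exact oscKernel_eq_zero hψ fun hx' => absurd hx'.2 (not_le.2 hx)
  · rw [norm_oscKernel]
    linarith [hM₀ x]
  · refine (norm_oscKernel_sub_le h hψ hL hM₀ x y).trans
      (mul_le_mul_of_nonneg_right ?_ (norm_nonneg _))
    calc M₀ * (2 * C * 2 ^ C * Φ 1) + L ≤ M₀ * (2 * |C| * 2 ^ C * Φ 1) + L * Φ 1 := by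
          have := le_abs_self C
          have : (L : ℝ) ≤ L * Φ 1 := le_mul_of_one_le_right (by positivity) hΦ
          gcongr
      _ = M₂ * Φ 1 := by rw [hM₂]; ring
      _ ≤ _ := by gcongr; linarith [M₀.2]
  · rw [← fourier_apply_zero, fourier_oscKernel hn h hK hψ hΩ hKΩ]
    simp only [inner_zero_right, mul_zero, zero_mul, sub_zero]
    rw [integral_mul_const, integral_complex_ofReal, hΩ0, Complex.ofReal_zero, zero_mul]
  · rw [fourier_oscKernel hn h hK hψ hΩ hKΩ]
    have hpos : 0 < c₀ * Φ 1 := by positivity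
    have hin : ∀ θ : Metric.sphere (0 : Rn n) 1, ‖(Ω θ : ℂ) *
        (∫ r in (1 / 2 : ℝ)..2, Complex.exp ((Φ r - 2 * Real.pi * inner ℝ (θ : Rn n) ξ * r : ℝ) *
          Complex.I) * (ψ r / r : ℝ))‖ ≤
        |MΩ| * ((8 * 2 + M' * (2 - 1 / 2)) / √(c₀ * Φ 1)) := fun θ => by
      rw [norm_mul, Complex.norm_real]
      refine mul_le_mul ((hMΩ θ θ.2).trans (le_abs_self _)) ?_ (norm_nonneg _) (abs_nonneg _)
      refine norm_integral_exp_mul_le (φ := fun r => Φ r - 2 * Real.pi * inner ℝ (θ : Rn n) ξ * r)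
        (φ' := fun r => deriv Φ r - 2 * Real.pi * inner ℝ (θ : Rn n) ξ)
        (φ'' := deriv (deriv Φ)) (A' := A') (by norm_num) (fun r hr => ?_) (fun r hr => ?_)
        (h.continuousOn_deriv2.mono fun r hr => lt_of_lt_of_le (by norm_num) hr.1) hA hcA
        h.sign hpos (fun r hr => h.le_deriv2 hr) hM2 hM'
      · exact ((h.hasDerivAt r (lt_of_lt_of_le (by norm_num) hr.1)).sub
          ((hasDerivAt_id r).const_mul _)).congr_deriv (by ring)
      · exact (h.hasDerivAt_deriv r (lt_of_lt_of_le (by norm_num) hr.1)).sub_const _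
    refine (norm_integral_le_of_norm_le_const (.of_forall hin)).trans ?_
    rw [Real.sqrt_mul hc₀pos.le, ← div_div, mul_div_assoc', div_mul_eq_mul_div, ← hS, ← hM₁]
    gcongr
    linarith [M₀.2]

/-- The volume of the ball of radius `2`. -/
def ballVol (n : ℕ) : ℝ := volume.real (Metric.closedBall (0 : Rn n) 2)

theorem ballVol_nonneg (n : ℕ) : 0 ≤ ballVol n := measureReal_nonneg

theorem ofReal_ballVol (n : ℕ) (y : Rn n) :
    volume (Metric.closedBall y 2) = ENNReal.ofReal (ballVol n) := by
  rw [ballVol, ofReal_measureReal (measure_closedBall_lt_top).ne,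
    Measure.addHaar_closedBall_center]

namespace IsOscPiece

variable {n : ℕ} {g : Rn n → ℂ} {M Λ : ℝ} (h : IsOscPiece g M Λ)
include h

theorem nonneg : 0 ≤ M := (norm_nonneg _).trans (h.bound 0)

theorem continuous : Continuous g :=
  (LipschitzWith.of_dist_le_mul (K := (M * Λ).toNNReal) fun x y => by
    rw [dist_eq_norm, dist_eq_norm]
    exact (h.lipschitz x y).trans
      (mul_le_mul_of_nonneg_right (Real.le_coe_toNNReal _) (norm_nonneg _))).continuous

theorem integrable : Integrable g :=
  h.continuous.integrable_of_hasCompactSupport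
    (HasCompactSupport.intro (isCompact_closedBall (0 : Rn n) 2)
      fun x hx => h.support x (by simpa using hx))

theorem norm_sub_le_rpow (hΛ : 1 ≤ Λ) {δ : ℝ} (hδ : 0 < δ) (hδ1 : δ ≤ 1) (x y : Rn n) :
    ‖g (x - y) - g x‖ ≤ 2 * M * (Λ * ‖y‖) ^ δ := by
  have hM := h.nonneg
  rcases le_total (Λ * ‖y‖) 1 with h1 | h1
  · have h2 := h.lipschitz (x - y) x
    rw [sub_sub_cancel_left, norm_neg] at h2
    have h3 : Λ * ‖y‖ ≤ (Λ * ‖y‖) ^ δ := by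
      simpa using Real.rpow_le_rpow_of_exponent_ge_of_imp (by positivity) h1 hδ1 (by simp)
    calc ‖g (x - y) - g x‖ ≤ M * (Λ * ‖y‖) := by linarith
      _ ≤ M * (Λ * ‖y‖) ^ δ := by gcongr
      _ ≤ _ := by
        have : 0 ≤ M * (Λ * ‖y‖) ^ δ := by positivity
        linarith
  · have h2 := (norm_sub_le (g (x - y)) (g x)).trans (add_le_add (h.bound _) (h.bound _))
    have h3 := Real.one_le_rpow h1 hδ.le
    nlinarith

theorem lintegral_sub_le (hΛ : 1 ≤ Λ) {δ : ℝ} (hδ : 0 < δ) (hδ1 : δ ≤ 1) (y : Rn n) :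
    ∫⁻ x, ‖g (x - y) - g x‖ₑ ≤ ENNReal.ofReal (4 * M * ballVol n * (Λ * ‖y‖) ^ δ) := by
  have hM := h.nonneg
  set S : Set (Rn n) := Metric.closedBall 0 2 ∪ Metric.closedBall y 2 with hS
  have hb : ∀ x, ‖g (x - y) - g x‖ₑ ≤
      S.indicator (fun _ => ENNReal.ofReal (2 * M * (Λ * ‖y‖) ^ δ)) x := fun x => by
    by_cases hx : x ∈ S
    · rw [indicator_of_mem hx, ← ofReal_norm]
      exact ENNReal.ofReal_le_ofReal (h.norm_sub_le_rpow hΛ hδ hδ1 x y)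
    · simp only [hS, mem_union, not_or, mem_closedBall_iff_norm, sub_zero, not_le] at hx
      rw [h.support _ hx.1, h.support _ hx.2]
      simp
  calc ∫⁻ x, ‖g (x - y) - g x‖ₑ
      ≤ ∫⁻ x, S.indicator (fun _ => ENNReal.ofReal (2 * M * (Λ * ‖y‖) ^ δ)) x := lintegral_mono hb
    _ = ENNReal.ofReal (2 * M * (Λ * ‖y‖) ^ δ) * volume S := by
        rw [lintegral_indicator_const (Metric.isClosed_closedBall.measurableSet.union
          Metric.isClosed_closedBall.measurableSet)]
    _ ≤ ENNReal.ofReal (2 * M * (Λ * ‖y‖) ^ δ) * ENNReal.ofReal (2 * ballVol n) := by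
        gcongr
        refine (measure_union_le _ _).trans ?_
        rw [ofReal_ballVol, ofReal_ballVol, ← ENNReal.ofReal_add (ballVol_nonneg n)
          (ballVol_nonneg n), two_mul]
    _ = _ := by
        rw [← ENNReal.ofReal_mul (by positivity)]
        congr 1
        ring

theorem norm_fourier_le_mul (ξ : Rn n) : ‖𝓕 g ξ‖ ≤ 4 * Real.pi * M * ballVol n * ‖ξ‖ := by
  have hM := h.nonneg
  have h1 : 𝓕 g ξ = ∫ x, (Complex.exp (Complex.I * (-2 * Real.pi * inner ℝ x ξ : ℝ)) - 1) * g x := by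
    have hi : Integrable fun x => Complex.exp (Complex.I * (-2 * Real.pi * inner ℝ x ξ : ℝ)) * g x := by
      refine h.integrable.bdd_mul (c := 1) (by fun_prop) (.of_forall fun x => ?_)
      rw [mul_comm, Complex.norm_exp_ofReal_mul_I]
    simp only [sub_mul, one_mul]
    rw [integral_sub hi h.integrable, h.integral, sub_zero, Real.fourier_eq']
    refine integral_congr_ae (.of_forall fun x => ?_)
    simp only [smul_eq_mul]
    rw [mul_comm Complex.I]
  have hb : ∀ x, ‖(Complex.exp (Complex.I * (-2 * Real.pi * inner ℝ x ξ : ℝ)) - 1) * g x‖ ≤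
      (Metric.closedBall (0 : Rn n) 2).indicator (fun _ => 4 * Real.pi * ‖ξ‖ * M) x := fun x => by
    by_cases hx : x ∈ Metric.closedBall (0 : Rn n) 2
    · rw [indicator_of_mem hx, norm_mul]
      refine mul_le_mul (Real.norm_exp_I_mul_ofReal_sub_one_le.trans ?_) (h.bound x)
        (norm_nonneg _) (by positivity)
      rw [mem_closedBall_zero_iff] at hx
      rw [norm_mul, norm_mul, norm_neg, Real.norm_of_nonneg Real.pi_pos.le, Real.norm_of_nonneg
        two_pos.le]
      calc 2 * Real.pi * ‖inner ℝ x ξ‖ ≤ 2 * Real.pi * (2 * ‖ξ‖) := by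
            gcongr
            exact (norm_inner_le_norm x ξ).trans (by gcongr)
        _ = _ := by ring
    · rw [h.support x (by simpa using hx), indicator_of_notMem hx]
      simp
  rw [h1]
  refine (norm_integral_le_of_norm_le ?_ (.of_forall hb)).trans_eq ?_
  · exact (integrable_indicator_iff Metric.isClosed_closedBall.measurableSet).2
      (integrableOn_const measure_closedBall_lt_top.ne)
  · rw [integral_indicator_const _ Metric.isClosed_closedBall.measurableSet, smul_eq_mul, ← ballVol]
    ring

theorem norm_fourier_le_div (hΛ : 1 ≤ Λ) {ξ : Rn n} (hξ : ξ ≠ 0) :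
    ‖𝓕 g ξ‖ ≤ M * ballVol n * Λ / ‖ξ‖ := by
  have hM := h.nonneg
  have hv := ballVol_nonneg n
  have hξ' : 0 < ‖ξ‖ := norm_pos_iff.2 hξ
  set y : Rn n := -((1 / (2 * ‖ξ‖ ^ 2)) • ξ) with hy
  have hyn : ‖y‖ = 1 / (2 * ‖ξ‖) := by
    rw [hy, norm_neg, norm_smul, Real.norm_of_nonneg (by positivity)]
    field_simp
  rw [Real.fourier_eq, fourierIntegral_eq_half_sub_half_period_translate hξ h.integrable, norm_smul]
  have h1 : ‖∫ v, 𝐞 (-inner ℝ v ξ) • (g v - g (v + (1 / (2 * ‖ξ‖ ^ 2)) • ξ))‖ ≤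
      4 * M * ballVol n * (Λ * ‖y‖) := by
    rw [← ENNReal.ofReal_le_ofReal_iff (by positivity), ofReal_norm]
    refine (enorm_integral_le_lintegral_enorm _).trans (le_trans (le_of_eq ?_)
      ((h.lintegral_sub_le hΛ one_pos le_rfl y).trans_eq (by rw [Real.rpow_one])))
    refine lintegral_congr fun v => ?_
    rw [hy, sub_neg_eq_add, ← ofReal_norm, ← ofReal_norm, Circle.norm_smul,
      norm_sub_rev]
  calc _ ≤ ‖(1 / 2 : ℂ)‖ * (4 * M * ballVol n * (Λ * ‖y‖)) := by gcongr
    _ = _ := by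
      rw [hyn]
      norm_num
      field_simp
      norm_num

theorem norm_fourier_sq_le (hΛ : 1 ≤ Λ) {ξ : Rn n} (hξ : ξ ≠ 0) :
    ‖𝓕 g ξ‖ ^ 2 ≤ (M * (1 + 4 * Real.pi * ballVol n)) ^ 2 * Λ ^ (-(1 / 4) : ℝ) *
      (min ‖ξ‖ ‖ξ‖⁻¹) ^ (1 / 2 : ℝ) := by
  have hM := h.nonneg
  have hv := ballVol_nonneg n
  have hξ' : 0 < ‖ξ‖ := norm_pos_iff.2 hξ
  have hΛ0 : 0 < Λ := by linarith
  set N := M * (1 + 4 * Real.pi * ballVol n) with hN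
  have hN0 : 0 ≤ N := by positivity
  set Y := min ‖ξ‖ ‖ξ‖⁻¹ with hY
  have hY0 : 0 < Y := lt_min hξ' (inv_pos.2 hξ')
  have hpi : 1 ≤ 4 * Real.pi := by linarith [Real.pi_gt_three]
  have h1 : ‖𝓕 g ξ‖ ≤ N / √Λ := (h.fourier ξ).trans <| by
    gcongr
    rw [hN]
    exact le_mul_of_one_le_right hM (by linarith [mul_nonneg (zero_le_one.trans hpi) hv])
  have h2 : ‖𝓕 g ξ‖ ≤ N * Λ * Y := by
    have h3 : 4 * Real.pi * M * ballVol n ≤ N := by rw [hN]; nlinarith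
    have h4 : M * ballVol n ≤ N := by
      refine le_trans ?_ h3
      nlinarith [mul_nonneg hM hv]
    rcases le_total ‖ξ‖ ‖ξ‖⁻¹ with hle | hle
    · rw [hY, min_eq_left hle]
      refine (h.norm_fourier_le_mul ξ).trans ?_
      have : N ≤ N * Λ := le_mul_of_one_le_right hN0 hΛ
      exact mul_le_mul_of_nonneg_right (h3.trans this) hξ'.le
    · rw [hY, min_eq_right hle, ← div_eq_mul_inv]
      refine (h.norm_fourier_le_div hΛ hξ).trans ?_
      gcongr
  have h0 := norm_nonneg (𝓕 g ξ)
  refine le_of_pow_le_pow_left₀ (n := 4) (by norm_num) (by positivity) ?_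
  have e1 : (Λ ^ (-(1 / 4) : ℝ)) ^ 4 = Λ⁻¹ := by
    rw [← Real.rpow_natCast, ← Real.rpow_mul hΛ0.le, ← Real.rpow_neg_one]; norm_num
  have e2 : (Y ^ (1 / 2 : ℝ)) ^ 4 = Y ^ 2 := by
    rw [← Real.rpow_natCast, ← Real.rpow_mul hY0.le, ← Real.rpow_natCast]; norm_num
  rw [mul_pow, mul_pow, e1, e2]
  calc (‖𝓕 g ξ‖ ^ 2) ^ 4 = ‖𝓕 g ξ‖ ^ 6 * ‖𝓕 g ξ‖ ^ 2 := by ring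
    _ ≤ (N / √Λ) ^ 6 * (N * Λ * Y) ^ 2 := by gcongr
    _ = N ^ 8 * (Λ ^ 2 / (√Λ ^ 2) ^ 3) * Y ^ 2 := by ring
    _ = _ := by
      rw [Real.sq_sqrt hΛ0.le]
      field_simp

end IsOscPiece

/-- The `L¹`-normalized dilation `aⁿ g(a x)`. -/
def dilate {n : ℕ} (a : ℝ) (g : Rn n → ℂ) (x : Rn n) : ℂ := (a ^ n : ℝ) • g (a • x)

theorem lintegral_comp_smul_Rn {n : ℕ} {a : ℝ} (ha : 0 < a) (f : Rn n → ℝ≥0∞) :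
    ENNReal.ofReal (a ^ n) * ∫⁻ x, f (a • x) = ∫⁻ x, f x := by
  have h1 : ∫⁻ x, f (a • x) = ENNReal.ofReal (a ^ n)⁻¹ * ∫⁻ x, f x := by
    have h2 := Measure.map_addHaar_smul (volume : Measure (Rn n)) ha.ne'
    rw [finrank_euclideanSpace_fin, abs_of_pos (by positivity)] at h2
    rw [← smul_eq_mul, ← lintegral_smul_measure, ← h2]
    exact ((Homeomorph.smulOfNeZero a ha.ne').measurableEmbedding.lintegral_map f).symm
  rw [h1, ← mul_assoc, ← ENNReal.ofReal_mul (by positivity), mul_inv_cancel₀ (by positivity),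
    ENNReal.ofReal_one, one_mul]

theorem lintegral_dilate_sub {n : ℕ} {a : ℝ} (ha : 0 < a) (g : Rn n → ℂ) (w : Rn n) :
    ∫⁻ x, ‖dilate a g (x - w) - dilate a g x‖ₑ = ∫⁻ x, ‖g (x - a • w) - g x‖ₑ := by
  rw [← lintegral_comp_smul_Rn ha (fun x => ‖g (x - a • w) - g x‖ₑ), ← lintegral_const_mul' _ _ ENNReal.ofReal_ne_top]
  refine lintegral_congr fun x => ?_
  rw [dilate, dilate, ← smul_sub, enorm_smul, Real.enorm_eq_ofReal (by positivity), smul_sub]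

theorem fourier_dilate {n : ℕ} {a : ℝ} (ha : 0 < a) (g : Rn n → ℂ) (ξ : Rn n) :
    𝓕 (dilate a g) ξ = 𝓕 g (a⁻¹ • ξ) := by
  have h1 := Measure.integral_comp_smul (volume : Measure (Rn n))
    (fun x => Complex.exp (((-2 * Real.pi * inner ℝ x (a⁻¹ • ξ) : ℝ) : ℂ) * Complex.I) • g x) a
  rw [finrank_euclideanSpace_fin, abs_of_pos (by positivity)] at h1
  rw [Real.fourier_eq', Real.fourier_eq']
  rw [inv_smul_eq_iff₀ (by positivity) |>.1 h1.symm, ← integral_smul]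
  refine integral_congr_ae (.of_forall fun x => ?_)
  simp only [dilate]
  rw [real_inner_smul_left, real_inner_smul_right, mul_inv_cancel_left₀ ha.ne', smul_comm]

theorem exists_min_rpow_le {X : ℝ} (hX : 0 < X) {δ : ℝ} (hδ : 0 < δ) (hδ1 : δ ≤ 1) :
    ∃ m : ℤ, ∀ j : ℤ, (min (2 ^ j * X) (2 ^ j * X)⁻¹) ^ δ ≤
      2 * ((2 : ℝ) ^ (-δ)) ^ (j + m).natAbs := by
  obtain ⟨m, hm1, hm2⟩ := exists_mem_Ico_zpow hX one_lt_two
  refine ⟨m, fun j => ?_⟩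
  have hpos : 0 < (2 : ℝ) ^ j * X := by positivity
  have h1 : min (2 ^ j * X) (2 ^ j * X)⁻¹ ≤ 2 * (1 / 2) ^ (j + m).natAbs := by
    rcases le_total 0 (j + m) with hi | hi
    · obtain ⟨i, hi⟩ := Int.eq_ofNat_of_zero_le hi
      refine (min_le_right _ _).trans ?_
      have h2 : (2 : ℝ) ^ i ≤ 2 ^ j * X := by
        calc (2 : ℝ) ^ i = 2 ^ (j + m) := by rw [hi, zpow_natCast]
          _ = 2 ^ j * 2 ^ m := zpow_add₀ two_ne_zero _ _
          _ ≤ _ := by gcongr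
      rw [hi, Int.natAbs_natCast, one_div, inv_pow]
      have h3 := inv_anti₀ (by positivity) h2
      have : (0 : ℝ) ≤ (2 ^ i)⁻¹ := by positivity
      linarith
    · obtain ⟨i, hi⟩ := Int.eq_ofNat_of_zero_le (neg_nonneg.2 hi)
      refine (min_le_left _ _).trans ?_
      have hi' : j + m = -(i : ℤ) := by omega
      rw [hi', Int.natAbs_neg, Int.natAbs_natCast, one_div, inv_pow]
      calc (2 : ℝ) ^ j * X ≤ 2 ^ j * 2 ^ (m + 1) := by gcongr
        _ = 2 ^ (j + m + 1) := by rw [← zpow_add₀ two_ne_zero, add_assoc]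
        _ = _ := by rw [hi', zpow_add_one₀ two_ne_zero, zpow_neg, zpow_natCast, mul_comm]
  calc (min (2 ^ j * X) (2 ^ j * X)⁻¹) ^ δ ≤ (2 * (1 / 2) ^ (j + m).natAbs) ^ δ :=
        Real.rpow_le_rpow (le_min hpos.le (inv_nonneg.2 hpos.le)) h1 hδ.le
    _ = 2 ^ δ * ((2 : ℝ) ^ (-δ)) ^ (j + m).natAbs := by
        rw [Real.mul_rpow (by positivity) (by positivity), ← Real.rpow_natCast, ← Real.rpow_natCast,
          ← Real.rpow_mul (by positivity), one_div, Real.inv_rpow (by positivity), Real.rpow_neg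
          (by positivity), Real.inv_rpow (by positivity), ← Real.rpow_mul (by positivity), mul_comm δ]
    _ ≤ _ := by
        gcongr
        simpa using Real.rpow_le_rpow_of_exponent_le one_le_two hδ1

/-- The sum of a two-sided geometric series. -/
def geomSum (δ : ℝ) : ℝ≥0∞ := ∑' i : ℤ, ENNReal.ofReal (2 * ((2 : ℝ) ^ (-δ)) ^ i.natAbs)

theorem geomSum_ne_top {δ : ℝ} (hδ : 0 < δ) : geomSum δ ≠ ⊤ := by
  have h1 : Summable fun i : ℕ => 2 * ((2 : ℝ) ^ (-δ)) ^ i :=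
    (summable_geometric_of_lt_one (by positivity)
      (Real.rpow_lt_one_of_one_lt_of_neg one_lt_two (neg_neg_iff_pos.2 hδ))).mul_left 2
  refine Summable.tsum_ofReal_ne_top (Summable.of_nat_of_neg ?_ ?_) <;> simpa using h1

theorem sum_comp_le_mul_tsum {ι κ : Type*} [DecidableEq κ] {F : Finset ι} {e : ι → κ} {N : ℕ}
    (hN : ∀ i, (F.filter fun k => e k = i).card ≤ N) (w : κ → ℝ≥0∞) :
    ∑ k ∈ F, w (e k) ≤ N * ∑' i, w i := by
  rw [Finset.sum_comp w e]
  calc ∑ i ∈ F.image e, (F.filter fun k => e k = i).card • w i ≤ ∑ i ∈ F.image e, N * w i := by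
        refine Finset.sum_le_sum fun i _ => ?_
        rw [nsmul_eq_mul]
        gcongr
        exact hN i
    _ = N * ∑ i ∈ F.image e, w i := by rw [Finset.mul_sum]
    _ ≤ _ := by gcongr; exact ENNReal.sum_le_tsum _

theorem sum_min_rpow_le {ι : Type*} {F : Finset ι} {e : ι → ℤ} {N : ℕ}
    (hN : ∀ i, (F.filter fun k => e k = i).card ≤ N) {X : ℝ} (hX : 0 < X) {δ : ℝ} (hδ : 0 < δ)
    (hδ1 : δ ≤ 1) :
    ∑ k ∈ F, ENNReal.ofReal ((min (2 ^ e k * X) (2 ^ e k * X)⁻¹) ^ δ) ≤ N * geomSum δ := by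
  obtain ⟨m, hm⟩ := exists_min_rpow_le hX hδ hδ1
  calc _ ≤ ∑ k ∈ F, ENNReal.ofReal (2 * ((2 : ℝ) ^ (-δ)) ^ (e k + m).natAbs) :=
        Finset.sum_le_sum fun k _ => ENNReal.ofReal_le_ofReal (hm (e k))
    _ ≤ N * ∑' i : ℤ, ENNReal.ofReal (2 * ((2 : ℝ) ^ (-δ)) ^ (i + m).natAbs) :=
        sum_comp_le_mul_tsum hN fun i : ℤ => ENNReal.ofReal (2 * ((2 : ℝ) ^ (-δ)) ^ (i + m).natAbs)
    _ = N * geomSum δ := by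
        rw [geomSum, ← (Equiv.addRight m).tsum_eq
          fun i : ℤ => ENNReal.ofReal (2 * ((2 : ℝ) ^ (-δ)) ^ i.natAbs)]
        rfl

namespace IsOscPiece

variable {n : ℕ} {g : Rn n → ℂ} {M Λ : ℝ} (h : IsOscPiece g M Λ)
include h

theorem continuous_dilate (a : ℝ) : Continuous (dilate a g) :=
  (h.continuous.comp (continuous_const_smul a)).const_smul (a ^ n)

theorem norm_dilate_le {a : ℝ} (ha : 0 < a) (x : Rn n) : ‖dilate a g x‖ ≤ a ^ n * M := by
  rw [dilate, norm_smul, Real.norm_of_nonneg (by positivity)]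
  exact mul_le_mul_of_nonneg_left (h.bound _) (by positivity)

theorem dilate_eq_zero {a : ℝ} (ha : 0 < a) {x : Rn n} (hx : 2 / a < ‖x‖) : dilate a g x = 0 := by
  rw [dilate, h.support, smul_zero]
  rw [norm_smul, Real.norm_of_nonneg ha.le]
  rwa [div_lt_iff₀' ha] at hx

theorem integrable_dilate {a : ℝ} (ha : 0 < a) : Integrable (dilate a g) :=
  (h.continuous_dilate a).integrable_of_hasCompactSupport
    (HasCompactSupport.intro (isCompact_closedBall (0 : Rn n) (2 / a))
      fun x hx => h.dilate_eq_zero ha (by simpa using hx))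

theorem norm_fourier_dilate_sq_le (hΛ : 1 ≤ Λ) (j : ℤ) {ξ : Rn n} (hξ : ξ ≠ 0) :
    ‖𝓕 (dilate (2 ^ (-j)) g) ξ‖ ^ 2 ≤
      (M * (1 + 4 * Real.pi * ballVol n)) ^ 2 * Λ ^ (-(1 / 4) : ℝ) *
        (min (2 ^ j * ‖ξ‖) (2 ^ j * ‖ξ‖)⁻¹) ^ (1 / 2 : ℝ) := by
  rw [fourier_dilate (by positivity), zpow_neg, inv_inv]
  have h1 := h.norm_fourier_sq_le hΛ (ξ := (2 : ℝ) ^ j • ξ) (smul_ne_zero (by positivity) hξ)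
  rwa [norm_smul, Real.norm_of_nonneg (by positivity)] at h1

theorem setLIntegral_dilate_sub_le (hΛ : 1 ≤ Λ) {δ : ℝ} (hδ : 0 < δ) (hδ1 : δ ≤ 1) (j : ℤ)
    {w : Rn n} (hw : w ≠ 0) :
    ∫⁻ x in {x | 2 * ‖w‖ ≤ ‖x‖}, ‖dilate (2 ^ (-j)) g (x - w) - dilate (2 ^ (-j)) g x‖ₑ ≤
      ENNReal.ofReal (16 * M * ballVol n * Λ ^ δ) *
        ENNReal.ofReal ((min (2 ^ j * ‖w‖⁻¹) (2 ^ j * ‖w‖⁻¹)⁻¹) ^ δ) := by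
  have hM := h.nonneg
  have hv := ballVol_nonneg n
  have hw' : 0 < ‖w‖ := norm_pos_iff.2 hw
  have ha : (0 : ℝ) < 2 ^ (-j) := by positivity
  have hinv : (2 : ℝ) ^ j = (2 ^ (-j))⁻¹ := by rw [zpow_neg, inv_inv]
  set a : ℝ := 2 ^ (-j) with haj
  set Y := a * ‖w‖ with hY
  have hY0 : 0 < Y := by positivity
  have hYX : (2 : ℝ) ^ j * ‖w‖⁻¹ = Y⁻¹ := by rw [hinv, hY, mul_inv]
  rw [hYX, inv_inv]
  rcases le_or_gt Y 2 with h2 | h2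
  · refine (setLIntegral_le_lintegral _ _).trans ?_
    rw [lintegral_dilate_sub ha]
    refine (h.lintegral_sub_le hΛ hδ hδ1 _).trans ?_
    rw [← ENNReal.ofReal_mul (by positivity), norm_smul, Real.norm_of_nonneg ha.le, ← hY,
      Real.mul_rpow (by positivity) hY0.le]
    refine ENNReal.ofReal_le_ofReal ?_
    have hmin : Y ≤ 4 * min Y⁻¹ Y := by
      rcases le_total Y⁻¹ Y with h3 | h3
      · rw [min_eq_left h3, ← div_eq_mul_inv, le_div_iff₀ hY0]
        nlinarith
      · rw [min_eq_right h3]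
        linarith
    have hmin0 : 0 < min Y⁻¹ Y := lt_min (inv_pos.2 hY0) hY0
    have h4 : Y ^ δ ≤ 4 * (min Y⁻¹ Y) ^ δ := by
      calc Y ^ δ ≤ (4 * min Y⁻¹ Y) ^ δ := by gcongr
        _ = 4 ^ δ * (min Y⁻¹ Y) ^ δ := Real.mul_rpow (by norm_num) hmin0.le
        _ ≤ _ := by
          gcongr
          simpa using Real.rpow_le_rpow_of_exponent_le (by norm_num : (1 : ℝ) ≤ 4) hδ1
    calc 4 * M * ballVol n * (Λ ^ δ * Y ^ δ)
        ≤ 4 * M * ballVol n * (Λ ^ δ * (4 * (min Y⁻¹ Y) ^ δ)) := by gcongr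
      _ = _ := by ring
  · refine le_of_eq_of_le ?_ zero_le
    have hms : MeasurableSet {x : Rn n | 2 * ‖w‖ ≤ ‖x‖} :=
      (isClosed_le continuous_const continuous_norm).measurableSet
    rw [setLIntegral_congr_fun hms (g := fun _ => 0), lintegral_zero]
    intro x hx
    have hx' : 2 * ‖w‖ ≤ ‖x‖ := hx
    have h3 : 2 / a < ‖w‖ := by rwa [div_lt_iff₀' ha]
    have h4 : ‖w‖ ≤ ‖x - w‖ := by
      have := norm_sub_norm_le x w
      linarith
    simp only
    rw [h.dilate_eq_zero ha (h3.trans_le h4), h.dilate_eq_zero ha (by linarith), sub_zero,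
      enorm_zero]

end IsOscPiece

/-- A finite family of kernels as a vector valued kernel. -/
def vecKernel {n : ℕ} {ι : Type*} (F : Finset ι) (h : ι → Rn n → ℂ) (x : Rn n) :
    EuclideanSpace ℂ F := WithLp.toLp 2 fun k => h k x

section VecKernel

variable {n : ℕ} {ι : Type*} {F : Finset ι} {h : ι → Rn n → ℂ}

theorem continuous_vecKernel (hc : ∀ k, Continuous (h k)) : Continuous (vecKernel F h) :=
  (PiLp.continuous_toLp 2 _).comp (continuous_pi fun k => hc k)

theorem norm_euclidean_le_sum {κ : Type*} [Fintype κ] (v : EuclideanSpace ℂ κ) :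
    ‖v‖ ≤ ∑ k, ‖v k‖ := by
  rw [EuclideanSpace.norm_eq, Real.sqrt_le_left (Finset.sum_nonneg fun _ _ => norm_nonneg _)]
  exact Finset.sum_sq_le_sq_sum_of_nonneg fun _ _ => norm_nonneg _

theorem enorm_euclidean_le_sum {κ : Type*} [Fintype κ] (v : EuclideanSpace ℂ κ) :
    ‖v‖ₑ ≤ ∑ k, ‖v k‖ₑ := by
  simp_rw [← ofReal_norm]
  rw [← ENNReal.ofReal_sum_of_nonneg fun _ _ => norm_nonneg _]
  exact ENNReal.ofReal_le_ofReal (norm_euclidean_le_sum v)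

theorem enorm_euclidean_sq {κ : Type*} [Fintype κ] (v : EuclideanSpace ℂ κ) :
    ‖v‖ₑ ^ 2 = ∑ k, ‖v k‖ₑ ^ 2 := by
  simp_rw [← ofReal_norm, ← ENNReal.ofReal_pow (norm_nonneg _)]
  rw [EuclideanSpace.norm_sq_eq, ENNReal.ofReal_sum_of_nonneg fun _ _ => by positivity]

theorem integrable_vecKernel (hc : ∀ k, Continuous (h k)) (hi : ∀ k, Integrable (h k)) :
    Integrable (vecKernel F h) := by
  refine (integrable_finsetSum (Finset.univ : Finset F) fun k _ => (hi k).norm).mono'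
    (continuous_vecKernel hc).aestronglyMeasurable (.of_forall fun x => ?_)
  exact norm_euclidean_le_sum _

theorem fourier_vecKernel (hc : ∀ k, Continuous (h k)) (hi : ∀ k, Integrable (h k)) (ξ : Rn n)
    (k : F) : (𝓕 (vecKernel F h) ξ) k = 𝓕 (h k) ξ := by
  rw [Real.fourier_eq, Real.fourier_eq]
  have h1 := (EuclideanSpace.proj k : EuclideanSpace ℂ F →L[ℂ] ℂ).integral_comp_comm
    ((Real.fourierIntegral_convergent_iff ξ).2 (integrable_vecKernel (F := F) hc hi))
  exact h1.symm

end VecKernel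

theorem IsOscPiece.comp_neg {n : ℕ} {g : Rn n → ℂ} {M Λ : ℝ} (h : IsOscPiece g M Λ) :
    IsOscPiece (fun x => g (-x)) M Λ where
  support x hx := h.support _ (by rwa [norm_neg])
  bound x := h.bound _
  lipschitz x y := by
    refine (h.lipschitz _ _).trans_eq ?_
    rw [neg_sub_neg, norm_sub_rev]
  integral := by rw [integral_neg_eq_self, h.integral]
  fourier ξ := by
    have : 𝓕 (fun x => g (-x)) ξ = 𝓕 g (-ξ) := by
      rw [Real.fourier_eq', Real.fourier_eq', ← integral_neg_eq_self]
      simp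
    rw [this]
    exact h.fourier _

/-- A family of oscillatory pieces at scales `2 ^ e k`, with frequencies between `D₁` and `D₂`
and at most `N` pieces at each scale. -/
structure IsPieceFamily {n : ℕ} {ι : Type*} (F : Finset ι) (g : ι → Rn n → ℂ) (e : ι → ℤ)
    (M D₁ D₂ : ℝ) (N : ℕ) : Prop where
  one_le : 1 ≤ D₁
  piece : ∀ k, ∃ Λ, D₁ ≤ Λ ∧ Λ ≤ D₂ ∧ IsOscPiece (g k) M Λ
  card : ∀ i, (F.filter fun k => e k = i).card ≤ N

/-- The vector-valued kernel attached to a family of pieces. -/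
def pieceKernel {n : ℕ} {ι : Type*} (F : Finset ι) (g : ι → Rn n → ℂ) (e : ι → ℤ) :
    Rn n → EuclideanSpace ℂ F :=
  vecKernel F fun k => dilate (2 ^ (-e k)) (g k)

namespace IsPieceFamily

variable {n : ℕ} {ι : Type*} {F : Finset ι} {g : ι → Rn n → ℂ} {e : ι → ℤ} {M D₁ D₂ : ℝ} {N : ℕ}
  (h : IsPieceFamily F g e M D₁ D₂ N)
include h

theorem comp_neg : IsPieceFamily F (fun k x => g k (-x)) e M D₁ D₂ N where
  one_le := h.one_le
  piece k := by
    obtain ⟨Λ, h1, h2, h3⟩ := h.piece k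
    exact ⟨Λ, h1, h2, h3.comp_neg⟩
  card := h.card

theorem continuous_dilate (k : ι) : Continuous (dilate (2 ^ (-e k)) (g k)) := by
  obtain ⟨Λ, h1, h2, h3⟩ := h.piece k
  exact h3.continuous_dilate _

theorem integrable_dilate (k : ι) : Integrable (dilate (2 ^ (-e k)) (g k)) := by
  obtain ⟨Λ, h1, h2, h3⟩ := h.piece k
  exact h3.integrable_dilate (by positivity)

theorem continuous : Continuous (pieceKernel F g e) :=
  continuous_vecKernel h.continuous_dilate

theorem integrable : Integrable (pieceKernel F g e) :=
  integrable_vecKernel h.continuous_dilate h.integrable_dilate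

theorem exists_bound : ∃ A, ∀ x, ‖pieceKernel F g e x‖ ≤ A := by
  refine ⟨∑ k : F, (2 ^ (-e k)) ^ n * M, fun x => (norm_euclidean_le_sum _).trans ?_⟩
  refine Finset.sum_le_sum fun k _ => ?_
  obtain ⟨Λ, h1, h2, h3⟩ := h.piece k
  exact h3.norm_dilate_le (by positivity) x

theorem enorm_fourier_sq_le (ξ : Rn n) :
    ‖𝓕 (pieceKernel F g e) ξ‖ₑ ^ 2 ≤
      ENNReal.ofReal ((M * (1 + 4 * Real.pi * ballVol n)) ^ 2 * D₁ ^ (-(1 / 4) : ℝ)) *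
        (N * geomSum (1 / 2)) := by
  have hD := h.one_le
  rw [enorm_euclidean_sq]
  simp_rw [pieceKernel, fourier_vecKernel h.continuous_dilate h.integrable_dilate]
  rw [Finset.sum_coe_sort F fun k => ‖𝓕 (dilate (2 ^ (-e k)) (g k)) ξ‖ₑ ^ 2]
  rcases eq_or_ne ξ 0 with rfl | hξ
  · refine le_of_eq_of_le (Finset.sum_eq_zero fun k _ => ?_) zero_le
    obtain ⟨Λ, h1, h2, h3⟩ := h.piece k
    rw [fourier_dilate (by positivity), smul_zero, fourier_apply_zero, h3.integral]
    simp
  · refine le_trans ?_ (mul_le_mul_right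
      (sum_min_rpow_le h.card (norm_pos_iff.2 hξ) one_half_pos one_half_lt_one.le) _)
    rw [Finset.mul_sum]
    refine Finset.sum_le_sum fun k _ => ?_
    obtain ⟨Λ, h1, h2, h3⟩ := h.piece k
    rw [← ENNReal.ofReal_mul (by positivity), ← ofReal_norm,
      ← ENNReal.ofReal_pow (norm_nonneg _)]
    refine ENNReal.ofReal_le_ofReal ((h3.norm_fourier_dilate_sq_le (hD.trans h1) _ hξ).trans ?_)
    refine mul_le_mul_of_nonneg_right (mul_le_mul_of_nonneg_left ?_ (by positivity))
      (by positivity)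
    exact Real.rpow_le_rpow_of_nonpos (by linarith) h1 (by norm_num)

theorem setLIntegral_sub_le {δ : ℝ} (hδ : 0 < δ) (hδ1 : δ ≤ 1) (w : Rn n) :
    ∫⁻ x in {x | 2 * ‖w‖ ≤ ‖x‖}, ‖pieceKernel F g e (x - w) - pieceKernel F g e x‖ₑ ≤
      ENNReal.ofReal (16 * M * ballVol n * D₂ ^ δ) * (N * geomSum δ) := by
  have hD := h.one_le
  have hv := ballVol_nonneg n
  rcases eq_or_ne w 0 with rfl | hw
  · simp
  refine le_trans ?_ (mul_le_mul_right
    (sum_min_rpow_le h.card (inv_pos.2 (norm_pos_iff.2 hw)) hδ hδ1) _)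
  rw [Finset.mul_sum]
  calc _ ≤ ∫⁻ x in {x | 2 * ‖w‖ ≤ ‖x‖}, ∑ k ∈ F,
        ‖dilate (2 ^ (-e k)) (g k) (x - w) - dilate (2 ^ (-e k)) (g k) x‖ₑ := by
        refine lintegral_mono fun x => (enorm_euclidean_le_sum _).trans_eq ?_
        exact Finset.sum_coe_sort F fun k =>
          ‖dilate (2 ^ (-e k)) (g k) (x - w) - dilate (2 ^ (-e k)) (g k) x‖ₑ
    _ = ∑ k ∈ F, ∫⁻ x in {x | 2 * ‖w‖ ≤ ‖x‖},
        ‖dilate (2 ^ (-e k)) (g k) (x - w) - dilate (2 ^ (-e k)) (g k) x‖ₑ := by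
        refine lintegral_finsetSum _ fun k _ => ?_
        have := h.continuous_dilate k
        fun_prop
    _ ≤ _ := by
        refine Finset.sum_le_sum fun k _ => ?_
        obtain ⟨Λ, h1, h2, h3⟩ := h.piece k
        have hM := h3.nonneg
        refine (h3.setLIntegral_dilate_sub_le (hD.trans h1) hδ hδ1 _ hw).trans ?_
        refine mul_le_mul_left (ENNReal.ofReal_le_ofReal ?_) _
        refine mul_le_mul_of_nonneg_left (Real.rpow_le_rpow (by linarith) h2 hδ.le) ?_
        positivity

end IsPieceFamily

theorem memLp_two_of_bounded {n : ℕ} {E : Type*} [NormedAddCommGroup E] {f : Rn n → E}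
    (hf : Integrable f) {R : ℝ} (hR : ∀ x, ‖f x‖ ≤ R) : MemLp f 2 := by
  rw [memLp_two_iff_integrable_sq_norm hf.1]
  refine (hf.norm.const_mul R).mono' (hf.1.norm.pow 2) (.of_forall fun x => ?_)
  rw [Real.norm_of_nonneg (by positivity), sq]
  exact mul_le_mul_of_nonneg_right (hR x) (norm_nonneg _)

theorem kernelOp_eq_convolution {n : ℕ} {F₁ F₂ F₃ : Type*} [NormedAddCommGroup F₁]
    [NormedSpace ℂ F₁] [NormedAddCommGroup F₂] [NormedSpace ℂ F₂] [NormedAddCommGroup F₃]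
    [NormedSpace ℂ F₃] (B : F₁ →L[ℂ] F₂ →L[ℂ] F₃) (K : Rn n → F₁) (g : Rn n → F₂) :
    kernelOp B K g = convolution K g B volume := by
  ext x
  rw [convolution_eq_swap]
  rfl

theorem norm_kernelOp_le {n : ℕ} {F₁ F₂ F₃ : Type*} [NormedAddCommGroup F₁]
    [NormedSpace ℂ F₁] [NormedAddCommGroup F₂] [NormedSpace ℂ F₂] [NormedAddCommGroup F₃]
    [NormedSpace ℂ F₃] {B : F₁ →L[ℂ] F₂ →L[ℂ] F₃} (hB : IsContractive B) {K : Rn n → F₁}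
    {M : ℝ} (hM : ∀ x, ‖K x‖ ≤ M) {g : Rn n → F₂} (hg : Integrable g) (x : Rn n) :
    ‖kernelOp B K g x‖ ≤ M * ∫ y, ‖g y‖ := by
  rw [← integral_const_mul]
  refine norm_integral_le_of_norm_le (hg.norm.const_mul M) (.of_forall fun y => ?_)
  exact (hB _ _).trans (mul_le_mul_of_nonneg_right (hM _) (norm_nonneg _))

section PieceOperator

variable {n : ℕ} {ι : Type*} {F : Finset ι} {g : ι → Rn n → ℂ} {e : ι → ℤ} {M D₁ D₂ : ℝ} {N : ℕ}
  {F₂ F₃ : Type*} [NormedAddCommGroup F₂] [InnerProductSpace ℂ F₂] [CompleteSpace F₂]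
  [NormedAddCommGroup F₃] [InnerProductSpace ℂ F₃] [CompleteSpace F₃]
  {B : EuclideanSpace ℂ F →L[ℂ] F₂ →L[ℂ] F₃}

theorem IsPieceFamily.lintegral_kernelOp_sq_le (h : IsPieceFamily F g e M D₁ D₂ N)
    (hB : IsContractive B) {f : Rn n → F₂} (hf : Integrable f) {R : ℝ} (hR : ∀ x, ‖f x‖ ≤ R) :
    ∫⁻ x, ‖kernelOp B (pieceKernel F g e) f x‖ₑ ^ 2 ≤
      ENNReal.ofReal ((M * (1 + 4 * Real.pi * ballVol n)) ^ 2 * D₁ ^ (-(1 / 4) : ℝ)) *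
        (N * geomSum (1 / 2)) * ∫⁻ x, ‖f x‖ₑ ^ 2 := by
  obtain ⟨A, hA⟩ := h.exists_bound
  have h1 := norm_kernelOp_le hB hA hf
  rw [kernelOp_eq_convolution] at h1 ⊢
  exact lintegral_enorm_convolution_sq_le B hB h.integrable hf (memLp_two_of_bounded hf hR)
    (memLp_two_of_bounded (h.integrable.integrable_convolution B hf) h1) h.enorm_fourier_sq_le

theorem IsPieceFamily.lintegral_kernelOp_rpow_le (h : IsPieceFamily F g e M D₁ D₂ N) (hn : n ≠ 0)
    (hB : IsContractive B) {f : Rn n → F₂} (hf : Integrable f) (hfc : Continuous f)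
    {q α δ : ℝ} (hq : 1 < q) (hq2 : q < 2) (hα : 0 < α) (hδ : 0 < δ) (hδ1 : δ ≤ 1) :
    ∫⁻ x, ‖kernelOp B (pieceKernel F g e) f x‖ₑ ^ q ≤
      czConst n q * (ENNReal.ofReal (α ^ (-q)) +
        ENNReal.ofReal (16 * M * ballVol n * D₂ ^ δ) * (N * geomSum δ) *
          ENNReal.ofReal (α ^ (1 - q)) +
        ENNReal.ofReal ((M * (1 + 4 * Real.pi * ballVol n)) ^ 2 * D₁ ^ (-(1 / 4) : ℝ)) *
          (N * geomSum (1 / 2)) * ENNReal.ofReal (α ^ (2 - q))) * ∫⁻ x, ‖f x‖ₑ ^ q := by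
  obtain ⟨A, hA⟩ := h.exists_bound
  refine _root_.lintegral_kernelOp_rpow_le hn hB h.continuous hA (fun u hu hub => ?_)
    (h.setLIntegral_sub_le hδ hδ1) hf hfc hq hq2 hα
  obtain ⟨R, hR⟩ := hub
  refine h.lintegral_kernelOp_sq_le hB hu (R := R) fun x => ?_
  have := hR x
  rwa [enorm_eq_nnnorm, ENNReal.coe_le_coe, ← NNReal.coe_le_coe, coe_nnnorm] at this

end PieceOperator

/-- Decay in `l` of the `L^q` norm, `1 < q ≤ 2`, of the operators attached to families of
pieces whose frequencies lie between `2 ^ (c * (l - 1))` and `2 ^ (C * l)`. -/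
theorem exists_lintegral_kernelOp_le {n : ℕ} (hn : n ≠ 0) {c C q : ℝ} (hc : 0 < c) (hC : 0 < C)
    (hq : 1 < q) (hq2 : q ≤ 2) (M : ℝ) (N : ℕ) :
    ∃ η > (0 : ℝ), ∃ A : ℝ≥0∞, A ≠ ⊤ ∧ ∀ l : ℤ, 1 ≤ l → ∀ (F : Finset ℤ) (g : ℤ → Rn n → ℂ)
      (e : ℤ → ℤ), IsPieceFamily F g e M (2 ^ (c * (l - 1))) (2 ^ (C * l)) N →
      ∀ (F₂ F₃ : Type) [NormedAddCommGroup F₂] [InnerProductSpace ℂ F₂] [CompleteSpace F₂]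
        [NormedAddCommGroup F₃] [InnerProductSpace ℂ F₃] [CompleteSpace F₃]
        (B : EuclideanSpace ℂ F →L[ℂ] F₂ →L[ℂ] F₃), IsContractive B →
      ∀ f : Rn n → F₂, Integrable f → Continuous f → (∃ R, ∀ x, ‖f x‖ ≤ R) →
        ∫⁻ x, ‖kernelOp B (pieceKernel F g e) f x‖ₑ ^ q ≤
          A * ENNReal.ofReal (2 ^ (-(η * l))) * ∫⁻ x, ‖f x‖ₑ ^ q := by
  have hG := geomSum_ne_top one_half_pos
  rcases hq2.eq_or_lt with rfl | hq2
  · refine ⟨c / 4, by positivity,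
      ENNReal.ofReal ((M * (1 + 4 * Real.pi * ballVol n)) ^ 2 * 2 ^ (c / 4)) *
        (N * geomSum (1 / 2)), ENNReal.mul_ne_top ENNReal.ofReal_ne_top
        (ENNReal.mul_ne_top (ENNReal.natCast_ne_top N) hG), ?_⟩
    intro l hl F g e h F₂ F₃ _ _ _ _ _ _ B hB f hf hfc ⟨R, hR⟩
    have h1 := h.lintegral_kernelOp_sq_le hB hf hR
    simp only [ENNReal.rpow_two]
    refine h1.trans_eq ?_
    rw [mul_right_comm (ENNReal.ofReal _) _ (ENNReal.ofReal _), ← ENNReal.ofReal_mul (by positivity),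
      mul_assoc (_ ^ 2) (2 ^ (c / 4)), ← Real.rpow_add two_pos, ← Real.rpow_mul two_pos.le]
    ring_nf
  · set μ := c / 8 with hμ
    have hμ0 : 0 < μ := by positivity
    have hq1 : 0 < q - 1 := by linarith
    set δ := min 1 (μ * (q - 1) / (2 * C)) with hδ
    have hδ0 : 0 < δ := lt_min one_pos (by positivity)
    have hδ2 : C * δ ≤ μ * (q - 1) / 2 := by
      calc C * δ ≤ C * (μ * (q - 1) / (2 * C)) := by gcongr; exact min_le_right _ _
        _ = _ := by field_simp
    refine ⟨μ * (q - 1) / 2, by positivity, czConst n q * (1 +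
      ENNReal.ofReal (16 * M * ballVol n) * (N * geomSum δ) +
      ENNReal.ofReal ((M * (1 + 4 * Real.pi * ballVol n)) ^ 2 * 2 ^ (c / 4)) *
        (N * geomSum (1 / 2))), ENNReal.mul_ne_top czConst_ne_top (ENNReal.add_ne_top.2
      ⟨ENNReal.add_ne_top.2 ⟨ENNReal.one_ne_top, ENNReal.mul_ne_top ENNReal.ofReal_ne_top
        (ENNReal.mul_ne_top (ENNReal.natCast_ne_top N) (geomSum_ne_top hδ0))⟩,
      ENNReal.mul_ne_top ENNReal.ofReal_ne_top
        (ENNReal.mul_ne_top (ENNReal.natCast_ne_top N) hG)⟩), ?_⟩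
    intro l hl F g e h F₂ F₃ _ _ _ _ _ _ B hB f hf hfc _
    have hl' : (1 : ℝ) ≤ l := mod_cast hl
    refine (h.lintegral_kernelOp_rpow_le hn hB hf hfc hq hq2 (α := 2 ^ (μ * l)) (by positivity)
      hδ0 (min_le_left _ _)).trans (mul_le_mul_left ?_ _)
    rw [mul_assoc (czConst n q)]
    refine mul_le_mul_right ?_ _
    rw [add_mul, add_mul, one_mul]
    refine add_le_add (add_le_add ?_ ?_) ?_
    · refine ENNReal.ofReal_le_ofReal ?_
      rw [← Real.rpow_mul two_pos.le]
      refine Real.rpow_le_rpow_of_exponent_le one_le_two ?_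
      nlinarith [mul_pos hμ0 (show (0 : ℝ) < l by linarith)]
    · rw [mul_right_comm _ _ (ENNReal.ofReal _), mul_right_comm _ _ (ENNReal.ofReal _),
        ENNReal.ofReal_mul' (by positivity), mul_assoc (ENNReal.ofReal (16 * M * ballVol n)),
        ← ENNReal.ofReal_mul (by positivity), ← Real.rpow_mul two_pos.le,
        ← Real.rpow_mul two_pos.le, ← Real.rpow_add two_pos]
      refine mul_le_mul_left (mul_le_mul_right (ENNReal.ofReal_le_ofReal
        (Real.rpow_le_rpow_of_exponent_le one_le_two ?_)) _) _
      nlinarith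
    · rw [mul_right_comm _ _ (ENNReal.ofReal _), mul_right_comm _ _ (ENNReal.ofReal _),
        ← ENNReal.ofReal_mul (by positivity), ← ENNReal.ofReal_mul (by positivity),
        mul_assoc (_ ^ 2), mul_assoc (_ ^ 2), ← Real.rpow_mul two_pos.le,
        ← Real.rpow_mul two_pos.le, ← Real.rpow_add two_pos, ← Real.rpow_add two_pos]
      refine mul_le_mul_left (ENNReal.ofReal_le_ofReal (mul_le_mul_of_nonneg_left
        (Real.rpow_le_rpow_of_exponent_le one_le_two ?_) (by positivity))) _
      have : c = 8 * μ := by rw [hμ]; ring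
      rw [this]
      nlinarith [mul_pos hμ0 (show (0 : ℝ) < l by linarith)]

theorem lintegral_enorm_rpow_ne_top {n : ℕ} {E : Type*} [NormedAddCommGroup E] {f : Rn n → E}
    (hf : Integrable f) {R : ℝ} (hR : ∀ x, ‖f x‖ ≤ R) {p : ℝ} (hp : 1 < p) :
    ∫⁻ x, ‖f x‖ₑ ^ p ≠ ⊤ := by
  have h1 : ∀ x, ‖f x‖ₑ ^ p ≤ ENNReal.ofReal (R ^ (p - 1)) * ‖f x‖ₑ := fun x => by
    rw [← ofReal_norm_rpow _ (by linarith), ← ofReal_norm,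
      ← ENNReal.ofReal_mul' (norm_nonneg _)]
    refine ENNReal.ofReal_le_ofReal ?_
    calc ‖f x‖ ^ p = ‖f x‖ ^ (p - 1) * ‖f x‖ := by
          rw [← Real.rpow_add_one' (norm_nonneg _) (by linarith), sub_add_cancel]
      _ ≤ R ^ (p - 1) * ‖f x‖ := mul_le_mul_of_nonneg_right
          (Real.rpow_le_rpow (norm_nonneg _) (hR x) (by linarith)) (norm_nonneg _)
  refine ne_top_of_le_ne_top ?_ (lintegral_mono h1)
  rw [lintegral_const_mul' _ _ ENNReal.ofReal_ne_top]
  exact ENNReal.mul_ne_top ENNReal.ofReal_ne_top (lintegral_enorm_ne_top hf)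

section Pairings

variable (κ : Type*) [Fintype κ]

/-- The pairing of a vector with a scalar. -/
def smulPairing : EuclideanSpace ℂ κ →L[ℂ] ℂ →L[ℂ] EuclideanSpace ℂ κ :=
  (ContinuousLinearMap.lsmul ℂ ℂ).flip

/-- The bilinear dot product. -/
def dotPairing : EuclideanSpace ℂ κ →L[ℂ] EuclideanSpace ℂ κ →L[ℂ] ℂ :=
  ∑ i, (ContinuousLinearMap.mul ℂ ℂ).bilinearComp
    (EuclideanSpace.proj i : EuclideanSpace ℂ κ →L[ℂ] ℂ)
    (EuclideanSpace.proj i : EuclideanSpace ℂ κ →L[ℂ] ℂ)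

variable {κ}

theorem smulPairing_apply (w : EuclideanSpace ℂ κ) (z : ℂ) : smulPairing κ w z = z • w := rfl

theorem dotPairing_apply (w v : EuclideanSpace ℂ κ) : dotPairing κ w v = ∑ i, w i * v i := by
  simp [dotPairing]

theorem isContractive_smulPairing : IsContractive (smulPairing κ) := fun w z => by
  rw [smulPairing_apply, norm_smul, mul_comm]

theorem isContractive_dotPairing : IsContractive (dotPairing κ) := fun w v => by
  rw [dotPairing_apply, EuclideanSpace.norm_eq, EuclideanSpace.norm_eq]
  refine (norm_sum_le _ _).trans ?_
  simp_rw [norm_mul]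
  exact Real.sum_mul_le_sqrt_mul_sqrt _ _ _

/-- The vector of complex conjugates. -/
def conjVec (v : EuclideanSpace ℂ κ) : EuclideanSpace ℂ κ := WithLp.toLp 2 fun i => star (v i)

theorem continuous_conjVec {ι : Type*} : Continuous (conjVec (κ := ι)) :=
  (PiLp.continuous_toLp 2 _).comp
    (continuous_pi fun i => continuous_star.comp (EuclideanSpace.proj (𝕜 := ℂ) i).continuous)

theorem norm_conjVec (v : EuclideanSpace ℂ κ) : ‖conjVec v‖ = ‖v‖ := by
  simp [EuclideanSpace.norm_eq, conjVec]

theorem dotPairing_conjVec (v : EuclideanSpace ℂ κ) : dotPairing κ v (conjVec v) = (‖v‖ ^ 2 : ℝ) := by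
  rw [dotPairing_apply, EuclideanSpace.norm_sq_eq, Complex.ofReal_sum]
  refine Finset.sum_congr rfl fun i _ => ?_
  change v i * (starRingEnd ℂ) (v i) = _
  rw [Complex.mul_conj, Complex.normSq_eq_norm_sq]

end Pairings

/-- The operator with reflected kernel is the transpose. -/
theorem integral_dotPairing_kernelOp {n : ℕ} {κ : Type*} [Fintype κ]
    {H : Rn n → EuclideanSpace ℂ κ} (hH : Continuous H) {R : ℝ} (hR : ∀ x, ‖H x‖ ≤ R)
    {f : Rn n → ℂ} (hf : Integrable f) {g : Rn n → EuclideanSpace ℂ κ} (hg : Integrable g) :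
    ∫ x, dotPairing κ (kernelOp (smulPairing κ) H f x) (g x) =
      ∫ y, f y * kernelOp (dotPairing κ) (fun x => H (-x)) g y := by
  have h1 : ∀ x, dotPairing κ (kernelOp (smulPairing κ) H f x) (g x) =
      ∫ y, f y * dotPairing κ (H (x - y)) (g x) := fun x => by
    have h2 := ((dotPairing κ).flip (g x)).integral_comp_comm
      (integrable_kernelOp isContractive_smulPairing hH hR hf x)
    rw [kernelOp, ← ContinuousLinearMap.flip_apply, ← h2]
    refine integral_congr_ae (.of_forall fun y => ?_)
    simp [smulPairing_apply]
  have h2 : ∀ y, f y * kernelOp (dotPairing κ) (fun x => H (-x)) g y =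
      ∫ x, f y * dotPairing κ (H (x - y)) (g x) := fun y => by
    rw [kernelOp, ← integral_const_mul]
    simp_rw [neg_sub]
  simp_rw [h1, h2]
  refine integral_integral_swap ?_
  refine ((hg.norm.mul_prod hf.norm).const_mul R).mono' ?_ (.of_forall fun z => ?_)
  · exact (hf.1.comp_snd).mul ((dotPairing κ).aestronglyMeasurable_comp₂
      (hH.comp (by fun_prop)).aestronglyMeasurable hg.1.comp_fst)
  · simp only [Function.uncurry, norm_mul]
    calc ‖f z.2‖ * ‖dotPairing κ (H (z.1 - z.2)) (g z.1)‖ ≤ ‖f z.2‖ * (R * ‖g z.1‖) := by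
          refine mul_le_mul_of_nonneg_left ((isContractive_dotPairing _ _).trans ?_)
            (norm_nonneg _)
          exact mul_le_mul_of_nonneg_right (hR _) (norm_nonneg _)
      _ = _ := by ring

theorem pieceKernel_comp_neg {n : ℕ} {ι : Type*} (F : Finset ι) (g : ι → Rn n → ℂ) (e : ι → ℤ) :
    pieceKernel F (fun k x => g k (-x)) e = fun x => pieceKernel F g e (-x) := by
  ext x k
  simp [pieceKernel, vecKernel, dilate]

theorem IsContractive.integrable_kernelOp {n : ℕ} {F₁ F₂ F₃ : Type*} [NormedAddCommGroup F₁]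
    [NormedSpace ℂ F₁] [NormedAddCommGroup F₂] [NormedSpace ℂ F₂] [NormedAddCommGroup F₃]
    [NormedSpace ℂ F₃] {B : F₁ →L[ℂ] F₂ →L[ℂ] F₃} {K : Rn n → F₁} (hK : Integrable K)
    {f : Rn n → F₂} (hf : Integrable f) : Integrable (kernelOp B K f) := by
  rw [kernelOp_eq_convolution]
  exact hK.integrable_convolution B hf

/-- The function dual to `G` in `L^p`. -/
def dualVec {n : ℕ} {κ : Type*} [Fintype κ] (p : ℝ) (G : Rn n → EuclideanSpace ℂ κ) (x : Rn n) :
    EuclideanSpace ℂ κ := ((‖G x‖ ^ (p - 2) : ℝ) : ℂ) • conjVec (G x)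

section Dual

variable {n : ℕ} {κ : Type*} [Fintype κ] {p : ℝ} {G : Rn n → EuclideanSpace ℂ κ}

theorem norm_dualVec (hp : 2 < p) (x : Rn n) : ‖dualVec p G x‖ = ‖G x‖ ^ (p - 1) := by
  rw [dualVec, norm_smul, norm_conjVec, Complex.norm_real, Real.norm_of_nonneg (by positivity),
    ← Real.rpow_add_one' (norm_nonneg _) (by linarith)]
  ring_nf

theorem continuous_dualVec (hp : 2 < p) (hG : Continuous G) : Continuous (dualVec p G) := by
  refine Continuous.smul (Complex.continuous_ofReal.comp ?_) (continuous_conjVec.comp hG)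
  exact hG.norm.rpow_const fun x => Or.inr (by linarith)

theorem norm_dualVec_le (hp : 2 < p) {R : ℝ} (hR : ∀ x, ‖G x‖ ≤ R) (x : Rn n) :
    ‖dualVec p G x‖ ≤ R ^ (p - 1) := by
  rw [norm_dualVec hp]
  exact Real.rpow_le_rpow (norm_nonneg _) (hR x) (by linarith)

theorem integrable_dualVec (hp : 2 < p) (hG : Continuous G) {R : ℝ} (hR : ∀ x, ‖G x‖ ≤ R)
    (hGi : Integrable G) : Integrable (dualVec p G) := by
  refine (hGi.norm.const_mul (R ^ (p - 2))).mono' (continuous_dualVec hp hG).aestronglyMeasurable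
    (.of_forall fun x => ?_)
  rw [dualVec, norm_smul, norm_conjVec, Complex.norm_real, Real.norm_of_nonneg (by positivity)]
  exact mul_le_mul_of_nonneg_right (Real.rpow_le_rpow (norm_nonneg _) (hR x) (by linarith))
    (norm_nonneg _)

theorem dotPairing_dualVec (hp : 2 < p) (x : Rn n) :
    dotPairing κ (G x) (dualVec p G x) = (‖G x‖ ^ p : ℝ) := by
  rw [dualVec, map_smul, dotPairing_conjVec, smul_eq_mul, ← Complex.ofReal_mul,
    ← Real.rpow_natCast, ← Real.rpow_add_of_nonneg (norm_nonneg _) (by linarith) (by simp)]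
  norm_num

end Dual

/-- Decay of the `L^p` norm of the square function of a family of pieces. -/
theorem exists_lpNorm_kernelOp_le {n : ℕ} (hn : n ≠ 0) {c C p : ℝ} (hc : 0 < c) (hC : 0 < C)
    (hp : 1 < p) (M : ℝ) (N : ℕ) :
    ∃ η > (0 : ℝ), ∃ A : ℝ≥0∞, A ≠ ⊤ ∧ ∀ l : ℤ, 1 ≤ l → ∀ (F : Finset ℤ) (g : ℤ → Rn n → ℂ)
      (e : ℤ → ℤ), IsPieceFamily F g e M (2 ^ (c * (l - 1))) (2 ^ (C * l)) N →
      ∀ f : Rn n → ℂ, Integrable f → Continuous f → (∃ R, ∀ x, ‖f x‖ ≤ R) →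
        (∫⁻ x, ‖kernelOp (smulPairing F) (pieceKernel F g e) f x‖ₑ ^ p) ^ (1 / p) ≤
          A * ENNReal.ofReal (2 ^ (-(η * l))) * (∫⁻ x, ‖f x‖ₑ ^ p) ^ (1 / p) := by
  have hp0 : 0 < p := by linarith
  rcases le_or_gt p 2 with hp2 | hp2
  · obtain ⟨η, hη, A, hA, h⟩ := exists_lintegral_kernelOp_le hn hc hC hp hp2 M N
    refine ⟨η / p, by positivity, A ^ (1 / p), by finiteness, ?_⟩
    intro l hl F g e hF f hf hfc hfb
    have h1 := h l hl F g e hF _ _ _ isContractive_smulPairing f hf hfc hfb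
    refine (ENNReal.rpow_le_rpow h1 (by positivity : 0 ≤ 1 / p)).trans_eq ?_
    rw [ENNReal.mul_rpow_of_nonneg _ _ (by positivity),
      ENNReal.mul_rpow_of_nonneg _ _ (by positivity),
      ENNReal.ofReal_rpow_of_nonneg (by positivity) (by positivity), ← Real.rpow_mul two_pos.le]
    congr 4
    ring
  · set q := p.conjExponent with hq
    have hpq : p.HolderConjugate q := Real.HolderConjugate.conjExponent hp
    have hq0 := hpq.symm.pos
    have hq2 : q ≤ 2 := by
      rw [hq, Real.conjExponent, div_le_iff₀ (by linarith)]
      linarith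
    obtain ⟨η, hη, A, hA, h⟩ := exists_lintegral_kernelOp_le hn hc hC hpq.symm.lt hq2 M N
    refine ⟨η / q, by positivity, A ^ (1 / q), by finiteness, ?_⟩
    intro l hl F g e hF f hf hfc hfb
    obtain ⟨R, hR⟩ := hF.exists_bound
    set G := kernelOp (smulPairing F) (pieceKernel F g e) f with hG
    have hGc : Continuous G := continuous_kernelOp isContractive_smulPairing hF.continuous hR hf
    have hGi : Integrable G := IsContractive.integrable_kernelOp hF.integrable hf
    have hGb := norm_kernelOp_le isContractive_smulPairing hR hf
    set v := dualVec p G with hv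
    have hvc : Continuous v := continuous_dualVec hp2 hGc
    have hvi : Integrable v := integrable_dualVec hp2 hGc hGb hGi
    set T := kernelOp (dotPairing F) (fun x => pieceKernel F g e (-x)) v with hT
    have hTc : Continuous T := continuous_kernelOp isContractive_dotPairing
      (hF.continuous.comp continuous_neg) (fun x => hR (-x)) hvi
    have h1 : ∫⁻ x, ‖T x‖ₑ ^ q ≤ A * ENNReal.ofReal (2 ^ (-(η * l))) * ∫⁻ x, ‖G x‖ₑ ^ p := by
      have h2 := h l hl F _ e hF.comp_neg _ _ _ isContractive_dotPairing v hvi hvc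
        ⟨_, norm_dualVec_le hp2 hGb⟩
      rw [pieceKernel_comp_neg] at h2
      refine h2.trans_eq ?_
      congr 1
      refine lintegral_congr fun x => ?_
      rw [← ofReal_norm_rpow _ hq0.le, ← ofReal_norm_rpow _ hp0.le, norm_dualVec hp2,
        ← Real.rpow_mul (norm_nonneg _), hpq.sub_one_mul_conj]
    have h2 : ∫⁻ x, ‖G x‖ₑ ^ p ≤ ∫⁻ x, ‖f x‖ₑ * ‖T x‖ₑ := by
      have h3 := integral_dotPairing_kernelOp hF.continuous hR hf hvi
      simp_rw [← hG, hv, dotPairing_dualVec hp2] at h3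
      have hi : Integrable fun x => ‖G x‖ ^ p := by
        refine ⟨(hGc.norm.rpow_const fun x => Or.inr hp0.le).aestronglyMeasurable, ?_⟩
        refine (lt_top_iff_ne_top.2 (lintegral_enorm_rpow_ne_top hGi hGb hp)).trans_le' ?_
        refine lintegral_mono fun x => le_of_eq ?_
        rw [Real.enorm_of_nonneg (by positivity), ofReal_norm_rpow _ hp0.le]
      calc ∫⁻ x, ‖G x‖ₑ ^ p = ENNReal.ofReal (∫ x, ‖G x‖ ^ p) := by
            rw [ofReal_integral_eq_lintegral_ofReal hi (.of_forall fun x => by positivity)]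
            simp_rw [ofReal_norm_rpow _ hp0.le]
        _ = ‖∫ x, f x * T x‖ₑ := by
            rw [← hv, ← hT] at h3
            rw [← h3, integral_complex_ofReal, ← ofReal_norm, Complex.norm_real,
              Real.norm_of_nonneg (integral_nonneg fun x => by positivity)]
        _ ≤ _ := by
            refine (enorm_integral_le_lintegral_enorm _).trans_eq ?_
            simp_rw [enorm_mul]
    have h3 := ENNReal.lintegral_mul_le_Lp_mul_Lq volume hpq hfc.enorm.measurable.aemeasurable
      hTc.enorm.measurable.aemeasurable
    set I := ∫⁻ x, ‖G x‖ₑ ^ p with hI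
    have hItop : I ≠ ⊤ := lintegral_enorm_rpow_ne_top hGi hGb hp
    rcases eq_or_ne I 0 with h0 | h0
    · rw [h0, ENNReal.zero_rpow_of_pos (by positivity)]
      exact zero_le
    have hexp : ENNReal.ofReal (2 ^ (-(η * l))) ^ (1 / q) = ENNReal.ofReal (2 ^ (-(η / q * l))) := by
      rw [ENNReal.ofReal_rpow_of_nonneg (by positivity) (by positivity), ← Real.rpow_mul two_pos.le]
      congr 2
      ring
    have h4 : I ≤ A ^ (1 / q) * ENNReal.ofReal (2 ^ (-(η / q * l))) *
        (∫⁻ x, ‖f x‖ₑ ^ p) ^ (1 / p) * I ^ (1 / q) := by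
      refine (h2.trans h3).trans ?_
      refine (mul_le_mul_right (ENNReal.rpow_le_rpow h1 (by positivity : 0 ≤ 1 / q)) _).trans_eq ?_
      rw [ENNReal.mul_rpow_of_nonneg _ _ (by positivity),
        ENNReal.mul_rpow_of_nonneg _ _ (by positivity), hexp]
      ring
    have h5 : I = I ^ (1 / p) * I ^ (1 / q) := by
      rw [← ENNReal.rpow_add _ _ h0 hItop, one_div, one_div, hpq.inv_add_inv_eq_one,
        ENNReal.rpow_one]
    refine (ENNReal.mul_le_mul_iff_left ?_ ?_).1 (h5.symm.trans_le h4)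
    · simp [h0, hItop]
    · finiteness

theorem IsHomCZKernel.map_smul {n : ℕ} {K : Rn n → ℝ} (hK : IsHomCZKernel n K) {a : ℝ}
    (ha : 0 < a) {t : Rn n} (ht : t ≠ 0) : a ^ n * K (a • t) = K t := by
  obtain ⟨Ω, -, hΩ, -, hKΩ⟩ := hK
  have := norm_pos_iff.2 ht
  rw [hKΩ t ht, hKΩ _ (smul_ne_zero ha.ne' ht), hΩ a ha, norm_smul, Real.norm_of_nonneg ha.le]
  field_simp
  ring

theorem dilate_oscKernel {n : ℕ} {K : Rn n → ℝ} (hK : IsHomCZKernel n K) {ψ : ℝ → ℝ}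
    (hψ : IsLPCutoff ψ) (Γ : ℝ → ℝ) (u : ℝ) (j : ℤ) (t : Rn n) :
    dilate (2 ^ (-j)) (oscKernel (fun s => u * Γ (2 ^ j * s)) ψ K) t =
      Complex.exp (Complex.I * Complex.ofReal (u * Γ ‖t‖)) *
        Complex.ofReal (ψ ((2 : ℝ) ^ (-j) * ‖t‖) * K t) := by
  have ha : (0 : ℝ) < 2 ^ (-j) := by positivity
  rw [dilate, oscKernel, norm_smul, Real.norm_of_nonneg ha.le, ← mul_assoc (2 ^ j),
    ← zpow_add₀ two_ne_zero, add_neg_cancel, zpow_zero, one_mul, Complex.real_smul,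
    mul_comm Complex.I]
  rcases eq_or_ne t 0 with rfl | ht
  · have h0 : ψ 0 = 0 := by
      by_contra h
      have := (hψ.2.2.1 0 h).1
      norm_num at this
    simp [h0]
  · rw [← hK.map_smul ha ht]
    push_cast
    ring

theorem kernelOp_smulPairing_pieceKernel {n : ℕ} {ι : Type*} {F : Finset ι} {g : ι → Rn n → ℂ}
    {e : ι → ℤ} {M D₁ D₂ : ℝ} {N : ℕ} (h : IsPieceFamily F g e M D₁ D₂ N) {f : Rn n → ℂ}
    (hf : Integrable f) (x : Rn n) (k : F) :
    kernelOp (smulPairing F) (pieceKernel F g e) f x k =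
      ∫ t, f (x - t) * dilate (2 ^ (-e k)) (g k) t := by
  obtain ⟨R, hR⟩ := h.exists_bound
  have h1 := (EuclideanSpace.proj k : EuclideanSpace ℂ F →L[ℂ] ℂ).integral_comp_comm
    (integrable_kernelOp isContractive_smulPairing h.continuous hR hf x)
  refine h1.symm.trans ?_
  rw [← integral_sub_left_eq_self _ volume x]
  simp only [sub_sub_cancel]
  rfl

theorem PhaseBounds.card_filter_kstar_le {Γ : ℝ → ℝ} {c C σ : ℝ} (h : PhaseBounds Γ c C σ)
    (F : Finset ℤ) (l i : ℤ) : (F.filter fun k => kstar Γ k + l = i).card ≤ ⌈C⌉₊ + 1 := by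
  rcases (F.filter fun k => kstar Γ k + l = i).eq_empty_or_nonempty with h0 | h0
  · simp [h0]
  set a := (F.filter fun k => kstar Γ k + l = i).min' h0 with ha
  have ha' : kstar Γ a + l = i := (Finset.mem_filter.1 (Finset.min'_mem _ h0)).2
  have hsub : (F.filter fun k => kstar Γ k + l = i) ⊆ Finset.Icc a (a + ⌈C⌉₊) := by
    intro k hk
    refine Finset.mem_Icc.2 ⟨Finset.min'_le _ _ hk, ?_⟩
    have h1 := h.sub_lt_of_kstar_eq (k := a) (k' := k)
      (by have := (Finset.mem_filter.1 hk).2; omega)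
    have h2 : (k : ℝ) < a + ⌈C⌉₊ := by linarith [Nat.le_ceil C]
    exact_mod_cast h2.le
  refine (Finset.card_le_card hsub).trans ?_
  rw [Int.card_Icc]
  omega

theorem lpNormENN_tsum_le {n : ℕ} {p : ℝ} (hp : 0 < p) {a : ℤ → Rn n → ℝ≥0∞}
    (ha : ∀ k, Measurable (a k)) {b : ℝ≥0∞}
    (h : ∀ F : Finset ℤ, lpNormENN p (fun x => (∑ k ∈ F, a k x) ^ (1 / 2 : ℝ)) volume ≤ b) :
    lpNormENN p (fun x => (∑' k, a k x) ^ (1 / 2 : ℝ)) volume ≤ b := by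
  have hlim : Tendsto (fun m : ℕ => lpNormENN p
      (fun x => (∑ k ∈ Finset.Icc (-m : ℤ) m, a k x) ^ (1 / 2 : ℝ)) volume) atTop
      (𝓝 (lpNormENN p (fun x => (∑' k, a k x) ^ (1 / 2 : ℝ)) volume)) := by
    refine (ENNReal.continuous_rpow_const.tendsto _).comp ?_
    refine lintegral_tendsto_of_tendsto_of_monotone (fun m => ?_) (.of_forall fun x => ?_)
      (.of_forall fun x => ?_)
    · exact (((Finset.measurable_sum _ fun k _ => ha k).pow_const _).pow_const _).aemeasurable
    · intro m m' hm
      refine ENNReal.rpow_le_rpow (ENNReal.rpow_le_rpow (Finset.sum_le_sum_of_subset ?_)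
        (by norm_num)) hp.le
      exact Finset.Icc_subset_Icc (by simpa using hm) (by simpa using hm)
    · refine (ENNReal.continuous_rpow_const.tendsto _).comp
        ((ENNReal.continuous_rpow_const.tendsto _).comp ?_)
      exact ENNReal.summable.hasSum.comp Finset.tendsto_Icc_neg
  exact le_of_tendsto' hlim fun m => h _

theorem PhaseBounds.isPieceFamily {Γ : ℝ → ℝ} {c C σ : ℝ} (h : PhaseBounds Γ c C σ) {n : ℕ}
    {K : Rn n → ℝ} {ψ : ℝ → ℝ} {M : ℝ}
    (hM : ∀ Φ : ℝ → ℝ, PhaseBounds Φ c C σ → 1 ≤ Φ 1 → IsOscPiece (oscKernel Φ ψ K) M (Φ 1))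
    {l : ℤ} (hl : 1 ≤ l) (F : Finset ℤ) :
    IsPieceFamily F (fun k => oscKernel (fun s => 2 ^ k * Γ (2 ^ (kstar Γ k + l) * s)) ψ K)
      (fun k => kstar Γ k + l) M (2 ^ (c * (l - 1))) (2 ^ (C * l)) (⌈C⌉₊ + 1) where
  one_le := by
    have : (1 : ℝ) ≤ l := mod_cast hl
    exact Real.one_le_rpow one_le_two (mul_nonneg h.c_pos.le (by linarith))
  card := h.card_filter_kstar_le F l
  piece k := by
    have h1 := h.le_frequency k hl
    have h0 : (1 : ℝ) ≤ 2 ^ (c * (l - 1)) := by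
      have : (1 : ℝ) ≤ l := mod_cast hl
      exact Real.one_le_rpow one_le_two (mul_nonneg h.c_pos.le (by linarith))
    refine ⟨_, h1, h.frequency_le k hl, ?_⟩
    have h2 := hM _ (h.scale (u := 2 ^ k) (a := 2 ^ (kstar Γ k + l)) (by positivity)
      (by positivity)) (by simpa using h0.trans h1)
    simpa using h2

theorem Hloc_eq_kernelOp {n : ℕ} {K : Rn n → ℝ} (hK : IsHomCZKernel n K) {ψ : ℝ → ℝ}
    (hψ : IsLPCutoff ψ) {Γ : ℝ → ℝ} {l : ℤ} {F : Finset ℤ} {M D₁ D₂ : ℝ} {N : ℕ}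
    (h : IsPieceFamily F
      (fun k => oscKernel (fun s => 2 ^ k * Γ (2 ^ (kstar Γ k + l) * s)) ψ K)
      (fun k => kstar Γ k + l) M D₁ D₂ N) {f : Rn n → ℂ} (hf : Integrable f) (x : Rn n) (k : F) :
    Hloc Γ K ψ (2 ^ (k : ℤ)) (kstar Γ k + l) f x = kernelOp (smulPairing F)
      (pieceKernel F (fun k => oscKernel (fun s => 2 ^ k * Γ (2 ^ (kstar Γ k + l) * s)) ψ K)
        fun k => kstar Γ k + l) f x k := by
  rw [kernelOp_smulPairing_pieceKernel h hf, Hloc]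
  simp_rw [dilate_oscKernel hK hψ, mul_assoc]

/-- Lemma 4.2: the square-function estimate for the oscillatory pieces. -/
theorem square_function_oscillatory (n : ℕ) (hn : 2 ≤ n) (Γ : ℝ → ℝ) (hΓ : IsGammaU Γ)
    (K : Rn n → ℝ) (hK : IsHomCZKernel n K) (ψ : ℝ → ℝ) (hψ : IsLPCutoff ψ)
    (p : ℝ) (hp : 1 < p) :
    ∃ ε > (0 : ℝ), ∃ C > (0 : ℝ), ∀ l : ℤ, 1 ≤ l → ∀ f : SchwartzMap (Rn n) ℂ,
      lpNormENN p
          (fun x => (∑' k : ℤ,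
            (‖Hloc Γ K ψ ((2 : ℝ) ^ k) (kstar Γ k + l) (⇑f) x‖₊ : ℝ≥0∞) ^ (2 : ℝ))
              ^ (1/2 : ℝ)) volume
        ≤ ENNReal.ofReal (C * (2 : ℝ) ^ (-(ε * (l : ℝ)))) *
            eLpNorm (⇑f) (ENNReal.ofReal p) volume := by
  have hn0 : n ≠ 0 := by omega
  have hp0 : 0 < p := by linarith
  obtain ⟨c, C, σ, hΦ⟩ := hΓ.exists_phaseBounds
  obtain ⟨M, -, hM⟩ := exists_isOscPiece (C := C) (σ := σ) hn0 hK hψ hΦ.c_pos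
  obtain ⟨η, hη, A, hA, h⟩ := exists_lpNorm_kernelOp_le hn0 hΦ.c_pos hΦ.C_pos hp M (⌈C⌉₊ + 1)
  refine ⟨η, hη, A.toReal + 1, by positivity, fun l hl f => ?_⟩
  have hfam := hΦ.isPieceFamily hM hl
  have hcont (k : ℤ) : Continuous (Hloc Γ K ψ (2 ^ k) (kstar Γ k + l) f) := by
    obtain ⟨R, hR⟩ := (hfam {k}).exists_bound
    have h1 := continuous_kernelOp isContractive_smulPairing (hfam {k}).continuous hR f.integrable
    let k' : ({k} : Finset ℤ) := ⟨k, Finset.mem_singleton_self k⟩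
    exact ((EuclideanSpace.proj k' : EuclideanSpace ℂ ({k} : Finset ℤ) →L[ℂ] ℂ).continuous.comp
      h1).congr fun x => (Hloc_eq_kernelOp hK hψ (hfam {k}) f.integrable x k').symm
  refine lpNormENN_tsum_le hp0
    (fun k => ((hcont k).enorm.measurable.pow_const (2 : ℝ))) fun F => ?_
  have h1 := h l hl F _ _ (hfam F) f f.integrable f.continuous
    ⟨_, f.toBoundedContinuousFunction.norm_coe_le_norm⟩
  have h2 : lpNormENN p (fun x => (∑ k ∈ F,
      ‖Hloc Γ K ψ (2 ^ k) (kstar Γ k + l) f x‖ₑ ^ (2 : ℝ)) ^ (1 / 2 : ℝ)) volume =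
      (∫⁻ x, ‖kernelOp (smulPairing F) (pieceKernel F
        (fun k => oscKernel (fun s => 2 ^ k * Γ (2 ^ (kstar Γ k + l) * s)) ψ K)
        fun k => kstar Γ k + l) f x‖ₑ ^ p) ^ (1 / p) := by
    rw [lpNormENN]
    congr 1
    refine lintegral_congr fun x => ?_
    congr 1
    rw [← Finset.sum_coe_sort F]
    simp_rw [Hloc_eq_kernelOp hK hψ (hfam F) f.integrable x, ENNReal.rpow_two]
    rw [← enorm_euclidean_sq, ← ENNReal.rpow_two, ← ENNReal.rpow_mul]
    norm_num
  rw [h2, eLpNorm_eq_lintegral_rpow_enorm_toReal (by simpa using hp0) ENNReal.ofReal_ne_top,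
    ENNReal.toReal_ofReal hp0.le]
  refine h1.trans (mul_le_mul_left ?_ _)
  rw [ENNReal.ofReal_mul (by positivity)]
  refine mul_le_mul_left ?_ _
  rw [← ENNReal.ofReal_toReal hA]
  exact ENNReal.ofReal_le_ofReal (by rw [ENNReal.toReal_ofReal ENNReal.toReal_nonneg]; linarith)
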